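/- Let $n$ be an integer with $5\le n\le 12$. Then there is no function $u\in C^4(\mathbb{R}^n)$ such that $\Delta^2 u = e^u$ on $\mathbb{R}^n$, $u$ is stable outside a compact set, and $\Delta u(x)\to 0$ as $|x|\to\infty$. -/

import Mathlib

open MeasureTheory Metric Filter Set

noncomputable section

/-- Euclidean space `ℝ^n`. -/
abbrev En (n : ℕ) : Type := EuclideanSpace ℝ (Fin n)

/-- The Laplacian of `f` at `x`: the trace of the Hessian,
`Δ f (x) = ∑ i ∂²f/∂xᵢ² (x)`. -/
def lap {m : ℕ} (f : EuclideanSpace ℝ (Fin m) → ℝ) (x : EuclideanSpace ℝ (Fin m)) : ℝ :=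
  ∑ i, fderiv ℝ (fun y => fderiv ℝ f y (EuclideanSpace.single i (1:ℝ))) x
      (EuclideanSpace.single i (1:ℝ))

/-- `φ ∈ C_c^∞(S)`: smooth, compactly supported, with (closed) support contained in `S`. -/
def TestOn (n : ℕ) (S : Set (En n)) (φ : En n → ℝ) : Prop :=
  ContDiff ℝ (⊤ : ℕ∞) φ ∧ HasCompactSupport φ ∧ tsupport φ ⊆ S

/-- `u` is stable outside the ball `B_R` in the fourth-order sense:
`∫ e^u φ² ≤ ∫ (Δφ)²` for all `φ ∈ C_c^∞(ℝ^n \ closure B_R)`. -/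
def Stable4OutsideBall (n : ℕ) (u : En n → ℝ) (R : ℝ) : Prop :=
  ∀ φ : En n → ℝ, TestOn n (Metric.closedBall (0 : En n) R)ᶜ φ →
    ∫ x, Real.exp (u x) * φ x ^ 2 ≤ ∫ x, (lap φ x) ^ 2

/-- The `i`-th partial derivative. -/
def pd {n : ℕ} (i : Fin n) (f : En n → ℝ) (x : En n) : ℝ :=
  fderiv ℝ f x (EuclideanSpace.single i (1 : ℝ))

/-- The pointwise inner product of the gradients of `f` and `g`. -/
def gd {n : ℕ} (f g : En n → ℝ) (x : En n) : ℝ := ∑ i, pd i f x * pd i g x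

section Calculus

variable {n : ℕ}

theorem lap_eq_sum_pd (f : En n → ℝ) (x : En n) : lap f x = ∑ i, pd i (pd i f) x := rfl

theorem contDiff_pd {k : ℕ} {f : En n → ℝ} (hf : ContDiff ℝ (k + 1 : ℕ) f) (i : Fin n) :
    ContDiff ℝ k (pd i f) := by
  have h : ContDiff ℝ k (fderiv ℝ f) := hf.fderiv_right (by norm_cast)
  exact h.clm_apply contDiff_const

theorem contDiff_one_pd {f : En n → ℝ} (hf : ContDiff ℝ 2 f) (i : Fin n) :
    ContDiff ℝ 1 (pd i f) := by
  exact_mod_cast contDiff_pd (k := 1) (by exact_mod_cast hf) i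

theorem continuous_pd {f : En n → ℝ} (hf : ContDiff ℝ 1 f) (i : Fin n) :
    Continuous (pd i f) :=
  (contDiff_pd (k := 0) (by exact_mod_cast hf) i).continuous

theorem continuous_gd {f g : En n → ℝ} (hf : ContDiff ℝ 1 f) (hg : ContDiff ℝ 1 g) :
    Continuous (gd f g) := by
  unfold gd
  exact continuous_finsetSum _ fun i _ => (continuous_pd hf i).mul (continuous_pd hg i)

theorem contDiff_lap {k : ℕ} {f : En n → ℝ} (hf : ContDiff ℝ (k + 2 : ℕ) f) :
    ContDiff ℝ k (lap f) := by
  have : lap f = fun x => ∑ i, pd i (pd i f) x := rfl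
  rw [this]
  exact ContDiff.sum fun i _ => contDiff_pd (contDiff_pd (k := k + 1) hf i) i

theorem continuous_lap {f : En n → ℝ} (hf : ContDiff ℝ 2 f) : Continuous (lap f) :=
  (contDiff_lap (k := 0) (by exact_mod_cast hf)).continuous

theorem pd_mul {f g : En n → ℝ} (hf : Differentiable ℝ f) (hg : Differentiable ℝ g) (i : Fin n) :
    pd i (fun x => f x * g x) = fun x => f x * pd i g x + g x * pd i f x := by
  ext x
  simp only [pd]
  rw [fderiv_fun_mul (hf x) (hg x)]
  simp

theorem pd_add {f g : En n → ℝ} (hf : Differentiable ℝ f) (hg : Differentiable ℝ g) (i : Fin n) :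
    pd i (fun x => f x + g x) = fun x => pd i f x + pd i g x := by
  ext x
  simp only [pd]
  rw [fderiv_fun_add (hf x) (hg x)]
  simp

theorem pd_comp {F : ℝ → ℝ} {F' : ℝ} {f : En n → ℝ} {x : En n} (hf : DifferentiableAt ℝ f x)
    (hF : HasDerivAt F F' (f x)) (i : Fin n) :
    pd i (fun y => F (f y)) x = F' * pd i f x := by
  simp only [pd]
  have := (hF.comp_hasFDerivAt x hf.hasFDerivAt).fderiv
  rw [show (fun y => F (f y)) = F ∘ f from rfl, this]
  simp

theorem lap_mul {f g : En n → ℝ} (hf : ContDiff ℝ 2 f) (hg : ContDiff ℝ 2 g) (x : En n) :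
    lap (fun x => f x * g x) x = f x * lap g x + 2 * gd f g x + g x * lap f x := by
  have hf1 := hf.differentiable (by norm_num)
  have hg1 := hg.differentiable (by norm_num)
  have h2f i := (contDiff_one_pd hf i).differentiable (by norm_num)
  have h2g i := (contDiff_one_pd hg i).differentiable (by norm_num)
  simp only [lap_eq_sum_pd, gd]
  rw [Finset.mul_sum, Finset.mul_sum, Finset.mul_sum, ← Finset.sum_add_distrib,
    ← Finset.sum_add_distrib]
  refine Finset.sum_congr rfl fun i _ => ?_
  rw [pd_mul hf1 hg1, pd_add (hf1.fun_mul (h2g i)) (hg1.fun_mul (h2f i)), pd_mul hf1 (h2g i),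
    pd_mul hg1 (h2f i)]
  ring

theorem gd_comm (f g : En n → ℝ) (x : En n) : gd f g x = gd g f x := by
  simp only [gd, mul_comm]

theorem gd_self_nonneg (f : En n → ℝ) (x : En n) : 0 ≤ gd f f x :=
  Finset.sum_nonneg fun _ _ => mul_self_nonneg _

theorem gd_sq_le (f g : En n → ℝ) (x : En n) : gd f g x ^ 2 ≤ gd f f x * gd g g x := by
  have := Finset.sum_mul_sq_le_sq_mul_sq Finset.univ (fun i => pd i f x) (fun i => pd i g x)
  simpa [gd, sq] using this

theorem gd_mul_left {f g h : En n → ℝ} (hf : Differentiable ℝ f) (hg : Differentiable ℝ g)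
    (x : En n) : gd (fun x => f x * g x) h x = f x * gd g h x + g x * gd f h x := by
  simp only [gd, pd_mul hf hg, Finset.mul_sum, ← Finset.sum_add_distrib]
  exact Finset.sum_congr rfl fun i _ => by ring

theorem gd_mul_right {f g h : En n → ℝ} (hf : Differentiable ℝ f) (hg : Differentiable ℝ g)
    (x : En n) : gd h (fun x => f x * g x) x = f x * gd h g x + g x * gd h f x := by
  rw [gd_comm, gd_mul_left hf hg, gd_comm g, gd_comm f]

theorem gd_comp_left {F : ℝ → ℝ} {F' : ℝ} {f g : En n → ℝ} {x : En n}
    (hf : DifferentiableAt ℝ f x) (hF : HasDerivAt F F' (f x)) :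
    gd (fun y => F (f y)) g x = F' * gd f g x := by
  simp only [gd, pd_comp hf hF, Finset.mul_sum, mul_assoc]

theorem gd_comp_self {F : ℝ → ℝ} {F' : ℝ} {f : En n → ℝ} {x : En n}
    (hf : DifferentiableAt ℝ f x) (hF : HasDerivAt F F' (f x)) :
    gd (fun y => F (f y)) (fun y => F (f y)) x = F' ^ 2 * gd f f x := by
  rw [gd_comp_left hf hF, gd_comm, gd_comp_left hf hF]; ring

theorem lap_comp {F F₁ F₂ : ℝ → ℝ} {f : En n → ℝ} (hf : ContDiff ℝ 2 f)
    (hF : ∀ x, HasDerivAt F (F₁ (f x)) (f x)) (hF₁ : ∀ x, HasDerivAt F₁ (F₂ (f x)) (f x))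
    (x : En n) :
    lap (fun y => F (f y)) x = F₁ (f x) * lap f x + F₂ (f x) * gd f f x := by
  have hf1 := hf.differentiable (by norm_num)
  have h2f i := (contDiff_one_pd hf i).differentiable (by norm_num)
  have e i : pd i (fun y => F (f y)) = fun y => F₁ (f y) * pd i f y := by
    ext y; exact pd_comp (hf1 y) (hF y) i
  have hd : Differentiable ℝ (fun y => F₁ (f y)) := fun y =>
    ((hF₁ y).comp_hasFDerivAt y (hf1 y).hasFDerivAt).differentiableAt
  simp only [lap_eq_sum_pd, gd, Finset.mul_sum, ← Finset.sum_add_distrib]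
  refine Finset.sum_congr rfl fun i _ => ?_
  rw [e, pd_mul hd (h2f i)]
  beta_reduce
  rw [pd_comp (hf1 x) (hF₁ x)]
  ring

theorem pd_comp_smul {f : En n → ℝ} (hf : Differentiable ℝ f) (c : ℝ) (i : Fin n) :
    pd i (fun x => f (c • x)) = fun x => c * pd i f (c • x) := by
  ext x
  simp only [pd]
  have h : HasFDerivAt (fun x : En n => f (c • x))
      ((fderiv ℝ f (c • x)).comp (c • ContinuousLinearMap.id ℝ (En n))) x :=
    (hf (c • x)).hasFDerivAt.comp x ((hasFDerivAt_id x).const_smul c)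
  rw [h.fderiv]
  simp

theorem pd_const_mul {f : En n → ℝ} (hf : Differentiable ℝ f) (c : ℝ) (i : Fin n) :
    pd i (fun x => c * f x) = fun x => c * pd i f x := by
  ext x
  simp only [pd]
  rw [fderiv_const_mul (hf x)]
  simp

theorem lap_comp_smul {f : En n → ℝ} (hf : ContDiff ℝ 2 f) (c : ℝ) (x : En n) :
    lap (fun x => f (c • x)) x = c ^ 2 * lap f (c • x) := by
  have hf1 := hf.differentiable (by norm_num)
  have h2f i := (contDiff_one_pd hf i).differentiable (by norm_num)
  simp only [lap_eq_sum_pd, Finset.mul_sum]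
  refine Finset.sum_congr rfl fun i _ => ?_
  rw [pd_comp_smul hf1, pd_const_mul, pd_comp_smul (h2f i)]
  · ring
  · exact (h2f i).comp (differentiable_id.const_smul c)

theorem gd_comp_smul {f g : En n → ℝ} (hf : Differentiable ℝ f) (hg : Differentiable ℝ g) (c : ℝ)
    (x : En n) :
    gd (fun x => f (c • x)) (fun x => g (c • x)) x = c ^ 2 * gd f g (c • x) := by
  simp only [gd, pd_comp_smul hf, pd_comp_smul hg, Finset.mul_sum]
  exact Finset.sum_congr rfl fun i _ => by ring

theorem pd_norm_sq (i : Fin n) : pd i (fun x : En n => ‖x‖ ^ 2) = fun x => 2 * x i := by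
  ext x
  simp only [pd]
  rw [fderiv_norm_sq_apply]
  simp [PiLp.inner_apply]

theorem gd_norm_sq_left (f : En n → ℝ) (x : En n) :
    gd (fun x => ‖x‖ ^ 2) f x = 2 * fderiv ℝ f x x := by
  unfold gd
  simp only [pd_norm_sq]
  simp only [pd]
  conv_rhs => enter [2, 2]; rw [← (EuclideanSpace.basisFun (Fin n) ℝ).sum_repr x]
  simp [-WithLp.ofLp_sum, Finset.mul_sum, mul_assoc]

theorem gd_norm_sq (x : En n) : gd (fun x : En n => ‖x‖ ^ 2) (fun x => ‖x‖ ^ 2) x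
    = 4 * ‖x‖ ^ 2 := by
  unfold gd
  simp only [pd_norm_sq]
  rw [EuclideanSpace.norm_sq_eq, Finset.mul_sum]
  exact Finset.sum_congr rfl fun i _ => by rw [Real.norm_eq_abs, sq_abs]; ring

theorem lap_norm_sq (x : En n) : lap (fun x : En n => ‖x‖ ^ 2) x = 2 * n := by
  simp only [lap_eq_sum_pd, pd_norm_sq]
  have (i : Fin n) : pd i (fun x : En n => 2 * x i) x = 2 := by
    have h : HasFDerivAt (fun x : En n => 2 * x i) ((2 : ℝ) • EuclideanSpace.proj (𝕜 := ℝ) i) x :=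
      (EuclideanSpace.proj (𝕜 := ℝ) i : En n →L[ℝ] ℝ).hasFDerivAt.const_mul 2
    simp only [pd]
    rw [h.fderiv]
    simp
  simp [this, mul_comm]

theorem gd_self_eq_norm_fderiv_sq (f : En n → ℝ) (x : En n) : gd f f x = ‖fderiv ℝ f x‖ ^ 2 := by
  obtain ⟨w, hw⟩ := (InnerProductSpace.toDual ℝ (En n)).surjective (fderiv ℝ f x)
  have : ∀ i, pd i f x = w i := fun i => by
    simp [pd, ← hw, EuclideanSpace.inner_single_right]
  rw [← hw, LinearIsometryEquiv.norm_map, EuclideanSpace.norm_sq_eq]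
  simp [gd, this, sq]

end Calculus

section IntegrationByParts

variable {n : ℕ}

theorem hasCompactSupport_pd {f : En n → ℝ} (hf : HasCompactSupport f) (i : Fin n) :
    HasCompactSupport (pd i f) :=
  hf.fderiv_apply (𝕜 := ℝ) _

theorem hasCompactSupport_gd_left {f : En n → ℝ} (g : En n → ℝ) (hf : HasCompactSupport f) :
    HasCompactSupport (gd f g) := by
  refine hf.mono' fun x hx => ?_
  by_contra h
  refine hx (Finset.sum_eq_zero fun i _ => ?_)
  have : fderiv ℝ f x = 0 := by
    by_contra h'
    exact h (support_fderiv_subset ℝ h')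
  simp [pd, this]

theorem lap_congr_nhds {f g : En n → ℝ} {x : En n} (h : f =ᶠ[nhds x] g) : lap f x = lap g x := by
  have e (i : Fin n) : pd i f =ᶠ[nhds x] pd i g := by
    filter_upwards [h.fderiv (𝕜 := ℝ)] with z hz
    simp only [pd, hz]
  simp only [lap_eq_sum_pd]
  exact Finset.sum_congr rfl fun i _ => by simp only [pd, (e i).fderiv_eq (𝕜 := ℝ)]

theorem lap_const (c : ℝ) (x : En n) : lap (fun _ => c) x = 0 := by
  have (i : Fin n) : pd i (fun _ : En n => c) = fun _ => 0 := by ext; simp [pd]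
  simp [lap_eq_sum_pd, this, pd]

theorem lap_eq_zero_of_notMem_tsupport {f : En n → ℝ} {x : En n} (hx : x ∉ tsupport f) :
    lap f x = 0 := by
  rw [notMem_tsupport_iff_eventuallyEq] at hx
  rw [lap_congr_nhds (g := fun _ => 0) hx, lap_const]

theorem hasCompactSupport_lap {f : En n → ℝ} (hf : HasCompactSupport f) :
    HasCompactSupport (lap f) :=
  hf.mono' fun _ hx => by
    by_contra h
    exact hx (lap_eq_zero_of_notMem_tsupport h)

/-- Integration by parts: `∫ h Δw = - ∫ ∇w ⬝ ∇h` for compactly supported `h`. -/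
theorem integral_mul_lap {w h : En n → ℝ} (hw : ContDiff ℝ 2 w) (hh : ContDiff ℝ 1 h)
    (hc : HasCompactSupport h) : ∫ x, h x * lap w x = -∫ x, gd w h x := by
  have hw1 := hw.of_le (m := 1) (by norm_num)
  have key (i : Fin n) : ∫ x, h x * pd i (pd i w) x = -∫ x, pd i h x * pd i w x := by
    refine integral_mul_fderiv_eq_neg_fderiv_mul_of_integrable ?_ ?_ ?_ ?_ ?_
    · exact ((continuous_pd hh i).mul (continuous_pd hw1 i)).integrable_of_hasCompactSupport
        (hasCompactSupport_pd hc i).mul_right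
    · exact (hh.continuous.mul (continuous_pd (contDiff_one_pd hw i) i))
        |>.integrable_of_hasCompactSupport hc.mul_right
    · exact (hh.continuous.mul (continuous_pd hw1 i)).integrable_of_hasCompactSupport hc.mul_right
    · exact fun x _ => hh.differentiable (by norm_num) x
    · exact fun x _ => (contDiff_one_pd hw i).differentiable (by norm_num) x
  have e1 : (fun x => h x * lap w x) = fun x => ∑ i, h x * pd i (pd i w) x := by
    ext x; rw [lap_eq_sum_pd, Finset.mul_sum]
  have e2 : (fun x => gd w h x) = fun x => ∑ i, pd i h x * pd i w x := by
    ext x; simp only [gd, mul_comm]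
  rw [e1, e2, integral_finsetSum, integral_finsetSum, ← Finset.sum_neg_distrib]
  · exact Finset.sum_congr rfl fun i _ => key i
  · exact fun i _ => ((continuous_pd hh i).mul (continuous_pd hw1 i)).integrable_of_hasCompactSupport
        (hasCompactSupport_pd hc i).mul_right
  · exact fun i _ => (hh.continuous.mul (continuous_pd (contDiff_one_pd hw i) i))
        |>.integrable_of_hasCompactSupport hc.mul_right

/-- Green's identity, one factor compactly supported. -/
theorem integral_mul_lap_comm {w h : En n → ℝ} (hw : ContDiff ℝ 2 w) (hh : ContDiff ℝ 2 h)
    (hc : HasCompactSupport h) : ∫ x, h x * lap w x = ∫ x, w x * lap h x := by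
  have hw1 := hw.of_le (m := 1) (by norm_num)
  have hh1 := hh.of_le (m := 1) (by norm_num)
  rw [integral_mul_lap hw hh1 hc]
  obtain ⟨r, hr⟩ := hc.isCompact.isBounded.subset_closedBall 0
  let χ : ContDiffBump (0 : En n) := ⟨|r| + 1, |r| + 2, by positivity, by linarith⟩
  have hχ1 : ∀ x ∈ tsupport h, χ x = 1 := fun x hx => χ.one_of_mem_closedBall <|
    closedBall_subset_closedBall (by linarith [le_abs_self r]) (hr hx)
  have hχ : ContDiff ℝ 1 (fun x => χ x * w x) := (χ.contDiff (n := 1)).mul hw1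
  have e : (fun x => w x * lap h x) = fun x => (χ x * w x) * lap h x := by
    ext x
    by_cases hx : x ∈ tsupport h
    · rw [hχ1 x hx, one_mul]
    · simp [lap_eq_zero_of_notMem_tsupport hx]
  rw [e, integral_mul_lap hh hχ χ.hasCompactSupport.mul_right]
  congr 1
  refine integral_congr_ae (Eventually.of_forall fun x => ?_)
  by_cases hx : x ∈ tsupport h
  · beta_reduce
    have : (fun x => χ x * w x) =ᶠ[nhds x] w := by
      have hb : x ∈ ball (0 : En n) (|r| + 1) :=
        closedBall_subset_ball (by linarith [le_abs_self r]) (hr hx)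
      filter_upwards [isOpen_ball.mem_nhds hb] with y hy
      rw [χ.one_of_mem_closedBall (ball_subset_closedBall hy), one_mul]
    rw [gd_comm]
    simp only [gd, pd, this.fderiv_eq]
  · have h1 : fderiv ℝ h x = 0 := by
      by_contra h'
      exact hx (support_fderiv_subset ℝ h')
    simp [gd, pd, h1]

end IntegrationByParts

section Rellich

variable {n : ℕ}

theorem hasCompactSupport_sq {f : En n → ℝ} (hf : HasCompactSupport f) :
    HasCompactSupport (fun x => f x ^ 2) := by
  have := hf.mul_right (f' := f)
  simp only [sq]
  exact this

theorem contDiff_one_add_norm_sq {k : WithTop ℕ∞} :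
    ContDiff ℝ k (fun x : En n => 1 + ‖x‖ ^ 2) :=
  contDiff_const.add (contDiff_norm_sq ℝ)

theorem lap_inv_one_add_norm_sq (x : En n) : lap (fun x : En n => (1 + ‖x‖ ^ 2)⁻¹) x
    = -((1 + ‖x‖ ^ 2) ^ 2)⁻¹ * (2 * n) + 2 * ((1 + ‖x‖ ^ 2) ^ 3)⁻¹ * (4 * ‖x‖ ^ 2) := by
  have hpos (x : En n) : 0 < 1 + ‖x‖ ^ 2 := by positivity
  have := lap_comp (n := n) (F := fun t => (1 + t)⁻¹) (F₁ := fun t => -((1 + t) ^ 2)⁻¹)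
    (F₂ := fun t => 2 * ((1 + t) ^ 3)⁻¹) (f := fun x => ‖x‖ ^ 2) (contDiff_norm_sq ℝ)
    (fun x => ?_) (fun x => ?_) x
  · rw [lap_norm_sq, gd_norm_sq] at this
    exact this
  · have := ((hasDerivAt_id (‖x‖ ^ 2)).const_add 1).inv (hpos x).ne'
    refine this.congr_deriv ?_
    simp [neg_div]
  · have := ((((hasDerivAt_id (‖x‖ ^ 2)).const_add 1).pow 2).inv
      (pow_pos (hpos x) 2).ne').neg
    refine this.congr_deriv ?_
    have := (hpos x).ne'
    simp
    field_simp

theorem rellich_pointwise {N F l g r : ℝ} (hN : 5 ≤ N) (hx : 0 < r) :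
    F ^ 2 / r ^ 2 + 2 * (g / r) ≤ l ^ 2 - (F * F * (-(r ^ 2)⁻¹ * (2 * N)
      + 2 * (r ^ 3)⁻¹ * (4 * (r - 1))) - r⁻¹ * (F * l + 2 * g + F * l)) := by
  set a := F / r with ha
  have hfa : F = a * r := by rw [ha]; field_simp
  have e1 : F ^ 2 / r ^ 2 = a ^ 2 := by rw [ha]; ring
  have e2 : F * F * (-(r ^ 2)⁻¹ * (2 * N) + 2 * (r ^ 3)⁻¹ * (4 * (r - 1)))
      = a ^ 2 * (8 - 2 * N) - 8 * (a ^ 2 / r) := by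
    rw [hfa]; field_simp; ring
  have e3 : r⁻¹ * (F * l + 2 * g + F * l) = 2 * (a * l) + 2 * (g / r) := by
    rw [hfa]; field_simp; ring
  rw [e1, e2, e3]
  have h8 : 0 ≤ a ^ 2 / r := by positivity
  nlinarith [sq_nonneg (a + l), mul_nonneg (sq_nonneg a) (sub_nonneg.2 hN)]

theorem integrable_rellich_weighted {f : En n → ℝ} (hf : ContDiff ℝ 1 f)
    (hc : HasCompactSupport f) :
    Integrable (fun x => f x ^ 2 / (1 + ‖x‖ ^ 2) ^ 2 + 2 * (gd f f x / (1 + ‖x‖ ^ 2))) := by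
  have hpos (x : En n) : 0 < 1 + ‖x‖ ^ 2 := by positivity
  refine Integrable.add ?_ (Integrable.const_mul ?_ 2)
  · have hq := (hf.continuous.pow 2).div (contDiff_one_add_norm_sq (k := 0).continuous.pow 2)
      fun x => (pow_pos (hpos x) 2).ne'
    refine hq.integrable_of_hasCompactSupport ?_
    simp only [div_eq_mul_inv]
    exact (hasCompactSupport_sq hc).mul_right
  · have hq := (continuous_gd hf hf).div (contDiff_one_add_norm_sq (k := 0).continuous)
      fun x => (hpos x).ne'
    refine hq.integrable_of_hasCompactSupport ?_
    simp only [div_eq_mul_inv]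
    exact (hasCompactSupport_gd_left f hc).mul_right

/-- Rellich's inequality with the weight `1 + |x|²`. -/
theorem rellich_weighted (hn : 5 ≤ n) {f : En n → ℝ} (hf : ContDiff ℝ 2 f)
    (hc : HasCompactSupport f) :
    ∫ x, (f x ^ 2 / (1 + ‖x‖ ^ 2) ^ 2 + 2 * (gd f f x / (1 + ‖x‖ ^ 2))) ≤ ∫ x, lap f x ^ 2 := by
  have hpos (x : En n) : 0 < 1 + ‖x‖ ^ 2 := by positivity
  have hf1 := hf.of_le (m := 1) (by norm_num)
  obtain ⟨w, hw, hwc, hlw⟩ : ∃ w : En n → ℝ, (∀ x, w x = (1 + ‖x‖ ^ 2)⁻¹) ∧ ContDiff ℝ 2 w ∧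
      ∀ x, lap w x = -((1 + ‖x‖ ^ 2) ^ 2)⁻¹ * (2 * n)
        + 2 * ((1 + ‖x‖ ^ 2) ^ 3)⁻¹ * (4 * ‖x‖ ^ 2) :=
    ⟨_, fun _ => rfl, contDiff_one_add_norm_sq.inv fun x => (hpos x).ne',
      lap_inv_one_add_norm_sq⟩
  have hff : ContDiff ℝ 2 (fun x => f x * f x) := hf.mul hf
  have hcc : HasCompactSupport (fun x => f x * f x) := hc.mul_right
  have hgreen := integral_mul_lap_comm hwc hff hcc
  have i1 : Integrable (fun x => (f x * f x) * lap w x) :=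
    (hff.continuous.mul (continuous_lap hwc)).integrable_of_hasCompactSupport hcc.mul_right
  have i2 : Integrable (fun x => w x * lap (fun x => f x * f x) x) :=
    (hwc.continuous.mul (continuous_lap hff)).integrable_of_hasCompactSupport
      (hasCompactSupport_lap hcc).mul_left
  have i3 : Integrable (fun x => lap f x ^ 2) :=
    ((continuous_lap hf).pow 2).integrable_of_hasCompactSupport
      (hasCompactSupport_sq (hasCompactSupport_lap hc))
  have i4 := integrable_rellich_weighted hf1 hc
  have i12 : Integrable (fun x => f x * f x * lap w x - w x * lap (fun x => f x * f x) x) :=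
    i1.sub i2
  have hle : ∫ x, (f x ^ 2 / (1 + ‖x‖ ^ 2) ^ 2 + 2 * (gd f f x / (1 + ‖x‖ ^ 2)))
      ≤ ∫ x, (lap f x ^ 2 - ((f x * f x) * lap w x - w x * lap (fun x => f x * f x) x)) := by
    refine integral_mono i4 (i3.sub i12) fun x => ?_
    beta_reduce
    rw [lap_mul hf hf, hlw, hw]
    have hr1 : ‖x‖ ^ 2 = (1 + ‖x‖ ^ 2) - 1 := by ring
    have := rellich_pointwise (F := f x) (l := lap f x) (g := gd f f x)
      (show (5 : ℝ) ≤ n by exact_mod_cast hn) (hpos x)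
    rw [← hr1] at this
    exact this
  refine hle.trans ?_
  rw [integral_sub i3 i12, integral_sub i1 i2, hgreen, sub_self, sub_zero]

theorem exists_bound_derivs_smoothTransition :
    ∃ M : ℝ, 0 < M ∧ (∀ t, |deriv Real.smoothTransition t| ≤ M) ∧
      ∀ t, |deriv (deriv Real.smoothTransition) t| ≤ M := by
  have hT : ContDiff ℝ 2 Real.smoothTransition := Real.smoothTransition.contDiff (n := 2)
  have h1 : ContDiff ℝ 1 (deriv Real.smoothTransition) := hT.deriv' (n := 1)
  have h2 : Continuous (deriv (deriv Real.smoothTransition)) :=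
    (h1.deriv' (n := 0)).continuous
  have z1 : ∀ t ∉ Icc (0 : ℝ) 1, deriv Real.smoothTransition t = 0 := by
    intro t ht
    rw [mem_Icc, not_and_or, not_le, not_le] at ht
    rcases ht with ht | ht
    · have : Real.smoothTransition =ᶠ[nhds t] fun _ => 0 := by
        filter_upwards [Iio_mem_nhds ht] with s hs
        exact Real.smoothTransition.zero_of_nonpos hs.le
      rw [this.deriv_eq, deriv_const]
    · have : Real.smoothTransition =ᶠ[nhds t] fun _ => 1 := by
        filter_upwards [Ioi_mem_nhds ht] with s hs
        exact Real.smoothTransition.one_of_one_le hs.le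
      rw [this.deriv_eq, deriv_const]
  have z2 : ∀ t ∉ Icc (0 : ℝ) 1, deriv (deriv Real.smoothTransition) t = 0 := by
    intro t ht
    have : deriv Real.smoothTransition =ᶠ[nhds t] fun _ => 0 := by
      filter_upwards [isClosed_Icc.isOpen_compl.mem_nhds ht] with s hs using z1 s hs
    rw [this.deriv_eq, deriv_const]
  obtain ⟨M1, hM1⟩ := (isCompact_Icc (a := (0 : ℝ)) (b := 1)).exists_bound_of_continuousOn
    h1.continuous.continuousOn
  obtain ⟨M2, hM2⟩ := (isCompact_Icc (a := (0 : ℝ)) (b := 1)).exists_bound_of_continuousOn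
    h2.continuousOn
  refine ⟨|M1| + |M2| + 1, by positivity, fun t => ?_, fun t => ?_⟩
  · by_cases ht : t ∈ Icc (0 : ℝ) 1
    · have := hM1 t ht
      rw [Real.norm_eq_abs] at this
      linarith [le_abs_self M1, abs_nonneg M2]
    · rw [z1 t ht, abs_zero]; positivity
  · by_cases ht : t ∈ Icc (0 : ℝ) 1
    · have := hM2 t ht
      rw [Real.norm_eq_abs] at this
      linarith [le_abs_self M2, abs_nonneg M1]
    · rw [z2 t ht, abs_zero]; positivity

/-- A cutoff vanishing on a given ball and equal to `1` near infinity that varies slowly on the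
logarithmic scale. -/
theorem exists_log_cutoff (n : ℕ) (R₀ : ℝ) {δ : ℝ} (hδ : 0 < δ) :
    ∃ η : En n → ℝ, ContDiff ℝ (⊤ : ℕ∞) η ∧ (∀ x, 0 ≤ η x ∧ η x ≤ 1) ∧
      tsupport η ⊆ (closedBall 0 R₀)ᶜ ∧ (∃ R₁ : ℝ, ∀ x, R₁ ≤ ‖x‖ → η x = 1) ∧
      (∀ x, gd η η x ≤ δ / (1 + ‖x‖ ^ 2)) ∧ ∀ x, |lap η x| ≤ δ / (1 + ‖x‖ ^ 2) := by
  obtain ⟨M, hM, hM1, hM2⟩ := exists_bound_derivs_smoothTransition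
  set C : ℝ := 4 * M ^ 2 + (2 * n + 8) * M + 1 with hC
  have hCpos : 0 < C := by positivity
  obtain ⟨κ, hκ, hκ1, hκδ⟩ : ∃ κ : ℝ, 0 < κ ∧ κ ≤ 1 ∧ κ * C ≤ δ := by
    refine ⟨min 1 (δ / C), by positivity, min_le_left _ _, ?_⟩
    calc min 1 (δ / C) * C ≤ δ / C * C := by gcongr; exact min_le_right _ _
      _ = δ := by field_simp
  set s₀ : ℝ := κ * Real.log (1 + R₀ ^ 2) + 1 with hs
  have hpos (x : En n) : 0 < 1 + ‖x‖ ^ 2 := by positivity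
  set L : En n → ℝ := fun x => Real.log (1 + ‖x‖ ^ 2) with hL
  have hLc {k : WithTop ℕ∞} : ContDiff ℝ k L := contDiff_one_add_norm_sq.log fun x => (hpos x).ne'
  set T := Real.smoothTransition with hTdef
  have hT : ContDiff ℝ 2 T := Real.smoothTransition.contDiff (n := 2)
  have hT1 : ContDiff ℝ 1 (deriv T) := hT.deriv' (n := 1)
  set η : En n → ℝ := fun x => T (κ * L x - s₀) with hη
  have hηc : ContDiff ℝ (⊤ : ℕ∞) η :=
    (Real.smoothTransition.contDiff (n := ⊤)).comp ((contDiff_const.mul hLc).sub contDiff_const)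
  have gL (x : En n) : gd L L x = ((1 + ‖x‖ ^ 2)⁻¹) ^ 2 * (4 * ‖x‖ ^ 2) := by
    rw [← gd_norm_sq]
    refine gd_comp_self (F := fun t => Real.log (1 + t)) (f := fun x : En n => ‖x‖ ^ 2)
      ((contDiff_norm_sq ℝ (n := 1)).differentiable (by norm_num) x) ?_
    refine (((hasDerivAt_id (‖x‖ ^ 2)).const_add 1).log (hpos x).ne').congr_deriv ?_
    simp
  have lL (x : En n) : lap L x = (1 + ‖x‖ ^ 2)⁻¹ * (2 * n)
      + -((1 + ‖x‖ ^ 2) ^ 2)⁻¹ * (4 * ‖x‖ ^ 2) := by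
    rw [← gd_norm_sq, ← lap_norm_sq x]
    refine lap_comp (F := fun t => Real.log (1 + t)) (F₁ := fun t => (1 + t)⁻¹)
      (F₂ := fun t => -((1 + t) ^ 2)⁻¹) (f := fun x : En n => ‖x‖ ^ 2)
      (contDiff_norm_sq ℝ) (fun x => ?_) (fun x => ?_) x
    · refine (((hasDerivAt_id (‖x‖ ^ 2)).const_add 1).log (hpos x).ne').congr_deriv ?_
      simp
    · refine (((hasDerivAt_id (‖x‖ ^ 2)).const_add 1).inv (hpos x).ne').congr_deriv ?_
      simp [neg_div]
  have hd (t : ℝ) : HasDerivAt (fun t => T (κ * t - s₀)) (κ * deriv T (κ * t - s₀)) t := by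
    have h := (hT.differentiable (by norm_num) (κ * t - s₀)).hasDerivAt
    have := h.comp t (((hasDerivAt_id t).const_mul κ).sub_const s₀)
    exact this.congr_deriv (by simp; ring)
  have hd1 (t : ℝ) : HasDerivAt (fun t => κ * deriv T (κ * t - s₀))
      (κ ^ 2 * deriv (deriv T) (κ * t - s₀)) t := by
    have h := (hT1.differentiable (by norm_num) (κ * t - s₀)).hasDerivAt
    have := (h.comp t (((hasDerivAt_id t).const_mul κ).sub_const s₀)).const_mul κ
    exact this.congr_deriv (by simp; ring)
  have gle (x : En n) : gd L L x ≤ 4 / (1 + ‖x‖ ^ 2) := by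
    rw [gL, inv_pow, ← div_eq_inv_mul, div_le_div_iff₀ (by positivity) (hpos x)]
    nlinarith [hpos x, sq_nonneg ‖x‖]
  refine ⟨η, hηc, fun x => ⟨Real.smoothTransition.nonneg _, Real.smoothTransition.le_one _⟩,
    ?_, ?_, fun x => ?_, fun x => ?_⟩
  · have hcl : IsClosed {x : En n | s₀ ≤ κ * L x} :=
      isClosed_le continuous_const (continuous_const.mul (hLc (k := 0)).continuous)
    refine (closure_minimal ?_ hcl).trans ?_
    · intro x hx
      by_contra h
      refine hx (Real.smoothTransition.zero_of_nonpos ?_)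
      simp only [mem_ofPred_eq, not_le] at h
      linarith
    · intro x hx hx'
      rw [mem_closedBall_zero_iff] at hx'
      have : L x ≤ Real.log (1 + R₀ ^ 2) := Real.log_le_log (hpos x) (by gcongr)
      have : κ * L x ≤ κ * Real.log (1 + R₀ ^ 2) := by gcongr
      simp only [mem_ofPred_eq] at hx
      linarith
  · refine ⟨Real.exp ((s₀ + 1) / κ), fun x hx => Real.smoothTransition.one_of_one_le ?_⟩
    have h1 : Real.exp ((s₀ + 1) / κ) ≤ 1 + ‖x‖ ^ 2 := by nlinarith [sq_nonneg (‖x‖ - 1)]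
    have h2 : (s₀ + 1) / κ ≤ L x := by rwa [hL, Real.le_log_iff_exp_le (hpos x)]
    rw [div_le_iff₀ hκ] at h2
    linarith
  · have e : gd η η x = (κ * deriv T (κ * L x - s₀)) ^ 2 * gd L L x :=
      gd_comp_self (F := fun t => T (κ * t - s₀)) (f := L)
        ((hLc (k := 1)).differentiable (by norm_num) x) (hd _)
    have h1 : (κ * deriv T (κ * L x - s₀)) ^ 2 ≤ κ * M ^ 2 := by
      rw [mul_pow, ← sq_abs (deriv T _)]
      have := hM1 (κ * L x - s₀)
      gcongr
      nlinarith
    calc gd η η x ≤ κ * M ^ 2 * (4 / (1 + ‖x‖ ^ 2)) := by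
          rw [e]; exact mul_le_mul h1 (gle x) (gd_self_nonneg _ _) (by positivity)
      _ = κ * (4 * M ^ 2) / (1 + ‖x‖ ^ 2) := by ring
      _ ≤ δ / (1 + ‖x‖ ^ 2) := by
          gcongr
          refine le_trans ?_ hκδ
          gcongr
          have : 0 ≤ (2 * (n : ℝ) + 8) * M := by positivity
          linarith
  · have e : lap η x = κ * deriv T (κ * L x - s₀) * lap L x
        + κ ^ 2 * deriv (deriv T) (κ * L x - s₀) * gd L L x :=
      lap_comp (F := fun t => T (κ * t - s₀)) (F₁ := fun t => κ * deriv T (κ * t - s₀))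
        (F₂ := fun t => κ ^ 2 * deriv (deriv T) (κ * t - s₀)) (f := L) hLc
        (fun x => hd _) (fun x => hd1 _) x
    have hl : |lap L x| ≤ 2 * n / (1 + ‖x‖ ^ 2) + 4 / (1 + ‖x‖ ^ 2) := by
      have h1 : ((1 + ‖x‖ ^ 2) ^ 2)⁻¹ * (4 * ‖x‖ ^ 2) ≤ 4 / (1 + ‖x‖ ^ 2) := by
        have := gle x
        rwa [gL, inv_pow] at this
      have h0 : 0 ≤ ((1 + ‖x‖ ^ 2) ^ 2)⁻¹ * (4 * ‖x‖ ^ 2) := by positivity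
      have h2 : (1 + ‖x‖ ^ 2)⁻¹ * (2 * n) = 2 * n / (1 + ‖x‖ ^ 2) := by ring
      have h3 : 0 ≤ 2 * (n : ℝ) / (1 + ‖x‖ ^ 2) := by positivity
      rw [lL, h2, abs_le]
      constructor <;> linarith
    have a1 := hM1 (κ * L x - s₀)
    have a2 := hM2 (κ * L x - s₀)
    have hk2 : κ ^ 2 ≤ κ := by nlinarith
    have b1 : |κ * deriv T (κ * L x - s₀) * lap L x|
        ≤ κ * M * (2 * n / (1 + ‖x‖ ^ 2) + 4 / (1 + ‖x‖ ^ 2)) := by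
      rw [abs_mul, abs_mul, abs_of_pos hκ]
      gcongr
    have b2 : |κ ^ 2 * deriv (deriv T) (κ * L x - s₀) * gd L L x|
        ≤ κ * M * (4 / (1 + ‖x‖ ^ 2)) := by
      rw [abs_mul, abs_mul, abs_of_nonneg (sq_nonneg κ), abs_of_nonneg (gd_self_nonneg _ _)]
      have := gle x
      have h0 := gd_self_nonneg L x
      gcongr
    calc |lap η x| ≤ κ * M * (2 * n / (1 + ‖x‖ ^ 2) + 4 / (1 + ‖x‖ ^ 2))
          + κ * M * (4 / (1 + ‖x‖ ^ 2)) := by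
          rw [e]; exact (abs_add_le _ _).trans (add_le_add b1 b2)
      _ = κ * ((2 * n + 8) * M) / (1 + ‖x‖ ^ 2) := by ring
      _ ≤ δ / (1 + ‖x‖ ^ 2) := by
          gcongr
          refine le_trans ?_ hκδ
          gcongr
          have : 0 ≤ 4 * M ^ 2 := by positivity
          linarith

end Rellich

section StableCutoff

variable {n : ℕ}

theorem sq_lap_cutoff_le {τ δ a b e F l g r : ℝ} (hτ : 0 < τ) (hδ : 0 < δ) (hδ1 : δ ≤ 1)
    (hr : 0 < r) (ha0 : 0 ≤ a) (ha : a ≤ 1) (hg : 0 ≤ g) (hb : b ^ 2 ≤ δ / r * g)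
    (he : |e| ≤ δ / r) :
    (a * l + 2 * b + F * e) ^ 2 ≤
      (1 + τ) * l ^ 2 + (1 + 1 / τ) * (8 * δ) * (F ^ 2 / r ^ 2 + 2 * (g / r)) := by
  have h1 : (2 * b + F * e) ^ 2 ≤ 8 * δ * (F ^ 2 / r ^ 2 + 2 * (g / r)) := by
    have h2 : (2 * b + F * e) ^ 2 ≤ 8 * b ^ 2 + 2 * (F ^ 2 * e ^ 2) := by
      nlinarith [sq_nonneg (2 * b - F * e)]
    have h3 : e ^ 2 ≤ δ / r ^ 2 := by
      rw [← sq_abs]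
      calc |e| ^ 2 ≤ (δ / r) ^ 2 := by gcongr
        _ = δ * δ / r ^ 2 := by ring
        _ ≤ δ / r ^ 2 := by gcongr; nlinarith
    have h4 : F ^ 2 * e ^ 2 ≤ F ^ 2 * (δ / r ^ 2) := by gcongr
    have h5 : F ^ 2 * (δ / r ^ 2) = δ * (F ^ 2 / r ^ 2) := by ring
    have h6 : δ / r * g = δ * (g / r) := by ring
    have h7 : 0 ≤ δ * (F ^ 2 / r ^ 2) := by positivity
    have h8 : 0 ≤ δ * (g / r) := by positivity
    nlinarith
  have h2 : (a * l + (2 * b + F * e)) ^ 2 ≤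
      (1 + τ) * (a * l) ^ 2 + (1 + 1 / τ) * (2 * b + F * e) ^ 2 := by
    have : (1 + τ) * (a * l) ^ 2 + (1 + 1 / τ) * (2 * b + F * e) ^ 2
        - (a * l + (2 * b + F * e)) ^ 2 = (τ * (a * l) - (2 * b + F * e)) ^ 2 / τ := by
      field_simp; ring
    have h0 : 0 ≤ (τ * (a * l) - (2 * b + F * e)) ^ 2 / τ := by positivity
    linarith
  have h3 : (a * l) ^ 2 ≤ l ^ 2 := by
    rw [mul_pow]
    have : a ^ 2 ≤ 1 := pow_le_one₀ ha0 ha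
    nlinarith [sq_nonneg l]
  calc (a * l + 2 * b + F * e) ^ 2 = (a * l + (2 * b + F * e)) ^ 2 := by ring
    _ ≤ _ := h2
    _ ≤ (1 + τ) * l ^ 2 + (1 + 1 / τ) * (8 * δ * (F ^ 2 / r ^ 2 + 2 * (g / r))) := by gcongr
    _ = _ := by ring

/-- Stability outside a compact set gives an almost sharp inequality for all test functions,
once the potential is cut off near the origin. -/
theorem exists_cutoff_of_stable (hn : 5 ≤ n) {u : En n → ℝ} {R : ℝ}
    (h : Stable4OutsideBall n u R) {ε : ℝ} (hε : 0 < ε) :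
    ∃ η : En n → ℝ, ContDiff ℝ (⊤ : ℕ∞) η ∧ (∀ x, 0 ≤ η x ∧ η x ≤ 1) ∧
      (∃ R₁ : ℝ, ∀ x, R₁ ≤ ‖x‖ → η x = 1) ∧
      ∀ f : En n → ℝ, ContDiff ℝ (⊤ : ℕ∞) f → HasCompactSupport f →
        ∫ x, Real.exp (u x) * (η x * f x) ^ 2 ≤ (1 + ε) * ∫ x, lap f x ^ 2 := by
  set τ := ε / 2 with hτ
  have hτ0 : 0 < τ := by positivity
  obtain ⟨δ, hδ, hδ1, hδε⟩ : ∃ δ : ℝ, 0 < δ ∧ δ ≤ 1 ∧ (1 + 1 / τ) * (8 * δ) ≤ ε / 2 := by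
    have hK : 0 < (1 + 1 / τ) * 8 := by positivity
    refine ⟨min 1 (ε / 2 / ((1 + 1 / τ) * 8)), by positivity, min_le_left _ _, ?_⟩
    rw [← mul_assoc, ← le_div_iff₀' hK]
    exact min_le_right _ _
  obtain ⟨η, hη, h01, hsupp, hR1, hg, hl⟩ := exists_log_cutoff n R hδ
  refine ⟨η, hη, h01, hR1, fun f hf hc => ?_⟩
  have hηf : HasCompactSupport (fun x => η x * f x) := hc.mul_left
  have hst := h (fun x => η x * f x) ⟨hη.mul hf, hηf,
    (tsupport_mul_subset_left).trans hsupp⟩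
  have hf2 : ContDiff ℝ 2 f := contDiff_infty.1 hf 2
  have hη2 : ContDiff ℝ 2 η := contDiff_infty.1 hη 2
  have hf1 : ContDiff ℝ 1 f := contDiff_infty.1 hf 1
  have i1 : Integrable (fun x => lap (fun x => η x * f x) x ^ 2) :=
    ((continuous_lap (hη2.mul hf2)).pow 2).integrable_of_hasCompactSupport
      (hasCompactSupport_sq (hasCompactSupport_lap hηf))
  have i2 : Integrable (fun x => lap f x ^ 2) :=
    ((continuous_lap hf2).pow 2).integrable_of_hasCompactSupport
      (hasCompactSupport_sq (hasCompactSupport_lap hc))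
  have i3 := integrable_rellich_weighted hf1 hc
  have hpt : ∫ x, lap (fun x => η x * f x) x ^ 2 ≤ ∫ x, ((1 + τ) * lap f x ^ 2
      + (1 + 1 / τ) * (8 * δ) *
        (f x ^ 2 / (1 + ‖x‖ ^ 2) ^ 2 + 2 * (gd f f x / (1 + ‖x‖ ^ 2)))) := by
    refine integral_mono i1 ((i2.const_mul _).add (i3.const_mul _)) fun x => ?_
    beta_reduce
    rw [lap_mul hη2 hf2]
    refine sq_lap_cutoff_le hτ0 hδ hδ1 (by positivity) (h01 x).1 (h01 x).2 (gd_self_nonneg f x)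
      ((gd_sq_le η f x).trans ?_) (hl x)
    exact mul_le_mul_of_nonneg_right (hg x) (gd_self_nonneg f x)
  rw [integral_add (i2.const_mul _) (i3.const_mul _), integral_const_mul, integral_const_mul]
    at hpt
  have hnn : 0 ≤ ∫ x, lap f x ^ 2 := integral_nonneg fun x => sq_nonneg _
  have hrel : (1 + 1 / τ) * (8 * δ) *
      ∫ x, (f x ^ 2 / (1 + ‖x‖ ^ 2) ^ 2 + 2 * (gd f f x / (1 + ‖x‖ ^ 2)))
      ≤ ε / 2 * ∫ x, lap f x ^ 2 :=
    (mul_le_mul_of_nonneg_left (rellich_weighted hn hf2 hc) (by positivity)).trans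
      (mul_le_mul_of_nonneg_right hδε hnn)
  calc _ ≤ _ := hst
    _ ≤ _ := hpt
    _ ≤ (1 + τ) * (∫ x, lap f x ^ 2) + ε / 2 * ∫ x, lap f x ^ 2 := by gcongr
    _ = (1 + ε) * ∫ x, lap f x ^ 2 := by rw [hτ]; ring

end StableCutoff

section Dilation

variable {n : ℕ}

/-- A smooth function supported in the ball of radius `2` and equal to `1` on the unit ball. -/
def unitBump (n : ℕ) : En n → ℝ :=
  (⟨1, 2, by norm_num, by norm_num⟩ : ContDiffBump (0 : En n))

theorem contDiff_unitBump {k : ℕ∞} : ContDiff ℝ k (unitBump n) := ContDiffBump.contDiff _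

theorem unitBump_nonneg (x : En n) : 0 ≤ unitBump n x := ContDiffBump.nonneg _

theorem unitBump_le_one (x : En n) : unitBump n x ≤ 1 := ContDiffBump.le_one _

theorem unitBump_eq_one {x : En n} (hx : ‖x‖ ≤ 1) : unitBump n x = 1 :=
  ContDiffBump.one_of_mem_closedBall _ (by simpa using hx)

theorem unitBump_eq_zero {x : En n} (hx : 2 ≤ ‖x‖) : unitBump n x = 0 :=
  ContDiffBump.zero_of_le_dist _ (by simpa using hx)

theorem hasCompactSupport_unitBump : HasCompactSupport (unitBump n) :=
  ContDiffBump.hasCompactSupport _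

theorem exists_bound_derivs_unitBump (n : ℕ) : ∃ G : ℝ, 1 ≤ G ∧
    (∀ x, gd (unitBump n) (unitBump n) x ≤ G) ∧ ∀ x, |lap (unitBump n) x| ≤ G := by
  obtain ⟨a, ha⟩ := (hasCompactSupport_gd_left (unitBump n)
    (hasCompactSupport_unitBump (n := n))).exists_bound_of_continuous
      (continuous_gd (contDiff_unitBump (k := 1)) (contDiff_unitBump (k := 1)))
  obtain ⟨b, hb⟩ := (hasCompactSupport_lap
    (hasCompactSupport_unitBump (n := n))).exists_bound_of_continuous
      (continuous_lap (contDiff_unitBump (k := 2)))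
  refine ⟨|a| + |b| + 1, by linarith [abs_nonneg a, abs_nonneg b], fun x => ?_, fun x => ?_⟩
  · have := (le_abs_self _).trans (ha x)
    linarith [le_abs_self a, abs_nonneg b]
  · have := hb x
    rw [Real.norm_eq_abs] at this
    linarith [le_abs_self b, abs_nonneg a]

theorem hasCompactSupport_comp_smul {f : En n → ℝ} (hf : HasCompactSupport f) {c : ℝ}
    (hc : c ≠ 0) : HasCompactSupport (fun x => f (c • x)) :=
  hf.comp_homeomorph (Homeomorph.smulOfNeZero c hc)

theorem contDiff_comp_smul {k : WithTop ℕ∞} {f : En n → ℝ} (hf : ContDiff ℝ k f) (c : ℝ) :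
    ContDiff ℝ k (fun x => f (c • x)) :=
  hf.comp (contDiff_const_smul c)

theorem eventually_unitBump_eq_one (r : ℝ) :
    ∀ᶠ k : ℕ in atTop, ∀ x : En n, ‖x‖ ≤ r → unitBump n ((1 / ((k : ℝ) + 1)) • x) = 1 := by
  filter_upwards [eventually_ge_atTop ⌈r⌉₊] with k hk x hx
  refine unitBump_eq_one ?_
  rw [norm_smul, Real.norm_eq_abs, abs_of_pos (by positivity), div_mul_eq_mul_div, one_mul,
    div_le_one (by positivity)]
  have := Nat.ceil_le.1 hk
  linarith

/-- An inequality `∫ (W f)² ≤ ∫ (Δ f)²` for test functions extends to smooth functions with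
square integrable derivatives. -/
theorem integral_sq_le_integral_lap_sq {W : En n → ℝ} (hWc : HasCompactSupport W)
    (hW : ∀ f : En n → ℝ, ContDiff ℝ (⊤ : ℕ∞) f → HasCompactSupport f →
      ∫ x, (W x * f x) ^ 2 ≤ ∫ x, lap f x ^ 2)
    {f : En n → ℝ} (hf : ContDiff ℝ (⊤ : ℕ∞) f) (h0 : Integrable (fun x => f x ^ 2))
    (h1 : Integrable (gd f f)) (h2 : Integrable (fun x => lap f x ^ 2)) :
    ∫ x, (W x * f x) ^ 2 ≤ ∫ x, lap f x ^ 2 := by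
  obtain ⟨r, hr⟩ := hWc.isCompact.isBounded.subset_closedBall 0
  obtain ⟨G, hG1, hG, hL⟩ := exists_bound_derivs_unitBump n
  set χ : ℕ → En n → ℝ := fun k x => unitBump n ((1 / ((k : ℝ) + 1)) • x) with hχ
  have hχs (k : ℕ) : ContDiff ℝ (⊤ : ℕ∞) (χ k) := contDiff_comp_smul contDiff_unitBump _
  have hχc (k : ℕ) : HasCompactSupport (χ k) :=
    hasCompactSupport_comp_smul hasCompactSupport_unitBump (by positivity)
  have hf2 : ContDiff ℝ 2 f := contDiff_infty.1 hf 2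
  have hχ2 (k : ℕ) : ContDiff ℝ 2 (χ k) := contDiff_infty.1 (hχs k) 2
  have hk1 (k : ℕ) : (1 / ((k : ℝ) + 1)) ^ 2 ≤ 1 := by
    refine pow_le_one₀ (by positivity) ?_
    rw [div_le_one (by positivity)]
    linarith [(Nat.cast_nonneg k : (0 : ℝ) ≤ k)]
  have hg (k : ℕ) (x : En n) : gd (χ k) (χ k) x ≤ G := by
    rw [hχ]
    rw [gd_comp_smul ((contDiff_unitBump (k := 1)).differentiable (by norm_num))
      ((contDiff_unitBump (k := 1)).differentiable (by norm_num))]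
    calc _ ≤ 1 * gd (unitBump n) (unitBump n) ((1 / ((k : ℝ) + 1)) • x) :=
          mul_le_mul_of_nonneg_right (hk1 k) (gd_self_nonneg _ _)
      _ ≤ G := by rw [one_mul]; exact hG _
  have hl (k : ℕ) (x : En n) : |lap (χ k) x| ≤ G := by
    rw [hχ]
    rw [lap_comp_smul contDiff_unitBump, abs_mul, abs_of_nonneg (by positivity)]
    calc _ ≤ 1 * |lap (unitBump n) ((1 / ((k : ℝ) + 1)) • x)| :=
          mul_le_mul_of_nonneg_right (hk1 k) (abs_nonneg _)
      _ ≤ G := by rw [one_mul]; exact hL _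
  have hlim : Tendsto (fun k => ∫ x, lap (fun y => χ k y * f y) x ^ 2) atTop
      (nhds (∫ x, lap f x ^ 2)) := by
    refine tendsto_integral_of_dominated_convergence
      (fun x => 3 * (lap f x ^ 2 + 4 * G * gd f f x + G ^ 2 * f x ^ 2)) (fun k => ?_) ?_
      (fun k => Eventually.of_forall fun x => ?_) (Eventually.of_forall fun x => ?_)
    · exact ((continuous_lap ((hχ2 k).mul hf2)).pow 2).aestronglyMeasurable
    · exact ((h2.add (h1.const_mul _)).add (h0.const_mul _)).const_mul 3
    · rw [Real.norm_eq_abs, abs_of_nonneg (sq_nonneg _), lap_mul (hχ2 k) hf2]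
      have a1 : (χ k x * lap f x) ^ 2 ≤ lap f x ^ 2 := by
        rw [mul_pow]
        have : χ k x ^ 2 ≤ 1 := pow_le_one₀ (unitBump_nonneg _) (unitBump_le_one _)
        nlinarith [sq_nonneg (lap f x)]
      have a2 : gd (χ k) f x ^ 2 ≤ G * gd f f x := (gd_sq_le _ _ _).trans
        (mul_le_mul_of_nonneg_right (hg k x) (gd_self_nonneg _ _))
      have a3 : (f x * lap (χ k) x) ^ 2 ≤ G ^ 2 * f x ^ 2 := by
        rw [mul_pow, mul_comm, ← sq_abs (lap _ x)]
        have := hl k x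
        gcongr
      nlinarith [sq_nonneg (χ k x * lap f x - 2 * gd (χ k) f x),
        sq_nonneg (χ k x * lap f x - f x * lap (χ k) x),
        sq_nonneg (2 * gd (χ k) f x - f x * lap (χ k) x)]
    · refine tendsto_const_nhds.congr' ?_
      filter_upwards [eventually_unitBump_eq_one (n := n) (‖x‖ + 1)] with k hk
      rw [lap_congr_nhds (f := fun y => χ k y * f y) (g := f)]
      filter_upwards [ball_mem_nhds x one_pos] with y hy
      rw [hχ]
      beta_reduce
      rw [hk y, one_mul]
      have := norm_le_norm_add_norm_sub' y x
      rw [mem_ball, dist_eq_norm] at hy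
      linarith
  refine ge_of_tendsto hlim ?_
  filter_upwards [eventually_unitBump_eq_one (n := n) r] with k hk
  refine le_trans (le_of_eq ?_) (hW _ ((hχs k).mul hf) (hχc k).mul_right)
  refine integral_congr_ae (Eventually.of_forall fun x => ?_)
  beta_reduce
  by_cases hx : x ∈ tsupport W
  · rw [hχ]
    beta_reduce
    rw [hk x (by simpa using hr hx), one_mul]
  · rw [image_eq_zero_of_notMem_tsupport hx, zero_mul, zero_mul]

end Dilation

section FourierSide

open scoped SchwartzMap FourierTransform LineDeriv Laplacian

variable {n : ℕ}

theorem fourier_fourierMultiplierCLM_apply {g : En n → ℝ} (hg : g.HasTemperateGrowth)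
    (f : 𝓢(En n, ℂ)) (ξ : En n) :
    𝓕 (SchwartzMap.fourierMultiplierCLM ℂ g f) ξ = g ξ • 𝓕 f ξ := by
  rw [SchwartzMap.fourierMultiplierCLM_apply, FourierTransform.fourier_fourierInv_eq,
    SchwartzMap.smulLeftCLM_apply_apply hg]

theorem fourier_laplacian_apply (f : 𝓢(En n, ℂ)) (ξ : En n) :
    𝓕 (Δ f) ξ = -((2 * Real.pi) ^ 2 * ‖ξ‖ ^ 2) • 𝓕 f ξ := by
  have hg : (fun ξ : En n => ‖ξ‖ ^ 2).HasTemperateGrowth := by fun_prop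
  have := fourier_fourierMultiplierCLM_apply hg f ξ
  rw [SchwartzMap.laplacian_eq_fourierMultiplierCLM, FourierTransform.fourier_smul,
    smul_apply, neg_mul_eq_neg_mul, mul_smul]
  congr 1

theorem norm_fourier_lineDeriv_sq (f : 𝓢(En n, ℂ)) (m ξ : En n) :
    ‖𝓕 (∂_{m} f) ξ‖ ^ 2 = (2 * Real.pi) ^ 2 * inner ℝ ξ m ^ 2 * ‖𝓕 f ξ‖ ^ 2 := by
  have hg : (fun ξ : En n => inner ℝ ξ m).HasTemperateGrowth := by fun_prop
  rw [SchwartzMap.fourier_lineDerivOp_eq, smul_apply,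
    SchwartzMap.smulLeftCLM_apply_apply hg, norm_smul, norm_smul, mul_pow, mul_pow,
    Real.norm_eq_abs, sq_abs]
  simp [abs_of_pos Real.pi_pos]
  ring

theorem integrable_norm_sq (f : 𝓢(En n, ℂ)) : Integrable (fun x => ‖f x‖ ^ 2) := by
  have := (f.memLp 2).integrable_norm_pow (by norm_num)
  simpa using this

/-- `∫ |∇f|²` on the Fourier side. -/
theorem sum_integral_norm_lineDeriv_sq (f : 𝓢(En n, ℂ)) :
    Integrable (fun ξ => (2 * Real.pi) ^ 2 * ‖ξ‖ ^ 2 * ‖𝓕 f ξ‖ ^ 2) ∧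
    ∫ ξ, (2 * Real.pi) ^ 2 * ‖ξ‖ ^ 2 * ‖𝓕 f ξ‖ ^ 2 =
      ∑ i, ∫ x, ‖fderiv ℝ f x (EuclideanSpace.single i (1 : ℝ))‖ ^ 2 := by
  have e : (fun ξ => (2 * Real.pi) ^ 2 * ‖ξ‖ ^ 2 * ‖𝓕 f ξ‖ ^ 2) = fun ξ =>
      ∑ i : Fin n, ‖𝓕 (∂_{EuclideanSpace.single i (1 : ℝ)} f) ξ‖ ^ 2 := by
    ext ξ
    simp only [norm_fourier_lineDeriv_sq]
    rw [← Finset.sum_mul, ← Finset.mul_sum, EuclideanSpace.norm_sq_eq]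
    simp [EuclideanSpace.inner_single_right]
  rw [e]
  refine ⟨integrable_finsetSum _ fun i _ => integrable_norm_sq _, ?_⟩
  rw [integral_finsetSum _ fun i _ => integrable_norm_sq _]
  refine Finset.sum_congr rfl fun i _ => ?_
  rw [SchwartzMap.integral_norm_sq_fourier]
  rfl

theorem integral_sq_le_of_clm {W : En n → ℝ} (hWc : HasCompactSupport W)
    (hW : ∀ f : En n → ℝ, ContDiff ℝ (⊤ : ℕ∞) f → HasCompactSupport f →
      ∫ x, (W x * f x) ^ 2 ≤ ∫ x, lap f x ^ 2) (f : 𝓢(En n, ℂ)) (ℓ : ℂ →L[ℝ] ℝ)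
    (hℓ : ∀ z, |ℓ z| ≤ ‖z‖) :
    Integrable (fun x => ℓ (Δ f x) ^ 2) ∧
      ∫ x, (W x * ℓ (f x)) ^ 2 ≤ ∫ x, ℓ (Δ f x) ^ 2 := by
  have hint (h : 𝓢(En n, ℂ)) : Integrable (fun x => ℓ (h x) ^ 2) := by
    refine (integrable_norm_sq h).mono'
      ((ℓ.continuous.comp h.continuous).pow 2).aestronglyMeasurable
      (Eventually.of_forall fun x => ?_)
    rw [Real.norm_eq_abs, abs_pow]
    have := hℓ (h x)
    gcongr
  have hpd (h : 𝓢(En n, ℂ)) (i : Fin n) : pd i (fun x => ℓ (h x)) =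
      fun x => ℓ ((∂_{EuclideanSpace.single i (1 : ℝ)} h) x) := by
    ext x
    have := (ℓ.hasFDerivAt.comp x h.differentiableAt.hasFDerivAt).fderiv
    simp only [pd]
    rw [show (fun x => ℓ (h x)) = ℓ ∘ h from rfl, this]
    rfl
  have hlap : lap (fun x => ℓ (f x)) = fun x => ℓ (Δ f x) := by
    ext x
    rw [lap_eq_sum_pd, SchwartzMap.laplacian_eq_sum (EuclideanSpace.basisFun (Fin n) ℝ),
      sum_apply, map_sum]
    simp only [hpd, EuclideanSpace.basisFun_apply]
  have hs : ContDiff ℝ (⊤ : ℕ∞) (fun x => ℓ (f x)) := ℓ.contDiff.comp (f.smooth ⊤)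
  have h := integral_sq_le_integral_lap_sq hWc hW hs (hint f) ?_ ?_
  · refine ⟨hint _, ?_⟩
    rwa [hlap] at h
  · have : gd (fun x => ℓ (f x)) (fun x => ℓ (f x)) = fun x =>
        ∑ i : Fin n, ℓ ((∂_{EuclideanSpace.single i (1 : ℝ)} f : 𝓢(En n, ℂ)) x) ^ 2 := by
      ext x
      simp only [gd, hpd, sq]
    rw [this]
    exact integrable_finsetSum _ fun i _ => hint _
  · rw [hlap]
    exact hint _

theorem integral_sq_le_schwartz {W : En n → ℝ} (hWcont : Continuous W) (hWc : HasCompactSupport W)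
    (hW : ∀ f : En n → ℝ, ContDiff ℝ (⊤ : ℕ∞) f → HasCompactSupport f →
      ∫ x, (W x * f x) ^ 2 ≤ ∫ x, lap f x ^ 2) (f : 𝓢(En n, ℂ)) :
    ∫ x, W x ^ 2 * ‖f x‖ ^ 2 ≤ ∫ x, ‖Δ f x‖ ^ 2 := by
  obtain ⟨i1, h1⟩ := integral_sq_le_of_clm hWc hW f Complex.reCLM Complex.abs_re_le_norm
  obtain ⟨i2, h2⟩ := integral_sq_le_of_clm hWc hW f Complex.imCLM Complex.abs_im_le_norm
  have hc (ℓ : ℂ →L[ℝ] ℝ) : Integrable (fun x => (W x * ℓ (f x)) ^ 2) :=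
    ((hWcont.mul (ℓ.continuous.comp f.continuous)).pow 2).integrable_of_hasCompactSupport
      (hasCompactSupport_sq hWc.mul_right)
  have hz (z : ℂ) : ‖z‖ ^ 2 = Complex.reCLM z ^ 2 + Complex.imCLM z ^ 2 := by
    rw [← Complex.normSq_eq_norm_sq, Complex.normSq_apply]
    simp [sq]
  have e1 : ∫ x, W x ^ 2 * ‖f x‖ ^ 2 =
      (∫ x, (W x * Complex.reCLM (f x)) ^ 2) + ∫ x, (W x * Complex.imCLM (f x)) ^ 2 := by
    rw [← integral_add (hc _) (hc _)]
    refine integral_congr_ae (Eventually.of_forall fun x => ?_)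
    beta_reduce
    rw [hz]; ring
  have e2 : ∫ x, ‖Δ f x‖ ^ 2 =
      (∫ x, Complex.reCLM (Δ f x) ^ 2) + ∫ x, Complex.imCLM (Δ f x) ^ 2 := by
    rw [← integral_add i1 i2]
    exact integral_congr_ae (Eventually.of_forall fun x => hz _)
  rw [e1, e2]
  exact add_le_add h1 h2

end FourierSide

section Interpolation

open scoped SchwartzMap FourierTransform LineDeriv Laplacian

variable {n : ℕ}

theorem lintegral_sq_div_sq_add_sq {a : ℝ} (ha : 0 ≤ a) :
    ∫⁻ t : ℝ, ENNReal.ofReal (a ^ 2 / (t ^ 2 + a ^ 2)) = ENNReal.ofReal (Real.pi * a) := by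
  rcases ha.eq_or_lt with rfl | ha
  · simp
  have e : (fun t : ℝ => a ^ 2 / (t ^ 2 + a ^ 2)) = fun t => (1 + (a⁻¹ * t) ^ 2)⁻¹ := by
    ext t; field_simp; ring
  rw [← ofReal_integral_eq_lintegral_ofReal, e,
    Measure.integral_comp_mul_left (fun t : ℝ => (1 + t ^ 2)⁻¹), integral_univ_inv_one_add_sq]
  · congr 1
    rw [inv_inv, abs_of_pos ha, smul_eq_mul, mul_comm]
  · rw [e]
    exact integrable_inv_one_add_sq.comp_mul_left' (by positivity)
  · exact Eventually.of_forall fun t => by positivity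

theorem lintegral_lintegral_sq_div {ψ b : En n → ℝ} (hψ : Continuous ψ) (hb : Continuous b)
    (hb0 : ∀ x, 0 ≤ b x) :
    ∫⁻ t : ℝ, ∫⁻ x, ENNReal.ofReal (b x ^ 2 / (t ^ 2 + b x ^ 2) * ψ x)
      = ENNReal.ofReal Real.pi * ∫⁻ x, ENNReal.ofReal (b x * ψ x) := by
  rw [lintegral_lintegral_swap, ← lintegral_const_mul]
  · refine lintegral_congr fun x => ?_
    have (t : ℝ) : ENNReal.ofReal (b x ^ 2 / (t ^ 2 + b x ^ 2) * ψ x)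
        = ENNReal.ofReal (b x ^ 2 / (t ^ 2 + b x ^ 2)) * ENNReal.ofReal (ψ x) :=
      ENNReal.ofReal_mul (by positivity)
    simp only [this]
    rw [lintegral_mul_const, lintegral_sq_div_sq_add_sq (hb0 x),
      ← ENNReal.ofReal_mul (by have := hb0 x; positivity),
      ← ENNReal.ofReal_mul Real.pi_pos.le, mul_assoc]
    fun_prop
  · fun_prop
  · have h1 : Measurable fun p : ℝ × En n => b p.2 := hb.measurable.comp measurable_snd
    have h2 : Measurable fun p : ℝ × En n => ψ p.2 := hψ.measurable.comp measurable_snd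
    have h3 : Measurable fun p : ℝ × En n => p.1 := measurable_fst
    exact (((h1.pow_const 2).div ((h3.pow_const 2).add (h1.pow_const 2))).mul
      h2).ennreal_ofReal.aemeasurable

theorem interpolation_pointwise {t w : ℝ} (ht : t ≠ 0) (a b : ℂ) :
    w ^ 2 / (t ^ 2 + w ^ 2) * ‖a‖ ^ 2 ≤ (t ^ 2)⁻¹ * (w ^ 2 * ‖b‖ ^ 2) + ‖a - b‖ ^ 2 := by
  have h : ‖a‖ ≤ ‖b‖ + ‖a - b‖ := by
    simpa using norm_add_le b (a - b)
  have h2 : ‖a‖ ^ 2 ≤ (‖b‖ + ‖a - b‖) ^ 2 := by gcongr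
  have ht2 : 0 < t ^ 2 := by positivity
  have e : (t ^ 2)⁻¹ * (w ^ 2 * ‖b‖ ^ 2) + ‖a - b‖ ^ 2
      - w ^ 2 / (t ^ 2 + w ^ 2) * (‖b‖ + ‖a - b‖) ^ 2
      = (w ^ 2 * ‖b‖ - t ^ 2 * ‖a - b‖) ^ 2 / (t ^ 2 * (t ^ 2 + w ^ 2)) := by
    field_simp; ring
  have e0 : 0 ≤ (w ^ 2 * ‖b‖ - t ^ 2 * ‖a - b‖) ^ 2 / (t ^ 2 * (t ^ 2 + w ^ 2)) := by
    positivity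
  have h3 : w ^ 2 / (t ^ 2 + w ^ 2) * ‖a‖ ^ 2
      ≤ w ^ 2 / (t ^ 2 + w ^ 2) * (‖b‖ + ‖a - b‖) ^ 2 := by gcongr
  linarith

theorem hasTemperateGrowth_resolvent (c : ℝ) :
    (fun ξ : En n => (1 + (c * ‖ξ‖ ^ 2) ^ 2)⁻¹).HasTemperateGrowth := by
  have h1 := Function.hasTemperateGrowth_one_add_norm_sq_rpow (H := ℝ) (-1)
  have h2 : (fun ξ : En n => c * ‖ξ‖ ^ 2).HasTemperateGrowth := by fun_prop
  have h3 := h1.comp h2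
  refine (congrArg _ ?_).mp h3
  ext ξ
  simp [Real.rpow_neg_one]

theorem integral_resolvent_le {W : En n → ℝ} (hWcont : Continuous W) (hWc : HasCompactSupport W)
    (hW : ∀ f : En n → ℝ, ContDiff ℝ (⊤ : ℕ∞) f → HasCompactSupport f →
      ∫ x, (W x * f x) ^ 2 ≤ ∫ x, lap f x ^ 2) (f : 𝓢(En n, ℂ)) {t : ℝ} (ht : t ≠ 0) :
    ∫ x, W x ^ 2 / (t ^ 2 + W x ^ 2) * ‖f x‖ ^ 2 ≤
      ∫ ξ, ((2 * Real.pi) ^ 2 * ‖ξ‖ ^ 2) ^ 2 / (t ^ 2 + ((2 * Real.pi) ^ 2 * ‖ξ‖ ^ 2) ^ 2)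
        * ‖𝓕 f ξ‖ ^ 2 := by
  have ht2 : 0 < t ^ 2 := by positivity
  set m : En n → ℝ := fun ξ => (1 + ((2 * Real.pi) ^ 2 / t * ‖ξ‖ ^ 2) ^ 2)⁻¹ with hm
  have hmg : m.HasTemperateGrowth := hasTemperateGrowth_resolvent _
  set g := SchwartzMap.fourierMultiplierCLM ℂ m f with hg
  have hpos (x : En n) : 0 < t ^ 2 + W x ^ 2 := by positivity
  have i1 : Integrable (fun x => (t ^ 2)⁻¹ * (W x ^ 2 * ‖g x‖ ^ 2)) :=
    (((hWcont.pow 2).mul (g.continuous.norm.pow 2)).integrable_of_hasCompactSupport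
      (hasCompactSupport_sq hWc).mul_right).const_mul _
  have i2 : Integrable (fun x => ‖f x - g x‖ ^ 2) := integrable_norm_sq (f - g)
  have i0 : Integrable (fun x => W x ^ 2 / (t ^ 2 + W x ^ 2) * ‖f x‖ ^ 2) := by
    have hq := ((hWcont.pow 2).div (continuous_const.add (hWcont.pow 2))
      fun x => (hpos x).ne').mul (f.continuous.norm.pow 2)
    refine hq.integrable_of_hasCompactSupport ?_
    simp only [div_eq_mul_inv]
    exact (hasCompactSupport_sq hWc).mul_right.mul_right
  have h1 : ∫ x, W x ^ 2 / (t ^ 2 + W x ^ 2) * ‖f x‖ ^ 2 ≤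
      ∫ x, ((t ^ 2)⁻¹ * (W x ^ 2 * ‖g x‖ ^ 2) + ‖f x - g x‖ ^ 2) :=
    integral_mono i0 (i1.add i2) fun x => interpolation_pointwise ht _ _
  rw [integral_add i1 i2, integral_const_mul] at h1
  have h2 := integral_sq_le_schwartz hWcont hWc hW g
  have h3 : ∫ x, ‖f x - g x‖ ^ 2 = ∫ ξ, ‖𝓕 (f - g) ξ‖ ^ 2 :=
    (SchwartzMap.integral_norm_sq_fourier (f - g)).symm
  rw [← SchwartzMap.integral_norm_sq_fourier] at h2
  have hsub : 𝓕 (f - g) = 𝓕 f - 𝓕 g := map_sub (FourierTransform.fourierCLM ℂ 𝓢(En n, ℂ)) f g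
  have h4 : (t ^ 2)⁻¹ * (∫ ξ, ‖𝓕 (Δ g) ξ‖ ^ 2) + ∫ ξ, ‖𝓕 (f - g) ξ‖ ^ 2 =
      ∫ ξ, ((2 * Real.pi) ^ 2 * ‖ξ‖ ^ 2) ^ 2 / (t ^ 2 + ((2 * Real.pi) ^ 2 * ‖ξ‖ ^ 2) ^ 2)
        * ‖𝓕 f ξ‖ ^ 2 := by
    rw [← integral_const_mul, ← integral_add ((integrable_norm_sq _).const_mul _)
      (integrable_norm_sq _)]
    refine integral_congr_ae (Eventually.of_forall fun ξ => ?_)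
    beta_reduce
    rw [fourier_laplacian_apply, hsub, sub_apply, hg,
      fourier_fourierMultiplierCLM_apply hmg]
    set A := (2 * Real.pi) ^ 2 * ‖ξ‖ ^ 2 with hA
    have hmA : m ξ = t ^ 2 / (t ^ 2 + A ^ 2) := by
      rw [hm, hA]; field_simp
    have hA0 : 0 < t ^ 2 + A ^ 2 := by positivity
    have e1 : 𝓕 f ξ - m ξ • 𝓕 f ξ = (1 - m ξ) • 𝓕 f ξ := by rw [sub_smul, one_smul]
    rw [e1, norm_smul, norm_smul, norm_smul, mul_pow, mul_pow, mul_pow]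
    simp only [Real.norm_eq_abs, sq_abs]
    rw [hmA]
    field_simp
    ring
  rw [h3] at h1
  rw [← h4]
  refine h1.trans ?_
  gcongr

/-- The square root of the operator inequality `W² ≤ Δ²`. -/
theorem integral_mul_sq_le_integral_gd {W : En n → ℝ} (hWcont : Continuous W)
    (hW0 : ∀ x, 0 ≤ W x) (hWc : HasCompactSupport W)
    (hW : ∀ f : En n → ℝ, ContDiff ℝ (⊤ : ℕ∞) f → HasCompactSupport f →
      ∫ x, (W x * f x) ^ 2 ≤ ∫ x, lap f x ^ 2)
    {φ : En n → ℝ} (hφ : ContDiff ℝ (⊤ : ℕ∞) φ) (hc : HasCompactSupport φ) :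
    ∫ x, W x * φ x ^ 2 ≤ ∫ x, gd φ φ x := by
  have hcs : HasCompactSupport (fun x => (φ x : ℂ)) :=
    hc.comp_left (g := ((↑) : ℝ → ℂ)) Complex.ofReal_zero
  set f : 𝓢(En n, ℂ) := hcs.toSchwartzMap (Complex.ofRealCLM.contDiff.comp hφ) with hf
  have hfx (x : En n) : f x = (φ x : ℂ) := rfl
  obtain ⟨iA, hA⟩ := sum_integral_norm_lineDeriv_sq f
  set A : En n → ℝ := fun ξ => (2 * Real.pi) ^ 2 * ‖ξ‖ ^ 2 with hAdef
  have hAc : Continuous A := by fun_prop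
  have hA0 (ξ) : 0 ≤ A ξ := by positivity
  have hgrad : ∫ ξ, A ξ * ‖𝓕 f ξ‖ ^ 2 = ∫ x, gd φ φ x := by
    have hφ1 : ContDiff ℝ 1 φ := contDiff_infty.1 hφ 1
    rw [hA]
    unfold gd
    have ig (i : Fin n) : Integrable (fun x => pd i φ x * pd i φ x) :=
      ((continuous_pd hφ1 i).mul (continuous_pd hφ1 i)).integrable_of_hasCompactSupport
        (hasCompactSupport_pd hc i).mul_right
    rw [integral_finsetSum _ fun i _ => ig i]
    refine Finset.sum_congr rfl fun i _ => integral_congr_ae (Eventually.of_forall fun x => ?_)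
    beta_reduce
    have := (Complex.ofRealCLM.hasFDerivAt.comp x
      (hφ1.differentiable (by norm_num) x).hasFDerivAt).fderiv
    rw [show (⇑f : En n → ℂ) = Complex.ofRealCLM ∘ φ from rfl, this]
    simp [pd, sq]
  have key : ∫⁻ t : ℝ, ∫⁻ x, ENNReal.ofReal (W x ^ 2 / (t ^ 2 + W x ^ 2) * ‖f x‖ ^ 2) ≤
      ∫⁻ t : ℝ, ∫⁻ ξ, ENNReal.ofReal (A ξ ^ 2 / (t ^ 2 + A ξ ^ 2) * ‖𝓕 f ξ‖ ^ 2) := by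
    refine lintegral_mono_ae ?_
    filter_upwards [Measure.ae_ne volume (0 : ℝ)] with t ht
    have ib {b : En n → ℝ} (hb : Continuous b) (h : 𝓢(En n, ℂ)) :
        Integrable (fun x => b x ^ 2 / (t ^ 2 + b x ^ 2) * ‖h x‖ ^ 2) := by
      have hq := ((hb.pow 2).div (continuous_const.add (hb.pow 2))
        fun x => (show 0 < t ^ 2 + b x ^ 2 by positivity).ne').mul (h.continuous.norm.pow 2)
      refine (integrable_norm_sq h).mono' hq.aestronglyMeasurable
        (Eventually.of_forall fun x => ?_)
      rw [Real.norm_eq_abs, abs_of_nonneg (by positivity)]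
      refine mul_le_of_le_one_left (by positivity) ((div_le_one (by positivity)).2 ?_)
      linarith [sq_nonneg t]
    rw [← ofReal_integral_eq_lintegral_ofReal (ib hWcont f)
        (Eventually.of_forall fun x => by positivity),
      ← ofReal_integral_eq_lintegral_ofReal (ib hAc (𝓕 f))
        (Eventually.of_forall fun x => by positivity)]
    exact ENNReal.ofReal_le_ofReal (integral_resolvent_le hWcont hWc hW f ht)
  rw [lintegral_lintegral_sq_div (ψ := fun x => ‖f x‖ ^ 2) (f.continuous.norm.pow 2) hWcont hW0,
    lintegral_lintegral_sq_div (ψ := fun ξ => ‖𝓕 f ξ‖ ^ 2)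
      ((𝓕 f).continuous.norm.pow 2) hAc hA0,
    ENNReal.mul_le_mul_iff_right (by simp [Real.pi_pos]) ENNReal.ofReal_ne_top] at key
  have iW : Integrable (fun x => W x * ‖f x‖ ^ 2) :=
    (hWcont.mul (f.continuous.norm.pow 2)).integrable_of_hasCompactSupport hWc.mul_right
  rw [← ofReal_integral_eq_lintegral_ofReal iW
      (Eventually.of_forall fun x => mul_nonneg (hW0 x) (by positivity)),
    ← ofReal_integral_eq_lintegral_ofReal iA
      (Eventually.of_forall fun x => mul_nonneg (hA0 x) (by positivity)),
    ENNReal.ofReal_le_ofReal_iff (integral_nonneg fun ξ => mul_nonneg (hA0 ξ) (by positivity)),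
    hgrad] at key
  simpa [hfx] using key

end Interpolation

section Mollify

open scoped Convolution

variable {n : ℕ}

/-- A bump function at the origin supported in the ball of radius `1 / (j + 1)`. -/
def mollifier (n j : ℕ) : ContDiffBump (0 : En n) where
  rIn := 1 / (2 * ((j : ℝ) + 1))
  rOut := 1 / ((j : ℝ) + 1)
  rIn_pos := by positivity
  rIn_lt_rOut := by
    apply one_div_lt_one_div_of_lt <;> [positivity; linarith [(Nat.cast_nonneg j : (0:ℝ) ≤ j)]]

/-- Mollification of `f` at scale `1 / (j + 1)`. -/
def mollify (j : ℕ) (f : En n → ℝ) : En n → ℝ :=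
  (mollifier n j).normed volume ⋆[ContinuousLinearMap.lsmul ℝ ℝ, volume] f

theorem contDiff_mollify (j : ℕ) {f : En n → ℝ} (hf : Continuous f) :
    ContDiff ℝ (⊤ : ℕ∞) (mollify j f) :=
  HasCompactSupport.contDiff_convolution_left _ (ContDiffBump.hasCompactSupport_normed _)
    (ContDiffBump.contDiff_normed _) hf.locallyIntegrable

theorem mollify_eq_zero (j : ℕ) {f : En n → ℝ} {r : ℝ} (hf : ∀ x, r < ‖x‖ → f x = 0) {x : En n}
    (hx : r + 1 < ‖x‖) : mollify j f x = 0 := by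
  by_contra h
  obtain ⟨y, hy, z, hz, rfl⟩ := Set.mem_add.1 (support_convolution_subset _ h)
  rw [ContDiffBump.support_normed_eq, mem_ball_zero_iff] at hy
  have h1 : (mollifier n j).rOut ≤ 1 := by
    change 1 / ((j : ℝ) + 1) ≤ 1
    rw [div_le_one (by positivity)]; linarith [(Nat.cast_nonneg j : (0:ℝ) ≤ j)]
  have h2 : ‖z‖ ≤ r := not_lt.1 fun h => hz (hf z h)
  linarith [norm_add_le y z]

theorem abs_mollify_le (j : ℕ) {f : En n → ℝ} (hf : Continuous f) {M : ℝ} (hM : ∀ x, |f x| ≤ M)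
    (x : En n) : |mollify j f x| ≤ 3 * M := by
  have := (mollifier n j).dist_normed_convolution_le (x₀ := x) (μ := volume) (ε := 2 * M)
    (hf.aestronglyMeasurable)
    (fun y _ => (by
      rw [Real.dist_eq]; linarith [abs_sub (f y) (f x), hM x, hM y]))
  rw [Real.dist_eq] at this
  have h2 := abs_add_le (mollify j f x - f x) (f x)
  rw [sub_add_cancel] at h2
  have : |mollify j f x - f x| ≤ 2 * M := this
  linarith [hM x]

theorem tendsto_mollify {f : En n → ℝ} (hf : Continuous f) (x : En n) :
    Tendsto (fun j => mollify j f x) atTop (nhds (f x)) :=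
  ContDiffBump.convolution_tendsto_right_of_continuous
    (φ := fun j => mollifier n j) (tendsto_one_div_add_atTop_nhds_zero_nat (𝕜 := ℝ)) hf x

theorem pd_mollify (j : ℕ) {f : En n → ℝ} (hf : ContDiff ℝ 1 f) (hc : HasCompactSupport f)
    (i : Fin n) : pd i (mollify j f) = mollify j (pd i f) := by
  ext x
  have hl : LocallyIntegrable ((mollifier n j).normed volume) (volume : Measure (En n)) :=
    ((mollifier n j).continuous_normed).locallyIntegrable
  have h := hc.hasFDerivAt_convolution_right (ContinuousLinearMap.lsmul ℝ ℝ) hl hf x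
  have h2 := convolution_precompR_apply (𝕜 := ℝ) (E'' := En n) (ContinuousLinearMap.lsmul ℝ ℝ) hl (hc.fderiv ℝ)
    (hf.continuous_fderiv (by norm_num)) x (EuclideanSpace.single i (1 : ℝ))
  unfold pd
  rw [← show _ = fderiv ℝ (mollify j f) x from h.fderiv.symm]
  exact h2

theorem tendsto_integral_mul_mollify_sq {V f : En n → ℝ} (hV : Continuous V) (hf : Continuous f)
    (hc : HasCompactSupport f) :
    Tendsto (fun j => ∫ x, V x * mollify j f x ^ 2) atTop (nhds (∫ x, V x * f x ^ 2)) := by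
  obtain ⟨r, hr⟩ := hc.isCompact.isBounded.subset_closedBall 0
  have hr' : ∀ x, r < ‖x‖ → f x = 0 := fun x hx => by
    refine image_eq_zero_of_notMem_tsupport fun h => ?_
    have := hr h
    rw [mem_closedBall_zero_iff] at this
    linarith
  obtain ⟨M, hM⟩ := hc.exists_bound_of_continuous hf
  have hM' : ∀ x, |f x| ≤ M := hM
  refine tendsto_integral_of_dominated_convergence
    ((closedBall (0 : En n) (r + 1)).indicator fun x => |V x| * (3 * M) ^ 2) ?_ ?_ ?_ ?_
  · exact fun j => (hV.mul ((contDiff_mollify j hf).continuous.pow 2)).aestronglyMeasurable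
  · exact ((hV.abs.mul continuous_const).continuousOn.integrableOn_compact
      (isCompact_closedBall _ _)).integrable_indicator measurableSet_closedBall
  · refine fun j => Eventually.of_forall fun x => ?_
    by_cases hx : x ∈ closedBall (0 : En n) (r + 1)
    · rw [indicator_of_mem hx, Real.norm_eq_abs, abs_mul, abs_pow]
      gcongr
      exact abs_mollify_le j hf hM' x
    · rw [indicator_of_notMem hx, mollify_eq_zero j hr' (by simpa using hx)]
      simp
  · exact Eventually.of_forall fun x => (((tendsto_mollify hf x).pow 2).const_mul _)

theorem integral_le_of_contDiff_one {V : En n → ℝ} (hV : Continuous V) {k : ℝ}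
    (h : ∀ φ : En n → ℝ, ContDiff ℝ (⊤ : ℕ∞) φ → HasCompactSupport φ →
      ∫ x, V x * φ x ^ 2 ≤ k * ∫ x, gd φ φ x)
    {φ : En n → ℝ} (hφ : ContDiff ℝ 1 φ) (hc : HasCompactSupport φ) :
    ∫ x, V x * φ x ^ 2 ≤ k * ∫ x, gd φ φ x := by
  have hcc : ∀ j, HasCompactSupport (mollify j φ) := fun j => by
    obtain ⟨r, hr⟩ := hc.isCompact.isBounded.subset_closedBall 0
    refine HasCompactSupport.intro (isCompact_closedBall (0 : En n) (r + 1)) fun x hx =>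
      mollify_eq_zero j (r := r) (fun x hx => ?_) (by simpa using hx)
    refine image_eq_zero_of_notMem_tsupport fun h => ?_
    have := hr h
    rw [mem_closedBall_zero_iff] at this
    linarith
  have key : ∀ ψ : En n → ℝ, ContDiff ℝ 1 ψ → HasCompactSupport ψ →
      ∫ x, gd ψ ψ x = ∑ i, ∫ x, 1 * pd i ψ x ^ 2 := fun ψ hψ hψc => by
    rw [← integral_finsetSum]
    · simp [gd, sq]
    · intro i _
      have := (hasCompactSupport_pd hψc i)
      exact (continuous_const.mul ((continuous_pd hψ i).pow 2)).integrable_of_hasCompactSupport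
        ((hasCompactSupport_sq this).mul_left)
  refine le_of_tendsto_of_tendsto (tendsto_integral_mul_mollify_sq hV hφ.continuous hc)
    (b := atTop) (g := fun j => k * ∫ x, gd (mollify j φ) (mollify j φ) x) ?_
    (Eventually.of_forall fun j => h _ (contDiff_mollify j hφ.continuous) (hcc j))
  refine Tendsto.const_mul _ ?_
  have e : ∀ j, ∫ x, gd (mollify j φ) (mollify j φ) x
      = ∑ i, ∫ x, 1 * mollify j (pd i φ) x ^ 2 := fun j => by
    rw [key _ (contDiff_infty.1 (contDiff_mollify j hφ.continuous) 1) (hcc j)]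
    simp only [pd_mollify j hφ hc]
  simp only [e]
  rw [key φ hφ hc]
  exact tendsto_finsetSum _ fun i _ => tendsto_integral_mul_mollify_sq continuous_const
    (continuous_pd hφ i) (hasCompactSupport_pd hc i)

theorem exists_cutoff_of_stable_half (hn : 5 ≤ n) {u : En n → ℝ} (hu : Continuous u) {R : ℝ}
    (h : Stable4OutsideBall n u R) {ε : ℝ} (hε : 0 < ε) :
    ∃ η : En n → ℝ, ContDiff ℝ (⊤ : ℕ∞) η ∧ (∀ x, 0 ≤ η x ∧ η x ≤ 1) ∧
      (∃ R₁, ∀ x, R₁ ≤ ‖x‖ → η x = 1) ∧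
      (∀ f, ContDiff ℝ (⊤ : ℕ∞) f → HasCompactSupport f →
        ∫ x, Real.exp (u x) * (η x * f x) ^ 2 ≤ (1 + ε) * ∫ x, lap f x ^ 2) ∧
      ∀ φ : En n → ℝ, ContDiff ℝ 1 φ → HasCompactSupport φ →
        ∫ x, (Real.exp (u x / 2) * η x) * φ x ^ 2 ≤ √(1 + ε) * ∫ x, gd φ φ x := by
  obtain ⟨η, h1, h2, h3, h4⟩ := exists_cutoff_of_stable hn h hε
  refine ⟨η, h1, h2, h3, h4, fun φ hφ hc => ?_⟩
  have hηc := h1.continuous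
  refine integral_le_of_contDiff_one (by fun_prop) (fun φ hφ hc => ?_) hφ hc
  obtain ⟨r, hr⟩ := hc.isCompact.isBounded.subset_closedBall 0
  obtain ⟨k, hk⟩ := (eventually_unitBump_eq_one (n := n) r).exists
  set χ : En n → ℝ := fun x => unitBump n ((1 / ((k : ℝ) + 1)) • x) with hχ
  have hχc : HasCompactSupport χ :=
    hasCompactSupport_comp_smul hasCompactSupport_unitBump (by positivity)
  have hχC : Continuous χ := (contDiff_comp_smul (contDiff_unitBump (k := 1)) _).continuous
  have hs : 0 < √(1 + ε) := by positivity
  have hs2 : √(1 + ε) ^ 2 = 1 + ε := Real.sq_sqrt (by positivity)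
  have hχ0 : ∀ x, 0 ≤ χ x := fun x => unitBump_nonneg _
  have hχ1 : ∀ x, χ x ≤ 1 := fun x => unitBump_le_one _
  have main := integral_mul_sq_le_integral_gd
    (W := fun x => (√(1 + ε))⁻¹ * (Real.exp (u x / 2) * η x * χ x)) (by fun_prop)
    (fun x => by have := (h2 x).1; have := hχ0 x; positivity)
    (hχc.mul_left.mul_left) (fun f hf hfc => ?_) hφ hc
  · rw [← div_le_iff₀' hs, div_eq_inv_mul, ← integral_const_mul]
    refine le_of_eq_of_le (integral_congr_ae (Eventually.of_forall fun x => ?_)) main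
    beta_reduce
    by_cases hx : φ x = 0
    · simp [hx]
    · rw [show χ x = 1 from hk x (by simpa using hr (subset_tsupport _ hx))]; ring
  · have hpos : 0 < 1 + ε := by positivity
    have h5 := h4 f hf hfc
    rw [← div_le_iff₀' hpos, div_eq_inv_mul, ← integral_const_mul] at h5
    refine le_trans (integral_mono ?_ ?_ fun x => ?_) h5
    · refine Continuous.integrable_of_hasCompactSupport ?_ ?_
      · have := hf.continuous
        fun_prop
      · exact hasCompactSupport_sq hfc.mul_left
    · refine Continuous.integrable_of_hasCompactSupport ?_ ?_
      · have := hf.continuous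
        fun_prop
      · exact (hasCompactSupport_sq hfc.mul_left).mul_left.mul_left
    · beta_reduce
      have e1 : Real.exp (u x) = Real.exp (u x / 2) ^ 2 := by
        rw [← Real.exp_nat_mul]; congr 1; push_cast; ring
      have : ((√(1 + ε))⁻¹ * (Real.exp (u x / 2) * η x * χ x) * f x) ^ 2
          = (1 + ε)⁻¹ * (Real.exp (u x) * (η x * f x) ^ 2) * χ x ^ 2 := by
        have e2 : (1 + ε)⁻¹ = (√(1 + ε))⁻¹ ^ 2 := by rw [inv_pow, hs2]
        rw [e1, e2]; ring
      rw [this]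
      refine mul_le_of_le_one_right (by positivity) ?_
      exact pow_le_one₀ (hχ0 x) (hχ1 x)

end Mollify

section MinimumPrinciple

variable {n : ℕ}

theorem pd_pd_nonneg_of_isLocalMin {v : En n → ℝ} (hv : ContDiff ℝ 2 v) {z : En n}
    (hz : IsLocalMin v z) (i : Fin n) : 0 ≤ pd i (pd i v) z := by
  by_contra! hneg
  set e : En n := EuclideanSpace.single i (1 : ℝ) with he
  have hline : ∀ t : ℝ, HasDerivAt (fun s : ℝ => z + s • e) e t := fun t => by
    simpa using ((hasDerivAt_id t).smul_const e).const_add z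
  have hd : ∀ (f : En n → ℝ), Differentiable ℝ f → ∀ t : ℝ,
      HasDerivAt (fun s : ℝ => f (z + s • e)) (pd i f (z + t • e)) t := fun f hf t =>
    (hf (z + t • e)).hasFDerivAt.comp_hasDerivAt t (hline t)
  have hd1 := hd v (hv.differentiable (by norm_num))
  have hd2 := hd (pd i v) ((contDiff_one_pd hv i).differentiable (by norm_num))
  have e1 : deriv (fun s : ℝ => v (z + s • e)) = fun t => pd i v (z + t • e) :=
    funext fun t => (hd1 t).deriv
  have e2 : deriv (deriv (fun s : ℝ => v (z + s • e))) 0 = pd i (pd i v) z := by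
    rw [e1, (hd2 0).deriv]; simp
  have hmin : IsLocalMin (fun s : ℝ => v (z + s • e)) 0 := by
    have hc : ContinuousAt (fun s : ℝ => z + s • e) 0 := (hline 0).continuousAt
    have : Tendsto (fun s : ℝ => z + s • e) (nhds 0) (nhds z) := by
      simpa [ContinuousAt] using hc
    have h := this.eventually hz
    unfold IsLocalMin IsMinFilter
    simpa using h
  have hmax : IsLocalMax (fun s : ℝ => v (z + s • e)) 0 :=
    isLocalMax_of_deriv_deriv_neg (by rw [e2]; exact hneg) hmin.deriv_eq_zero
      (hd1 0).continuousAt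
  have hconst : (fun s : ℝ => v (z + s • e)) =ᶠ[nhds 0] fun _ => v (z + (0 : ℝ) • e) := by
    filter_upwards [hmin, hmax] with s h1 h2 using le_antisymm h2 h1
  have := hconst.deriv.deriv_eq
  rw [e2] at this
  simp at this
  linarith

theorem pos_of_lap_neg_of_tendsto_zero {v : En n → ℝ} (hv : ContDiff ℝ 2 v)
    (hlap : ∀ x, lap v x < 0) (h0 : Tendsto v (cocompact (En n)) (nhds 0)) (x : En n) :
    0 < v x := by
  by_contra! hx
  have : ∃ z, ∀ y, v z ≤ v y := by
    by_cases h : ∃ x₀, v x₀ < 0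
    · obtain ⟨x₀, hx₀⟩ := h
      exact hv.continuous.exists_forall_le' x₀ ((h0.eventually (lt_mem_nhds hx₀)).mono fun _ h => h.le)
    · push Not at h
      exact ⟨x, fun y => hx.trans (h y)⟩
  obtain ⟨z, hz⟩ := this
  have := hlap z
  rw [lap_eq_sum_pd] at this
  exact absurd (Finset.sum_nonneg fun i _ => pd_pd_nonneg_of_isLocalMin hv
    (Eventually.of_forall hz) i) (not_le.2 this)

end MinimumPrinciple

section ScaledAverages

variable {n : ℕ}

/-- A radial smooth bump supported in the closed unit ball. -/
def kerH (y : En n) : ℝ := expNegInvGlue (1 - ‖y‖ ^ 2)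

/-- The radial weight with `∇ kerH y = - kerG y • y`. -/
def kerG (y : En n) : ℝ := 2 * ((1 - ‖y‖ ^ 2)⁻¹ ^ 2 * expNegInvGlue (1 - ‖y‖ ^ 2))

theorem hasDerivAt_expNegInvGlue (t : ℝ) :
    HasDerivAt expNegInvGlue (t⁻¹ ^ 2 * expNegInvGlue t) t := by
  simpa using expNegInvGlue.hasDerivAt_polynomial_eval_inv_mul 1 t

theorem contDiff_kerH {k : ℕ∞} : ContDiff ℝ k (kerH (n := n)) :=
  expNegInvGlue.contDiff.comp (contDiff_const.sub (contDiff_norm_sq ℝ))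

theorem continuous_kerG : Continuous (kerG (n := n)) := by
  have h := expNegInvGlue.continuous_polynomial_eval_inv_mul (Polynomial.X ^ 2)
  simp only [Polynomial.eval_pow, Polynomial.eval_X] at h
  exact (h.comp (continuous_const.sub (continuous_norm.pow 2))).const_mul 2

theorem kerH_nonneg (y : En n) : 0 ≤ kerH y := expNegInvGlue.nonneg _

theorem kerG_nonneg (y : En n) : 0 ≤ kerG y := by
  have := expNegInvGlue.nonneg (1 - ‖y‖ ^ 2)
  unfold kerG
  positivity

theorem kerH_le_one (y : En n) : kerH y ≤ 1 := by
  unfold kerH expNegInvGlue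
  split_ifs with h
  · norm_num
  · push Not at h
    exact Real.exp_le_one_iff.2 (by have := inv_pos.2 h; linarith)

theorem kerH_eq_zero {y : En n} (hy : 1 ≤ ‖y‖) : kerH y = 0 :=
  expNegInvGlue.zero_of_nonpos (by nlinarith)

theorem kerG_eq_zero {y : En n} (hy : 1 ≤ ‖y‖) : kerG y = 0 := by
  have : expNegInvGlue (1 - ‖y‖ ^ 2) = 0 := expNegInvGlue.zero_of_nonpos (by nlinarith)
  simp [kerG, this]

theorem hasCompactSupport_kerH : HasCompactSupport (kerH (n := n)) :=
  HasCompactSupport.intro (isCompact_closedBall (0 : En n) 1) fun _ hx =>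
    kerH_eq_zero (by simpa using (not_le.1 (by simpa using hx)).le)

theorem hasCompactSupport_kerG : HasCompactSupport (kerG (n := n)) :=
  HasCompactSupport.intro (isCompact_closedBall (0 : En n) 1) fun _ hx =>
    kerG_eq_zero (by simpa using (not_le.1 (by simpa using hx)).le)

theorem le_kerG {y : En n} (hy : ‖y‖ ≤ 1 / 2) : expNegInvGlue (3 / 4) ≤ kerG y := by
  have h1 : 3 / 4 ≤ 1 - ‖y‖ ^ 2 := by nlinarith [norm_nonneg y]
  have h2 := expNegInvGlue.monotone h1
  have h3 : 1 ≤ (1 - ‖y‖ ^ 2)⁻¹ :=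
    (one_le_inv₀ (by linarith)).2 (by nlinarith [norm_nonneg y])
  have h4 := expNegInvGlue.nonneg (3 / 4)
  have h5 : 1 ≤ (1 - ‖y‖ ^ 2)⁻¹ ^ 2 := one_le_pow₀ h3
  unfold kerG
  nlinarith [expNegInvGlue.nonneg (1 - ‖y‖ ^ 2)]

theorem integral_kerG_pos : 0 < ∫ y : En n, kerG y := by
  refine continuous_kerG.integral_pos_of_hasCompactSupport_nonneg_nonzero
    hasCompactSupport_kerG kerG_nonneg (x := 0) ?_
  have h1 := le_kerG (y := (0 : En n)) (by simp)
  have h2 := expNegInvGlue.pos_of_pos (show (0 : ℝ) < 3 / 4 by norm_num)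
  linarith

theorem gd_kerH_right {f : En n → ℝ} (y : En n) :
    gd f kerH y = -(kerG y * fderiv ℝ f y y) := by
  have hd : DifferentiableAt ℝ (fun y : En n => ‖y‖ ^ 2) y :=
    (contDiff_norm_sq ℝ (n := 1)).differentiable (by norm_num) y
  have h : HasDerivAt (fun t : ℝ => expNegInvGlue (1 - t))
      ((1 - ‖y‖ ^ 2)⁻¹ ^ 2 * expNegInvGlue (1 - ‖y‖ ^ 2) * (-1)) (‖y‖ ^ 2) :=
    (hasDerivAt_expNegInvGlue (1 - ‖y‖ ^ 2)).comp (‖y‖ ^ 2)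
      ((hasDerivAt_id (‖y‖ ^ 2)).const_sub 1)
  have := gd_comp_left (g := f) hd h
  rw [gd_comm]
  change gd (fun y => expNegInvGlue (1 - ‖y‖ ^ 2)) f y = _
  rw [this, gd_norm_sq_left, kerG]
  ring

theorem integrable_comp_smul_mul {w k : En n → ℝ} (hw : Continuous w) (hk : Continuous k)
    (hkc : HasCompactSupport k) (R : ℝ) : Integrable (fun y => w (R • y) * k y) :=
  (by fun_prop : Continuous fun y => w (R • y) * k y).integrable_of_hasCompactSupport hkc.mul_left

theorem hasDerivAt_average {w : En n → ℝ} (hw : ContDiff ℝ 2 w) {R : ℝ} (hR : 0 < R) :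
    HasDerivAt (fun r : ℝ => ∫ y, w (r • y) * kerG y)
      (R * ∫ y, lap w (R • y) * kerH y) R := by
  have hdw : Continuous (fderiv ℝ w) := hw.continuous_fderiv (by norm_num)
  have hw1 : Differentiable ℝ w := hw.differentiable (by norm_num)
  obtain ⟨M, hM⟩ := (isCompact_closedBall (0 : En n) (R + 1)).exists_bound_of_continuousOn
    hdw.continuousOn
  have hmain := (hasDerivAt_integral_of_dominated_loc_of_deriv_le (μ := volume)
    (F := fun (r : ℝ) (y : En n) => w (r • y) * kerG y)
    (F' := fun (r : ℝ) (y : En n) => fderiv ℝ w (r • y) y * kerG y) (x₀ := R)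
    (s := ball R 1) (bound := fun y => M * kerG y) (ball_mem_nhds R one_pos)
    (Eventually.of_forall fun r =>
      (integrable_comp_smul_mul hw.continuous continuous_kerG hasCompactSupport_kerG
        r).aestronglyMeasurable)
    (integrable_comp_smul_mul hw.continuous continuous_kerG hasCompactSupport_kerG R)
    ?_ ?_ ?_ ?_).2
  · refine hmain.congr_deriv ?_
    have hR0 := hR.ne'
    have hwR : ContDiff ℝ 2 (fun y => w (R • y)) := contDiff_comp_smul hw R
    have h1 := integral_mul_lap hwR (contDiff_kerH (k := 1)) hasCompactSupport_kerH
    have e1 : ∀ y, fderiv ℝ (fun y => w (R • y)) y y = R * fderiv ℝ w (R • y) y := fun y => by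
      have h : HasFDerivAt (fun x : En n => w (R • x))
          ((fderiv ℝ w (R • y)).comp (R • ContinuousLinearMap.id ℝ (En n))) y :=
        (hw1 (R • y)).hasFDerivAt.comp y ((hasFDerivAt_id y).const_smul R)
      rw [h.fderiv]
      simp
    simp only [gd_kerH_right, lap_comp_smul hw, e1] at h1
    rw [integral_neg, neg_neg] at h1
    have e2 : ∀ y, kerH y * (R ^ 2 * lap w (R • y)) = R * (R * (lap w (R • y) * kerH y)) :=
      fun y => by ring
    have e3 : ∀ y, kerG y * (R * fderiv ℝ w (R • y) y)
      = R * (fderiv ℝ w (R • y) y * kerG y) := fun y => by ring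
    simp only [e2, e3] at h1
    rw [integral_const_mul, integral_const_mul, integral_const_mul] at h1
    exact (mul_left_cancel₀ hR0 h1).symm
  · exact (((hdw.comp (continuous_const_smul R)).clm_apply continuous_id).mul
      continuous_kerG).aestronglyMeasurable
  · refine Eventually.of_forall fun y r hr => ?_
    by_cases hy : 1 ≤ ‖y‖
    · simp [kerG_eq_zero hy]
    · push Not at hy
      rw [norm_mul, Real.norm_eq_abs (kerG y), abs_of_nonneg (kerG_nonneg y)]
      refine mul_le_mul_of_nonneg_right ?_ (kerG_nonneg y)
      refine ((fderiv ℝ w (r • y)).le_opNorm y).trans ?_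
      have hr' : |r| ≤ R + 1 := by
        rw [mem_ball, Real.dist_eq] at hr
        have := abs_add_le (r - R) R
        rw [sub_add_cancel, abs_of_pos hR] at this
        linarith
      have h2 := hM (r • y) (by
        rw [mem_closedBall_zero_iff, norm_smul, Real.norm_eq_abs]
        exact (mul_le_of_le_one_right (abs_nonneg r) hy.le).trans hr')
      exact (mul_le_of_le_one_right (norm_nonneg _) hy.le).trans h2
  · exact (continuous_kerG.integrable_of_hasCompactSupport hasCompactSupport_kerG).const_mul M
  · refine Eventually.of_forall fun y r _ => ?_
    have h1 : HasDerivAt (fun s : ℝ => s • y) y r := by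
      simpa using (hasDerivAt_id r).smul_const y
    exact ((hw1 (r • y)).hasFDerivAt.comp_hasDerivAt r h1).mul_const _

theorem tendsto_average_zero (hn : 0 < n) {w k : En n → ℝ} (hw : Continuous w)
    (h0 : Tendsto w (cocompact (En n)) (nhds 0)) (hk : Continuous k) (hkc : HasCompactSupport k) :
    Tendsto (fun R : ℝ => ∫ y, w (R • y) * k y) atTop (nhds 0) := by
  have : Nonempty (Fin n) := ⟨⟨0, hn⟩⟩
  obtain ⟨M, hM⟩ : ∃ M, ∀ x, |w x| ≤ M := by
    have h1 := h0.abs.eventually_le_const (show |(0 : ℝ)| < 1 by simp)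
    obtain ⟨K, hK, hKw⟩ := mem_cocompact.1 h1
    obtain ⟨M, hM⟩ := hK.exists_bound_of_continuousOn hw.continuousOn
    refine ⟨max M 1, fun x => ?_⟩
    by_cases hx : x ∈ K
    · exact (hM x hx).trans (le_max_left _ _)
    · exact (hKw hx).trans (le_max_right _ _)
  have := tendsto_integral_filter_of_dominated_convergence (μ := volume) (l := (atTop : Filter ℝ))
    (F := fun R y => w (R • y) * k y) (f := fun _ => 0) (fun y => M * |k y|)
    (Eventually.of_forall fun R => (integrable_comp_smul_mul hw hk hkc R).aestronglyMeasurable)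
    (Eventually.of_forall fun R => Eventually.of_forall fun y => by
      rw [norm_mul]; exact mul_le_mul_of_nonneg_right (hM _) (norm_nonneg _))
    ((hk.integrable_of_hasCompactSupport hkc).abs.const_mul M) ?_
  · simpa using this
  · have hne : ∀ᵐ y : En n, y ≠ 0 := by
      rw [ae_iff]; simp
    filter_upwards [hne] with y hy
    have h1 : Tendsto (fun R : ℝ => R • y) atTop (cocompact (En n)) := by
      rw [← cobounded_eq_cocompact, ← tendsto_norm_atTop_iff_cobounded]
      simp only [norm_smul]
      exact tendsto_norm_atTop_atTop.atTop_mul_const (norm_pos_iff.2 hy)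
    simpa using (h0.comp h1).mul_const (k y)

end ScaledAverages

section Growth

variable {n : ℕ}

theorem integral_comp_smul_En (f : En n → ℝ) {R : ℝ} (hR : 0 < R) :
    ∫ x, f (R • x) = (R ^ n)⁻¹ * ∫ x, f x := by
  rw [Measure.integral_comp_smul_of_nonneg _ _ _ (hR := hR.le), finrank_euclideanSpace_fin,
    smul_eq_mul]

theorem integral_comp_inv_smul_En (f : En n → ℝ) {R : ℝ} (hR : 0 < R) :
    ∫ x, f (R⁻¹ • x) = R ^ n * ∫ x, f x := by
  rw [integral_comp_smul_En f (inv_pos.2 hR), inv_pow, inv_inv]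

theorem exists_integral_exp_le (hn : 4 ≤ n) {u η : En n → ℝ} (hu : Continuous u)
    (hη : Continuous η) (hη01 : ∀ x, 0 ≤ η x ∧ η x ≤ 1) {R₁ : ℝ} (hη1 : ∀ x, R₁ ≤ ‖x‖ → η x = 1)
    {c : ℝ} (hc : 0 ≤ c)
    (hS : ∀ f, ContDiff ℝ (⊤ : ℕ∞) f → HasCompactSupport f →
      ∫ x, Real.exp (u x) * (η x * f x) ^ 2 ≤ c * ∫ x, lap f x ^ 2) :
    ∃ C, 0 ≤ C ∧ ∀ R : ℝ, 1 ≤ R →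
      ∫ y, Real.exp (u (R • y)) * unitBump n y ^ 2 ≤ C / R ^ 4 := by
  set C₀ := ∫ x, Real.exp (u x) * (1 - η x ^ 2) with hC₀
  set L := ∫ x, lap (unitBump n) x ^ 2 with hL
  have hη2 : ∀ x, 0 ≤ 1 - η x ^ 2 := fun x => by
    have := pow_le_one₀ (n := 2) (hη01 x).1 (hη01 x).2
    linarith
  have hC₀0 : 0 ≤ C₀ := integral_nonneg fun x => mul_nonneg (Real.exp_pos _).le (hη2 x)
  have hL0 : 0 ≤ L := integral_nonneg fun x => sq_nonneg _
  have hcs : HasCompactSupport fun x => 1 - η x ^ 2 :=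
    HasCompactSupport.intro (isCompact_closedBall (0 : En n) R₁) fun x hx => by
      rw [hη1 x (not_le.1 (by simpa using hx)).le]; norm_num
  refine ⟨c * L + C₀, by positivity, fun R hR => ?_⟩
  have hR0 : 0 < R := by linarith
  set f : En n → ℝ := fun x => unitBump n (R⁻¹ • x) with hf
  have hfs : ContDiff ℝ (⊤ : ℕ∞) f := contDiff_comp_smul contDiff_unitBump _
  have hfc : HasCompactSupport f :=
    hasCompactSupport_comp_smul hasCompactSupport_unitBump (inv_pos.2 hR0).ne'
  have hfC := hfs.continuous
  have h1 := hS f hfs hfc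
  have h2 : ∫ x, lap f x ^ 2 = (R⁻¹) ^ 4 * (R ^ n * L) := by
    rw [hL, ← integral_comp_inv_smul_En (fun x => lap (unitBump n) x ^ 2) hR0,
      ← integral_const_mul]
    refine integral_congr_ae (Eventually.of_forall fun x => ?_)
    beta_reduce
    rw [hf, lap_comp_smul (contDiff_unitBump (k := 2))]
    ring
  have h3 : ∫ x, Real.exp (u x) * f x ^ 2 ≤ c * ((R⁻¹) ^ 4 * (R ^ n * L)) + C₀ := by
    rw [← h2]
    refine le_trans ?_ (add_le_add_left h1 C₀)
    rw [hC₀]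
    have i1 : Integrable fun x => Real.exp (u x) * (η x * f x) ^ 2 :=
      (by fun_prop : Continuous fun x => Real.exp (u x) * (η x * f x) ^
        2).integrable_of_hasCompactSupport (hasCompactSupport_sq hfc.mul_left).mul_left
    have i2 : Integrable fun x => Real.exp (u x) * (1 - η x ^ 2) :=
      (by fun_prop : Continuous fun x => Real.exp (u x) * (1 - η x ^
        2)).integrable_of_hasCompactSupport hcs.mul_left
    have i3 : Integrable fun x => Real.exp (u x) * f x ^ 2 :=
      (by fun_prop : Continuous fun x => Real.exp (u x) * f x ^
        2).integrable_of_hasCompactSupport (hasCompactSupport_sq hfc).mul_left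
    rw [← integral_add i1 i2]
    refine integral_mono i3 (i1.add i2) fun x => ?_
    have e : Real.exp (u x) * (η x * f x) ^ 2 + Real.exp (u x) * (1 - η x ^ 2)
        - Real.exp (u x) * f x ^ 2 = Real.exp (u x) * ((1 - η x ^ 2) * (1 - f x ^ 2)) := by ring
    have hf1 : 0 ≤ 1 - f x ^ 2 := by
      have := pow_le_one₀ (n := 2) (unitBump_nonneg (R⁻¹ • x)) (unitBump_le_one _)
      simp only [hf]; linarith
    have := mul_nonneg (Real.exp_pos (u x)).le (mul_nonneg (hη2 x) hf1)
    beta_reduce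
    linarith
  have h4 : ∫ y, Real.exp (u (R • y)) * unitBump n y ^ 2
      = (R ^ n)⁻¹ * ∫ x, Real.exp (u x) * f x ^ 2 := by
    rw [← integral_comp_smul_En _ hR0]
    simp only [hf, smul_smul, inv_mul_cancel₀ hR0.ne', one_smul]
  rw [h4]
  calc (R ^ n)⁻¹ * ∫ x, Real.exp (u x) * f x ^ 2
      ≤ (R ^ n)⁻¹ * (c * ((R⁻¹) ^ 4 * (R ^ n * L)) + C₀) := by gcongr
    _ = c * L / R ^ 4 + C₀ / R ^ n := by field_simp
    _ ≤ c * L / R ^ 4 + C₀ / R ^ 4 := by gcongr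
    _ = _ := by ring

theorem kerH_le_unitBump_sq (y : En n) : kerH y ≤ unitBump n y ^ 2 := by
  by_cases hy : ‖y‖ ≤ 1
  · rw [unitBump_eq_one hy]; simpa using kerH_le_one y
  · rw [kerH_eq_zero (not_le.1 hy).le]; positivity

theorem exists_average_le (hn : 0 < n) {u v : En n → ℝ} (hu : Continuous u)
    (hv : ContDiff ℝ 2 v) (hlap : ∀ x, lap v x = -Real.exp (u x))
    (h0 : Tendsto v (cocompact (En n)) (nhds 0)) {C : ℝ}
    (hC : ∀ R : ℝ, 1 ≤ R → ∫ y, Real.exp (u (R • y)) * unitBump n y ^ 2 ≤ C / R ^ 4)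
    {R : ℝ} (hR : 1 ≤ R) : ∫ y, v (R • y) * kerG y ≤ C / 2 / R ^ 2 := by
  set F : ℝ → ℝ := fun r => (∫ y, v (r • y) * kerG y) - C / 2 / r ^ 2 with hF
  have hd : ∀ r : ℝ, 1 ≤ r → HasDerivAt F
      (r * (∫ y, lap v (r • y) * kerH y) + C / r ^ 3) r := fun r hr => by
    have hr0 : 0 < r := by linarith
    have h1 := (((hasDerivAt_pow 2 r).inv (by positivity)).const_mul (C / 2))
    have h2 := (hasDerivAt_average hv hr0).sub h1
    refine (h2.congr_deriv ?_)
    field_simp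
    push_cast
    ring
  have hmono : MonotoneOn F (Ici 1) := by
    refine monotoneOn_of_deriv_nonneg (convex_Ici 1)
      (fun r hr => (hd r hr).continuousAt.continuousWithinAt)
      (fun r hr => (hd r (interior_subset hr)).differentiableAt.differentiableWithinAt)
      fun r hr => ?_
    have hr : 1 ≤ r := interior_subset hr
    have hr0 : 0 < r := by linarith
    rw [(hd r hr).deriv]
    have h1 : ∫ y, lap v (r • y) * kerH y = -∫ y, Real.exp (u (r • y)) * kerH y := by
      rw [← integral_neg]; simp only [hlap, neg_mul]
    have h2 : ∫ y, Real.exp (u (r • y)) * kerH y ≤ C / r ^ 4 := by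
      refine le_trans (integral_mono ?_ ?_ fun y => ?_) (hC r hr)
      · exact integrable_comp_smul_mul (w := fun x => Real.exp (u x)) (by fun_prop)
          (contDiff_kerH (k := 0)).continuous hasCompactSupport_kerH r
      · exact integrable_comp_smul_mul (w := fun x => Real.exp (u x)) (by fun_prop)
          ((contDiff_unitBump (k := 0)).continuous.pow 2)
          (hasCompactSupport_sq hasCompactSupport_unitBump) r
      · exact mul_le_mul_of_nonneg_left (kerH_le_unitBump_sq y) (Real.exp_pos _).le
    rw [h1]
    have : C / r ^ 3 = r * (C / r ^ 4) := by field_simp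
    rw [this]
    nlinarith
  have hlim : Tendsto F atTop (nhds 0) := by
    have h1 := tendsto_average_zero hn hv.continuous h0 continuous_kerG hasCompactSupport_kerG
    have h2 : Tendsto (fun r : ℝ => C / 2 / r ^ 2) atTop (nhds 0) :=
      tendsto_const_nhds.div_atTop (tendsto_pow_atTop (by norm_num))
    simpa using h1.sub h2
  have : F R ≤ 0 := ge_of_tendsto hlim (by
    filter_upwards [eventually_ge_atTop R] with r hr using hmono hR (hR.trans hr) hr)
  simp only [hF] at this
  linarith

theorem unitBump_le_kerG (y : En n) :
    unitBump n y ≤ (expNegInvGlue (3 / 4))⁻¹ * kerG ((4 : ℝ)⁻¹ • y) := by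
  have hp : 0 < expNegInvGlue (3 / 4) := expNegInvGlue.pos_of_pos (by norm_num)
  by_cases hy : ‖y‖ ≤ 2
  · refine (unitBump_le_one y).trans ?_
    rw [← div_eq_inv_mul, le_div_iff₀ hp, one_mul]
    refine le_kerG ?_
    rw [norm_smul, Real.norm_eq_abs, abs_of_pos (by norm_num)]
    linarith
  · rw [unitBump_eq_zero (not_le.1 hy).le]
    exact mul_nonneg (inv_pos.2 hp).le (kerG_nonneg _)

theorem exists_integral_mul_unitBump_le {v : En n → ℝ} (hv : Continuous v) (hv0 : ∀ x, 0 ≤ v x)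
    {C : ℝ} (hC : ∀ R : ℝ, 1 ≤ R → ∫ y, v (R • y) * kerG y ≤ C / R ^ 2) :
    ∃ C', 0 ≤ C' ∧ ∀ R : ℝ, 1 ≤ R → ∫ x, v x * unitBump n (R⁻¹ • x) ≤ C' * R ^ n / R ^ 2 := by
  have hp : 0 < expNegInvGlue (3 / 4) := expNegInvGlue.pos_of_pos (by norm_num)
  have hC0 : 0 ≤ C := by
    have := (integral_nonneg fun y => mul_nonneg (hv0 _) (kerG_nonneg y)).trans (hC 1 le_rfl)
    simpa using this
  refine ⟨(expNegInvGlue (3 / 4))⁻¹ * 4 ^ n * C, by positivity, fun R hR => ?_⟩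
  have hR0 : 0 < R := by linarith
  have hkc : HasCompactSupport fun x : En n => kerG ((4 * R)⁻¹ • x) :=
    hasCompactSupport_comp_smul hasCompactSupport_kerG (by positivity)
  have hkC := continuous_kerG (n := n)
  have h1 : ∫ x, v x * unitBump n (R⁻¹ • x)
      ≤ ∫ x, (expNegInvGlue (3 / 4))⁻¹ * (v x * kerG ((4 * R)⁻¹ • x)) := by
    refine integral_mono ?_ ?_ fun x => ?_
    · exact (hv.mul ((contDiff_unitBump (k := 0)).continuous.comp
        (continuous_const_smul _))).integrable_of_hasCompactSupport
        (hasCompactSupport_comp_smul hasCompactSupport_unitBump (inv_pos.2 hR0).ne').mul_left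
    · exact (by fun_prop : Continuous fun x => (expNegInvGlue (3 / 4))⁻¹ * (v x *
        kerG ((4 * R)⁻¹ • x))).integrable_of_hasCompactSupport hkc.mul_left.mul_left
    · have := unitBump_le_kerG (R⁻¹ • x)
      rw [smul_smul, ← mul_inv] at this
      have := mul_le_mul_of_nonneg_left this (hv0 x)
      beta_reduce
      linarith
  refine h1.trans ?_
  have h4R : 0 < 4 * R := by positivity
  have h2 : ∫ x, v x * kerG ((4 * R)⁻¹ • x)
      = (4 * R) ^ n * ∫ y, v ((4 * R) • y) * kerG y := by
    rw [← integral_comp_inv_smul_En _ h4R]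
    simp only [smul_smul, mul_inv_cancel₀ h4R.ne', one_smul]
  rw [integral_const_mul, h2]
  have h3 := hC (4 * R) (by linarith)
  have h5 : C / (4 * R) ^ 2 ≤ C / R ^ 2 := by gcongr; linarith
  calc (expNegInvGlue (3 / 4))⁻¹ * ((4 * R) ^ n * ∫ y, v ((4 * R) • y) * kerG y)
      ≤ (expNegInvGlue (3 / 4))⁻¹ * ((4 * R) ^ n * (C / R ^ 2)) := by
        gcongr; exact h3.trans h5
    _ = _ := by rw [mul_pow]; ring

end Growth

section Energy

variable {n : ℕ}

theorem exists_sobolev (hn : 2 < n) {p : ℝ} (hp : p = 2 * n / (n - 2)) :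
    ∃ C : ℝ, 0 ≤ C ∧ ∀ f : En n → ℝ, ContDiff ℝ 1 f → HasCompactSupport f →
      ∫ x, |f x| ^ p ≤ C * (∫ x, gd f f x) ^ (p / 2) := by
  have hn' : (2 : ℝ) < n := by exact_mod_cast hn
  have hp0 : 0 < p := by rw [hp]; exact div_pos (by linarith) (by linarith)
  set K : NNReal := SNormLESNormFDerivOfEqConst ℝ (volume : Measure (En n)) ((2 : NNReal) : ℝ)
  refine ⟨(K : ℝ) ^ p, by positivity, fun f hf hc => ?_⟩
  have hfC := hf.continuous
  have h := eLpNorm_le_eLpNorm_fderiv_of_eq (volume : Measure (En n)) hf hc (p := 2)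
    (p' := p.toNNReal) (by norm_num) (by rw [finrank_euclideanSpace_fin]; omega) (by
      rw [Real.coe_toNNReal _ hp0.le, finrank_euclideanSpace_fin, hp]
      have : (n : ℝ) - 2 ≠ 0 := by linarith
      have : (n : ℝ) ≠ 0 := by linarith
      push_cast
      field_simp)
  have m1 : MemLp f (p.toNNReal : ENNReal) :=
    hfC.memLp_of_hasCompactSupport hc
  have m2 : MemLp (fderiv ℝ f) ((2 : NNReal) : ENNReal) :=
    (hf.continuous_fderiv (by norm_num)).memLp_of_hasCompactSupport (hc.fderiv ℝ)
  have hpp : 0 < p.toNNReal := Real.toNNReal_pos.2 hp0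
  rw [m1.eLpNorm_eq_integral_rpow_norm (by exact_mod_cast hpp.ne') ENNReal.coe_ne_top,
    m2.eLpNorm_eq_integral_rpow_norm (by norm_num) ENNReal.coe_ne_top] at h
  simp only [ENNReal.coe_toReal, Real.coe_toNNReal _ hp0.le, Real.norm_eq_abs] at h
  have e : ∫ x, ‖fderiv ℝ f x‖ ^ ((2 : NNReal) : ℝ) = ∫ x, gd f f x := by
    refine integral_congr_ae (Eventually.of_forall fun x => ?_)
    simp [gd_self_eq_norm_fderiv_sq]
  rw [e, ← ENNReal.ofReal_coe_nnreal, ← ENNReal.ofReal_mul (by positivity)] at h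
  have hE : 0 ≤ ∫ x, gd f f x := integral_nonneg fun x => gd_self_nonneg f x
  have hI : 0 ≤ ∫ x, |f x| ^ p := integral_nonneg fun x => by positivity
  rw [ENNReal.ofReal_le_ofReal_iff (by positivity)] at h
  have h2 := Real.rpow_le_rpow (by positivity) h hp0.le
  rw [← Real.rpow_mul hI, inv_mul_cancel₀ hp0.ne', Real.rpow_one,
    Real.mul_rpow (by positivity) (by positivity), ← Real.rpow_mul hE] at h2
  convert h2 using 3
  push_cast
  ring

theorem integral_gd_mul_self {g φ : En n → ℝ} (hg : ContDiff ℝ 2 g) (hφ : ContDiff ℝ 2 φ)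
    (hc : HasCompactSupport φ) {c : ℝ} {r : En n → ℝ} (hr : Continuous r)
    (h : ∀ x, gd g g x = c * lap (fun y => g y ^ 2) x + r x) :
    ∫ x, gd (fun y => g y * φ y) (fun y => g y * φ y) x
      = (∫ x, r x * φ x ^ 2) + ∫ x, g x ^ 2 * (gd φ φ x
        + (c - 1 / 2) * lap (fun y => φ y ^ 2) x) := by
  have hg1 : Differentiable ℝ g := hg.differentiable (by norm_num)
  have hφ1 : Differentiable ℝ φ := hφ.differentiable (by norm_num)
  have hG : ContDiff ℝ 2 (fun y => g y ^ 2) := hg.pow 2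
  have hF : ContDiff ℝ 2 (fun y => φ y ^ 2) := hφ.pow 2
  have hFc := hasCompactSupport_sq hc
  have hgC := hg.continuous
  have hφC := hφ.continuous
  have hlG := continuous_lap hG
  have hlF := continuous_lap hF
  have hgd := continuous_gd (hφ.of_le (m := 1) (by norm_num)) (hφ.of_le (m := 1) (by norm_num))
  have hgdGF := continuous_gd (hG.of_le (m := 1) (by norm_num)) (hF.of_le (m := 1) (by norm_num))
  have ibp1 := integral_mul_lap hG (hF.of_le (m := 1) (by norm_num)) hFc
  have ibp2 := integral_mul_lap_comm hG hF hFc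
  have pt : ∀ x, gd (fun y => g y * φ y) (fun y => g y * φ y) x
      = r x * φ x ^ 2 + g x ^ 2 * gd φ φ x + (c * (φ x ^ 2 * lap (fun y => g y ^ 2) x)
        + 1 / 2 * gd (fun y => g y ^ 2) (fun y => φ y ^ 2) x) := fun x => by
    rw [gd_mul_left hg1 hφ1, gd_mul_right hg1 hφ1, gd_mul_right hg1 hφ1]
    have e1 : gd (fun y => g y ^ 2) (fun y => φ y ^ 2) x = 2 * g x * (2 * φ x * gd g φ x) := by
      have a1 := gd_comp_left (g := fun y => φ y ^ 2) (hg1 x) (hasDerivAt_pow 2 (g x))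
      have a2 := gd_comp_left (g := g) (hφ1 x) (hasDerivAt_pow 2 (φ x))
      rw [a1, gd_comm, a2, gd_comm φ g]
      push_cast
      ring
    rw [e1, gd_comm φ g, h x]
    ring
  have i1 : Integrable fun x => r x * φ x ^ 2 :=
    (by fun_prop : Continuous fun x => r x * φ x ^ 2).integrable_of_hasCompactSupport hFc.mul_left
  have i2 : Integrable fun x => g x ^ 2 * gd φ φ x :=
    (by fun_prop : Continuous fun x => g x ^ 2 * gd φ φ x).integrable_of_hasCompactSupport
      (hasCompactSupport_gd_left φ hc).mul_left
  have i3 : Integrable fun x => c * (φ x ^ 2 * lap (fun y => g y ^ 2) x) :=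
    (by fun_prop : Continuous fun x => c * (φ x ^ 2 * lap (fun y => g y ^
      2) x)).integrable_of_hasCompactSupport hFc.mul_right.mul_left
  have i4 : Integrable fun x => 1 / 2 * gd (fun y => g y ^ 2) (fun y => φ y ^ 2) x := by
    refine (by fun_prop : Continuous fun x => 1 / 2 * gd (fun y => g y ^ 2) (fun y => φ y ^
      2) x).integrable_of_hasCompactSupport (HasCompactSupport.mul_left ?_)
    have := hasCompactSupport_gd_left (fun y => g y ^ 2) hFc
    rwa [show gd (fun y => φ y ^ 2) (fun y => g y ^ 2) = gd (fun y => g y ^ 2) (fun y => φ y ^ 2)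
      from funext (gd_comm _ _)] at this
  have i5 : Integrable fun x => (c - 1 / 2) * (g x ^ 2 * lap (fun y => φ y ^ 2) x) :=
    (by fun_prop : Continuous fun x => (c - 1 / 2) * (g x ^ 2 * lap (fun y => φ y ^
      2) x)).integrable_of_hasCompactSupport (hasCompactSupport_lap hFc).mul_left.mul_left
  have e2 : ∀ x, g x ^ 2 * (gd φ φ x + (c - 1 / 2) * lap (fun y => φ y ^ 2) x)
      = g x ^ 2 * gd φ φ x + (c - 1 / 2) * (g x ^ 2 * lap (fun y => φ y ^ 2) x) := fun x => by ring
  simp only [pt, e2]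
  have i12 : Integrable fun x => r x * φ x ^ 2 + g x ^ 2 * gd φ φ x := i1.add i2
  have i34 : Integrable fun x => c * (φ x ^ 2 * lap (fun y => g y ^ 2) x)
      + 1 / 2 * gd (fun y => g y ^ 2) (fun y => φ y ^ 2) x := i3.add i4
  rw [integral_add i12 i34, integral_add i1 i2, integral_add i3 i4, integral_add i2 i5,
    integral_const_mul, integral_const_mul, integral_const_mul]
  linear_combination (c - 1 / 2) * ibp2 + 1 / 2 * ibp1

theorem gd_exp_mul {u : En n → ℝ} (hu : ContDiff ℝ 2 u) (b : ℝ) (x : En n) :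
    gd (fun y => Real.exp (b * u y)) (fun y => Real.exp (b * u y)) x
      = 1 / 4 * lap (fun y => Real.exp (b * u y) ^ 2) x
        + -(b / 2) * lap u x * Real.exp (b * u x) ^ 2 := by
  have hexp : ∀ (c t : ℝ), HasDerivAt (fun s => Real.exp (c * s)) (Real.exp (c * t) * c) t :=
    fun c t => by simpa using (((hasDerivAt_id t).const_mul c).exp)
  have e : ∀ y, Real.exp (b * u y) ^ 2 = Real.exp (2 * b * u y) := fun y => by
    rw [← Real.exp_nat_mul]; congr 1; push_cast; ring
  have h1 := gd_comp_self (hu.differentiable (by norm_num) x) (hexp b (u x))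
  have h2 := lap_comp (F := fun s => Real.exp (2 * b * s))
    (F₁ := fun s => Real.exp (2 * b * s) * (2 * b))
    (F₂ := fun s => Real.exp (2 * b * s) * (2 * b) * (2 * b)) hu (fun x => hexp _ _)
    (fun x => (hexp _ _).mul_const _) x
  simp only [e]
  rw [h1, h2, mul_pow, e]
  ring

theorem gd_rpow {v : En n → ℝ} (hv : ContDiff ℝ 2 v) (hv0 : ∀ x, 0 < v x) {q : ℝ} (hq : 1 < q)
    (x : En n) :
    gd (fun y => v y ^ (q / 2)) (fun y => v y ^ (q / 2)) x
      = q / (4 * (q - 1)) * lap (fun y => (v y ^ (q / 2)) ^ 2) x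
        + -(q ^ 2 / (4 * (q - 1))) * lap v x * v x ^ (q - 1) := by
  have hd : ∀ (c : ℝ) (y : En n), HasDerivAt (fun s : ℝ => s ^ c) (c * v y ^ (c - 1)) (v y) :=
    fun c y => Real.hasDerivAt_rpow_const (Or.inl (hv0 y).ne')
  have e : ∀ y, (v y ^ (q / 2)) ^ 2 = v y ^ q := fun y => by
    rw [← Real.rpow_natCast, ← Real.rpow_mul (hv0 y).le]; congr 1; push_cast; ring
  have h1 := gd_comp_self (hv.differentiable (by norm_num) x) (hd (q / 2) x)
  have h2 := lap_comp (F := fun s => s ^ q) (F₁ := fun s => q * s ^ (q - 1))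
    (F₂ := fun s => q * ((q - 1) * s ^ (q - 1 - 1))) hv (fun x => hd _ _)
    (fun x => (hd _ _).const_mul _) x
  simp only [e]
  have e3 : (v x ^ (q / 2 - 1)) ^ 2 = v x ^ (q - 1 - 1) := by
    rw [← Real.rpow_natCast, ← Real.rpow_mul (hv0 x).le]; congr 1; push_cast; ring
  have hq1 : q - 1 ≠ 0 := by linarith
  rw [h1, h2, mul_pow, e3]
  field_simp
  ring

end Energy

section Cutoff

variable {n : ℕ}

/-- The standard cutoff at scale `R`: equal to `1` on the ball of radius `R` and to `0` outside
the ball of radius `2 * R`. -/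
def cut (R : ℝ) (x : En n) : ℝ := unitBump n (R⁻¹ • x)

theorem contDiff_cut (R : ℝ) {k : ℕ∞} : ContDiff ℝ k (cut (n := n) R) :=
  contDiff_comp_smul contDiff_unitBump _

theorem continuous_cut (R : ℝ) : Continuous (cut (n := n) R) := (contDiff_cut R (k := 0)).continuous

theorem cut_nonneg (R : ℝ) (x : En n) : 0 ≤ cut R x := unitBump_nonneg _

theorem cut_le_one (R : ℝ) (x : En n) : cut R x ≤ 1 := unitBump_le_one _

theorem cut_eq_one {R : ℝ} (hR : 0 < R) {x : En n} (hx : ‖x‖ ≤ R) : cut R x = 1 := by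
  refine unitBump_eq_one ?_
  rw [norm_smul, norm_inv, Real.norm_eq_abs, abs_of_pos hR, inv_mul_le_iff₀ hR]
  linarith

theorem hasCompactSupport_cut {R : ℝ} (hR : 0 < R) : HasCompactSupport (cut (n := n) R) :=
  hasCompactSupport_comp_smul hasCompactSupport_unitBump (inv_pos.2 hR).ne'

theorem hasCompactSupport_cut_pow {R : ℝ} (hR : 0 < R) {m : ℕ} (hm : m ≠ 0) :
    HasCompactSupport fun x : En n => cut R x ^ m :=
  (hasCompactSupport_cut hR).mono fun x hx => by
    simp only [Function.mem_support, ne_eq] at hx ⊢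
    exact fun h => hx (by rw [h, zero_pow hm])

theorem integral_cut {R : ℝ} (hR : 0 < R) :
    ∫ x : En n, cut R x = R ^ n * ∫ x, unitBump n x := integral_comp_inv_smul_En _ hR

theorem abs_cutoff_combination_le {X Γ Λ B : ℝ} (h0 : 0 ≤ X) (h1 : X ≤ 1) (hΓ0 : 0 ≤ Γ)
    (hΓ : Γ ≤ B) (hΛ : |Λ| ≤ B) : |60 * X ^ 59 * Λ + 3540 * X ^ 58 * Γ| ≤ 3600 * B * X ^ 58 := by
  have hP : 0 ≤ X ^ 58 := by positivity
  rw [pow_succ X 58]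
  generalize X ^ 58 = P at hP
  have h2 : |X * Λ| ≤ B := by
    rw [abs_mul, abs_of_nonneg h0]
    exact (mul_le_of_le_one_left (abs_nonneg Λ) h1).trans hΛ
  obtain ⟨h3, h4⟩ := abs_le.1 h2
  rw [show 60 * (P * X) * Λ + 3540 * P * Γ = P * (60 * (X * Λ) + 3540 * Γ) by ring, abs_mul,
    abs_of_nonneg hP, mul_comm (3600 * B)]
  exact mul_le_mul_of_nonneg_left (abs_le.2 ⟨by linarith, by linarith⟩) hP

theorem exists_cut_bounds (n : ℕ) : ∃ C : ℝ, 0 ≤ C ∧ ∀ R : ℝ, 0 < R → ∀ x : En n,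
    gd (fun y => cut R y ^ 30) (fun y => cut R y ^ 30) x ≤ C / R ^ 2 * cut R x ^ 58 ∧
    |lap (fun y => (cut R y ^ 30) ^ 2) x| ≤ C / R ^ 2 * cut R x ^ 58 := by
  obtain ⟨G, hG1, hG, hL⟩ := exists_bound_derivs_unitBump n
  refine ⟨3600 * G, by linarith, fun R hR x => ?_⟩
  have hc : ContDiff ℝ 2 (cut (n := n) R) := contDiff_cut R (k := 2)
  have hub : ContDiff ℝ 2 (unitBump n) := contDiff_unitBump (k := 2)
  have hd : Differentiable ℝ (unitBump n) := hub.differentiable (by norm_num)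
  have hgd : gd (cut R) (cut R) x = (R⁻¹) ^ 2 * gd (unitBump n) (unitBump n) (R⁻¹ • x) :=
    gd_comp_smul hd hd _ _
  have hlp : lap (cut R) x = (R⁻¹) ^ 2 * lap (unitBump n) (R⁻¹ • x) := lap_comp_smul hub _ _
  have h0 := cut_nonneg R x
  have h1 := cut_le_one R x
  have hR2 : 0 < (R⁻¹) ^ 2 := by positivity
  have hg0 : 0 ≤ gd (cut R) (cut R) x := gd_self_nonneg _ _
  have hgb : gd (cut R) (cut R) x ≤ (R⁻¹) ^ 2 * G := by
    rw [hgd]; exact mul_le_mul_of_nonneg_left (hG _) hR2.le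
  have hlb : |lap (cut R) x| ≤ (R⁻¹) ^ 2 * G := by
    rw [hlp, abs_mul, abs_of_pos hR2]; exact mul_le_mul_of_nonneg_left (hL _) hR2.le
  have h58 : 0 ≤ cut R x ^ 58 := by positivity
  have hb : 0 ≤ (R⁻¹) ^ 2 * G := by positivity
  have eC : ∀ t : ℝ, t * G / R ^ 2 = t * ((R⁻¹) ^ 2 * G) := fun t => by
    rw [inv_pow]; field_simp
  constructor
  · rw [gd_comp_self (hc.differentiable (by norm_num) x) (hasDerivAt_pow 30 (cut R x)), eC]
    have : (((30 : ℕ) : ℝ) * cut R x ^ (30 - 1)) ^ 2 = 900 * cut R x ^ 58 := by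
      push_cast; ring
    rw [this]
    nlinarith [mul_le_mul_of_nonneg_left hgb h58, mul_nonneg h58 hb]
  · have hl := lap_comp (F := fun t => (t ^ 30) ^ 2) (F₁ := fun t => 60 * t ^ 59)
      (F₂ := fun t => 3540 * t ^ 58) hc
      (fun x => by
        refine ((hasDerivAt_pow 60 (cut R x)).congr_deriv (by norm_num)).congr_of_eventuallyEq
          (Eventually.of_forall fun t => ?_)
        ring)
      (fun x => ((hasDerivAt_pow 59 (cut R x)).const_mul 60).congr_deriv (by push_cast; ring)) x
    rw [hl, eC]
    exact abs_cutoff_combination_le h0 h1 hg0 hgb hlb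

theorem exists_energy_bound {g r : En n → ℝ} (hg : ContDiff ℝ 2 g) (hr : Continuous r) {c : ℝ}
    (h : ∀ x, gd g g x = c * lap (fun y => g y ^ 2) x + r x) :
    ∃ C : ℝ, 0 ≤ C ∧ ∀ R : ℝ, 0 < R →
      ∫ x, gd (fun y => g y * cut R y ^ 30) (fun y => g y * cut R y ^ 30) x
        ≤ (∫ x, r x * (cut R x ^ 30) ^ 2) + C * ∫ x, 1 / R ^ 2 * (g x ^ 2 * cut R x ^ 58) := by
  obtain ⟨C, hC0, hC⟩ := exists_cut_bounds n
  refine ⟨C * (1 + |c - 1 / 2|), by positivity, fun R hR => ?_⟩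
  have hφ : ContDiff ℝ 2 (fun x : En n => cut R x ^ 30) := (contDiff_cut R (k := 2)).pow 30
  have hφc : HasCompactSupport fun x : En n => cut R x ^ 30 :=
    hasCompactSupport_cut_pow hR (by norm_num)
  rw [integral_gd_mul_self hg hφ hφc hr h]
  have hφ1 := hφ.of_le (m := 1) (by norm_num)
  have hgC := hg.continuous
  have hcC := continuous_cut (n := n) R
  have hgd := continuous_gd hφ1 hφ1
  have hlF := continuous_lap (hφ.pow 2)
  gcongr
  rw [← integral_const_mul]
  refine integral_mono ?_ ?_ fun x => ?_
  · refine (by fun_prop : Continuous fun x => g x ^ 2 * (gd (fun x => cut R x ^ 30)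
      (fun x => cut R x ^ 30) x + (c - 1 / 2) * lap (fun y => (cut R y ^ 30) ^
      2) x)).integrable_of_hasCompactSupport (HasCompactSupport.mul_left ?_)
    exact (hasCompactSupport_gd_left _ hφc).add
      (hasCompactSupport_lap (hasCompactSupport_sq hφc)).mul_left
  · exact (by fun_prop : Continuous fun x => C * (1 + |c - 1 / 2|) * (1 / R ^ 2 * (g x ^ 2 *
      cut R x ^ 58))).integrable_of_hasCompactSupport
      (hasCompactSupport_cut_pow hR (by norm_num)).mul_left.mul_left.mul_left
  · obtain ⟨h1, h2⟩ := hC R hR x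
    beta_reduce
    have h3 : (c - 1 / 2) * lap (fun y => (cut R y ^ 30) ^ 2) x
        ≤ |c - 1 / 2| * (C / R ^ 2 * cut R x ^ 58) := by
      refine (le_abs_self _).trans ?_
      rw [abs_mul]
      exact mul_le_mul_of_nonneg_left h2 (abs_nonneg _)
    calc g x ^ 2 * (gd (fun x => cut R x ^ 30) (fun x => cut R x ^ 30) x
          + (c - 1 / 2) * lap (fun y => (cut R y ^ 30) ^ 2) x)
        ≤ g x ^ 2 * (C / R ^ 2 * cut R x ^ 58 + |c - 1 / 2| * (C / R ^ 2 * cut R x ^ 58)) := by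
          gcongr
      _ = _ := by ring

theorem exists_stability_bound {a η : En n → ℝ} (ha : Continuous a) (ha0 : ∀ x, 0 ≤ a x)
    (hη : Continuous η) (hη01 : ∀ x, 0 ≤ η x ∧ η x ≤ 1) {R₁ : ℝ} (hη1 : ∀ x, R₁ ≤ ‖x‖ → η x = 1)
    {k : ℝ} (hk : 0 ≤ k)
    (hS : ∀ φ : En n → ℝ, ContDiff ℝ 1 φ → HasCompactSupport φ →
        ∫ x, (a x * η x) * φ x ^ 2 ≤ k * ∫ x, gd φ φ x)
    {g r : En n → ℝ} (hg : ContDiff ℝ 2 g) (hr : Continuous r) {c : ℝ}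
    (h : ∀ x, gd g g x = c * lap (fun y => g y ^ 2) x + r x) :
    ∃ C : ℝ, 0 ≤ C ∧ ∀ R : ℝ, 0 < R →
      ∫ x, a x * g x ^ 2 * (cut R x ^ 30) ^ 2
        ≤ k * (∫ x, r x * (cut R x ^ 30) ^ 2)
          + C * ((∫ x, 1 / R ^ 2 * (g x ^ 2 * cut R x ^ 58)) + 1) := by
  obtain ⟨C, hC0, hC⟩ := exists_energy_bound hg hr h
  set D := ∫ x, (1 - η x) * (a x * g x ^ 2) with hD
  have hη2 : ∀ x, 0 ≤ 1 - η x := fun x => by linarith [(hη01 x).2]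
  have hgC := hg.continuous
  have hD0 : 0 ≤ D := integral_nonneg fun x =>
    mul_nonneg (hη2 x) (mul_nonneg (ha0 x) (sq_nonneg _))
  have hcs : HasCompactSupport fun x => 1 - η x :=
    HasCompactSupport.intro (isCompact_closedBall (0 : En n) R₁) fun x hx => by
      rw [hη1 x (not_le.1 (by simpa using hx)).le]; norm_num
  refine ⟨k * C + D, by positivity, fun R hR => ?_⟩
  have hcC := continuous_cut (n := n) R
  have hφc : HasCompactSupport fun x : En n => cut R x ^ 30 :=
    hasCompactSupport_cut_pow hR (by norm_num)
  set φ : En n → ℝ := fun x => cut R x ^ 30 with hφ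
  have hφC : Continuous φ := by fun_prop
  have hgφ : ContDiff ℝ 1 fun x => g x * φ x :=
    (hg.of_le (by norm_num)).mul ((contDiff_cut R (k := 1)).pow 30)
  have h1 := hS _ hgφ hφc.mul_left
  have h2 := hC R hR
  have h3 : ∫ x, a x * g x ^ 2 * (cut R x ^ 30) ^ 2
      ≤ (∫ x, (a x * η x) * (g x * φ x) ^ 2) + D := by
    have i1 : Integrable fun x => (a x * η x) * (g x * φ x) ^ 2 :=
      (by fun_prop : Continuous fun x => (a x * η x) * (g x * φ x) ^
        2).integrable_of_hasCompactSupport (hasCompactSupport_sq hφc.mul_left).mul_left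
    have i2 : Integrable fun x => (1 - η x) * (a x * g x ^ 2) :=
      (by fun_prop : Continuous fun x => (1 - η x) * (a x * g x ^
        2)).integrable_of_hasCompactSupport hcs.mul_right
    rw [hD, ← integral_add i1 i2]
    refine integral_mono ?_ (i1.add i2) fun x => ?_
    · exact (by fun_prop : Continuous fun x => a x * g x ^ 2 * (φ x) ^
        2).integrable_of_hasCompactSupport (hasCompactSupport_sq hφc).mul_left
    · have hle : φ x ^ 2 ≤ 1 :=
        pow_le_one₀ (pow_nonneg (cut_nonneg R x) _) (pow_le_one₀ (cut_nonneg R x) (cut_le_one R x))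
      have hp : 0 ≤ (1 - η x) * (a x * g x ^ 2) * (1 - φ x ^ 2) :=
        mul_nonneg (mul_nonneg (hη2 x) (mul_nonneg (ha0 x) (sq_nonneg _))) (by linarith)
      change a x * g x ^ 2 * φ x ^ 2 ≤ a x * η x * (g x * φ x) ^ 2 + (1 - η x) * (a x * g x ^ 2)
      nlinarith
  have h4 : 0 ≤ ∫ x, 1 / R ^ 2 * (g x ^ 2 * cut R x ^ 58) :=
    integral_nonneg fun x => by have := cut_nonneg R x; positivity
  have h5 := mul_le_mul_of_nonneg_left h2 hk
  have h6 := mul_nonneg hD0 h4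
  have h7 := mul_nonneg hk hC0
  nlinarith

theorem mul_rpow_cutoff_le {l δ z χ p t s j : ℝ} (hl : 0 ≤ l) (hδ : 0 < δ) (hz : 0 < z)
    (hχ0 : 0 ≤ χ) (hχ1 : χ ≤ 1) (hj : 0 ≤ j) (hs : 0 ≤ s) (ht : 1 ≤ t - s * j) :
    l * (z ^ p * χ ^ t) ≤ δ * (z ^ (p + 1) * χ ^ (t + s))
      + l * (l / δ) ^ j * (z ^ (p - j) * χ) := by
  have ht0 : 0 < t := by nlinarith
  rcases hχ0.eq_or_lt with rfl | hχ
  · rw [Real.zero_rpow ht0.ne', Real.zero_rpow (by linarith)]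
    simp
  · have hzp : 0 < z ^ p := Real.rpow_pos_of_pos hz p
    have hχt : 0 < χ ^ t := Real.rpow_pos_of_pos hχ t
    have r0 : 0 ≤ l * (l / δ) ^ j * (z ^ (p - j) * χ) := by positivity
    have l0 : 0 ≤ δ * (z ^ (p + 1) * χ ^ (t + s)) := by positivity
    by_cases hc : l ≤ δ * (z * χ ^ s)
    · have : δ * (z ^ (p + 1) * χ ^ (t + s)) = δ * (z * χ ^ s) * (z ^ p * χ ^ t) := by
        rw [Real.rpow_add hz, Real.rpow_add hχ, Real.rpow_one]; ring
      rw [this]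
      have := mul_le_mul_of_nonneg_right hc (mul_pos hzp hχt).le
      linarith
    · push Not at hc
      have h1 : z * χ ^ s ≤ l / δ := by rw [le_div_iff₀ hδ]; linarith
      have h2 : (z * χ ^ s) ^ j ≤ (l / δ) ^ j := Real.rpow_le_rpow (by positivity) h1 hj
      have h3 : χ ^ (t - s * j) ≤ χ := by
        simpa using Real.rpow_le_rpow_of_exponent_ge hχ hχ1 ht
      have e : z ^ p * χ ^ t = (z * χ ^ s) ^ j * (z ^ (p - j) * χ ^ (t - s * j)) := by
        rw [Real.mul_rpow hz.le (by positivity), ← Real.rpow_mul hχ.le]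
        have e1 : z ^ p = z ^ j * z ^ (p - j) := by rw [← Real.rpow_add hz]; congr 1; ring
        have e2 : χ ^ t = χ ^ (s * j) * χ ^ (t - s * j) := by
          rw [← Real.rpow_add hχ]; congr 1; ring
        rw [e1, e2]; ring
      have h4 : (z * χ ^ s) ^ j * (z ^ (p - j) * χ ^ (t - s * j))
          ≤ (l / δ) ^ j * (z ^ (p - j) * χ) := by gcongr
      rw [e]
      have := mul_le_mul_of_nonneg_left h4 hl
      linarith

end Cutoff

section MoserAlgebra

theorem exists_coupling {A B q : ℝ} (hA : 0 < A) (hB : 0 < B) (hq : 1 ≤ q) :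
    ∃ θ : ℝ, 0 < θ ∧ ∀ a v : ℝ, 0 < a → 0 < v →
      A * (v * a ^ q) + θ * (B * (v ^ (q - 1) * a ^ 2))
        ≤ √(A * B) * (a * a ^ q + θ * (a * v ^ q)) := by
  set c := √(B / A) with hc
  have hc0 : 0 < c := by positivity
  have hAc : A * c = √(A * B) := by
    have : A * c = √(A ^ 2) * √(B / A) := by rw [Real.sqrt_sq hA.le]
    rw [this, ← Real.sqrt_mul (by positivity)]
    congr 1
    field_simp
  have hcc : c ^ 2 = B / A := Real.sq_sqrt (by positivity)
  have hBc : B = √(A * B) * c := by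
    rw [← hAc, mul_assoc, ← sq, hcc]; field_simp
  have hκ : 0 ≤ √(A * B) := Real.sqrt_nonneg _
  refine ⟨(c ^ q)⁻¹, by positivity, fun a v ha hv => ?_⟩
  obtain ⟨w, hw, rfl⟩ : ∃ w, 0 < w ∧ v = c * w := ⟨v / c, by positivity, by field_simp⟩
  have e1 : (c * w) ^ q = c ^ q * w ^ q := Real.mul_rpow hc0.le hw.le
  have e2 : (c * w) ^ (q - 1) = c ^ q / c * w ^ (q - 1) := by
    rw [Real.mul_rpow hc0.le hw.le, Real.rpow_sub_one hc0.ne']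
  have e3 : a ^ q = a * a ^ (q - 1) := by
    rw [Real.rpow_sub_one ha.ne']; field_simp
  have e4 : w ^ q = w * w ^ (q - 1) := by
    rw [Real.rpow_sub_one hw.ne']; field_simp
  have hcq : 0 < c ^ q := by positivity
  have key : w * a ^ (q - 1) + a * w ^ (q - 1) ≤ a ^ q + w ^ q := by
    rw [e3, e4]
    have h0 : 0 ≤ q - 1 := by linarith
    rcases le_total a w with h | h
    · have := Real.rpow_le_rpow ha.le h h0
      nlinarith
    · have := Real.rpow_le_rpow hw.le h h0
      nlinarith
  have l1 : A * (c * w * a ^ q) = √(A * B) * a * (w * a ^ (q - 1)) := by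
    rw [e3, ← hAc]; ring
  have l2 : (c ^ q)⁻¹ * (B * ((c * w) ^ (q - 1) * a ^ 2))
      = √(A * B) * a * (a * w ^ (q - 1)) := by
    rw [e2]
    nth_rewrite 1 [hBc]
    field_simp
  have l3 : (c ^ q)⁻¹ * (a * (c * w) ^ q) = a * w ^ q := by rw [e1]; field_simp
  rw [l1, l2, l3]
  have := mul_le_mul_of_nonneg_left key (mul_nonneg hκ ha.le)
  linarith

theorem le_of_forall_young {q D F T : ℝ} (hq : 1 ≤ q) (hD : 0 < D) (hT : 1 ≤ T)
    (h : ∀ δ : ℝ, 0 < δ → T ≤ δ * (D * T ^ (1 + 1 / q)) + δ ^ (1 - q) * F + 1) :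
    T ≤ (2 * ((2 * D) ^ (q - 1) * F + 1)) ^ q := by
  have hT0 : 0 < T := by linarith
  have hq0 : 0 < q := by linarith
  have h1 := h ((2 * D)⁻¹ * T ^ (-(1 / q))) (by positivity)
  have e1 : (2 * D)⁻¹ * T ^ (-(1 / q)) * (D * T ^ (1 + 1 / q)) = T / 2 := by
    have : T ^ (-(1 / q)) * T ^ (1 + 1 / q) = T := by
      rw [← Real.rpow_add hT0]; simp
    calc _ = (2 * D)⁻¹ * D * (T ^ (-(1 / q)) * T ^ (1 + 1 / q)) := by ring
      _ = _ := by rw [this]; field_simp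
  have e2 : ((2 * D)⁻¹ * T ^ (-(1 / q))) ^ (1 - q) = (2 * D) ^ (q - 1) * T ^ (1 - 1 / q) := by
    rw [Real.mul_rpow (by positivity) (by positivity), ← Real.rpow_mul hT0.le,
      Real.inv_rpow (by positivity), ← Real.rpow_neg (by positivity)]
    congr 2
    · ring
    · field_simp; ring
  rw [e1, e2] at h1
  have hTp : 1 ≤ T ^ (1 - 1 / q) := Real.one_le_rpow hT (by
    rw [sub_nonneg, div_le_one hq0]; exact hq)
  have e3 : T = T ^ (1 / q) * T ^ (1 - 1 / q) := by
    rw [← Real.rpow_add hT0]; simp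
  have h2 : T ^ (1 / q) * T ^ (1 - 1 / q)
      ≤ (2 * ((2 * D) ^ (q - 1) * F + 1)) * T ^ (1 - 1 / q) := by
    rw [← e3]; nlinarith
  have h3 := le_of_mul_le_mul_right h2 (by linarith)
  have h4 := Real.rpow_le_rpow (by positivity) h3 hq0.le
  rwa [← Real.rpow_mul hT0.le, one_div_mul_cancel hq0.ne', Real.rpow_one] at h4

end MoserAlgebra

section Moser

variable {n : ℕ}

theorem integral_mul_cut_le {z : En n → ℝ} (hz : Continuous z) (hz0 : ∀ x, 0 < z x)
    {q s j δ R : ℝ} (hj : 0 ≤ j) (hs : 0 ≤ s) (ht : 1 ≤ 58 - s * j) (hδ : 0 < δ) (hR : 0 < R) :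
    ∫ x, 1 / R ^ 2 * (z x ^ q * cut R x ^ 58)
      ≤ δ * (∫ x, z x ^ (q + 1) * cut R x ^ (58 + s))
        + 1 / R ^ 2 * (1 / R ^ 2 / δ) ^ j * ∫ x, z x ^ (q - j) * cut R x := by
  have hzc : ∀ p : ℝ, Continuous fun x => z x ^ p :=
    fun p => hz.rpow_const fun x => Or.inl (hz0 x).ne'
  have hc := continuous_cut (n := n) R
  have hcs := hasCompactSupport_cut (n := n) hR
  have hcr : Continuous fun x : En n => cut R x ^ (58 + s) :=
    hc.rpow_const fun x => Or.inr (by linarith)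
  have hcrs : HasCompactSupport fun x : En n => cut R x ^ (58 + s) :=
    hcs.mono fun x hx => by
      simp only [Function.mem_support, ne_eq] at hx ⊢
      exact fun h => hx (by rw [h, Real.zero_rpow (by linarith)])
  have z1 := hzc q
  have z2 := hzc (q + 1)
  have z3 := hzc (q - j)
  have i1 : Integrable fun x => 1 / R ^ 2 * (z x ^ q * cut R x ^ 58) :=
    (by fun_prop : Continuous fun x => 1 / R ^ 2 * (z x ^ q * cut R x ^ 58))
      |>.integrable_of_hasCompactSupport
        ((hasCompactSupport_cut_pow hR (m := 58) (by norm_num)).mul_left.mul_left)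
  have i2 : Integrable fun x => δ * (z x ^ (q + 1) * cut R x ^ (58 + s)) :=
    (by fun_prop : Continuous fun x => δ * (z x ^ (q + 1) * cut R x ^ (58 + s)))
      |>.integrable_of_hasCompactSupport hcrs.mul_left.mul_left
  have i3 : Integrable fun x => 1 / R ^ 2 * (1 / R ^ 2 / δ) ^ j * (z x ^ (q - j) * cut R x) :=
    (by fun_prop : Continuous fun x => 1 / R ^ 2 * (1 / R ^ 2 / δ) ^ j * (z x ^ (q - j) * cut R x))
      |>.integrable_of_hasCompactSupport hcs.mul_left.mul_left
  rw [← integral_const_mul, ← integral_const_mul, ← integral_add i2 i3]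
  refine integral_mono i1 (i2.add i3) fun x => ?_
  have := mul_rpow_cutoff_le (l := 1 / R ^ 2) (p := q) (t := 58) (by positivity) hδ (hz0 x)
    (cut_nonneg R x) (cut_le_one R x) hj hs ht
  have e : cut R x ^ (58 : ℝ) = cut R x ^ 58 := by exact_mod_cast Real.rpow_natCast (cut R x) 58
  rw [e] at this
  exact this

theorem scale_mul_rpow {R δ j : ℝ} (hR : 0 < R) (hδ : 0 < δ) :
    1 / R ^ 2 * (1 / R ^ 2 / δ) ^ j * R ^ (2 * (j + 1)) = δ ^ (-j) := by
  have h1 : R ^ (2 * (j + 1)) = R ^ 2 * (R ^ 2) ^ j := by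
    rw [show 2 * (j + 1) = (2 : ℝ) * j + 2 by ring, Real.rpow_add hR, Real.rpow_mul hR.le]
    norm_cast
    ring
  rw [h1, Real.div_rpow (by positivity) hδ.le, Real.div_rpow (by positivity) (by positivity),
    Real.one_rpow, Real.rpow_neg hδ.le]
  have : (R ^ 2) ^ j ≠ 0 := (Real.rpow_pos_of_pos (by positivity) j).ne'
  field_simp

theorem exp_mul_sq_eq (q t : ℝ) : Real.exp (q / 4 * t) ^ 2 = Real.exp (t / 2) ^ q := by
  rw [← Real.exp_nat_mul, ← Real.exp_mul]
  congr 1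
  push_cast
  ring

theorem rpow_half_sq {t q : ℝ} (ht : 0 < t) : (t ^ (q / 2)) ^ 2 = t ^ q := by
  rw [← Real.rpow_natCast, ← Real.rpow_mul ht.le]
  congr 1
  push_cast
  ring

theorem exp_half_sq (t : ℝ) : Real.exp (t / 2) ^ 2 = Real.exp t := by
  rw [← Real.exp_nat_mul]
  congr 1
  push_cast
  ring

end Moser

section Bootstrap

/-- Closing the coupled system of stability, coupling, interpolation, energy and Sobolev
inequalities. -/
theorem exists_bound_of_coupled_system {q A B κ θ B' C₁ C₂ C₃ M N S₀ : ℝ} (hq : 1 ≤ q)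
    (hA : 0 < A) (hB : 0 < B) (hκ : κ < 1) (hθ : 0 < θ) (hB' : 0 ≤ B') (hC₁ : 0 ≤ C₁)
    (hC₂ : 0 ≤ C₂) (hC₃ : 0 ≤ C₃) (hM : 0 ≤ M) (hS₀ : 0 ≤ S₀) :
    ∃ F : ℝ, ∀ X Y P Q L₁ L₂ E S : ℝ, 0 ≤ X → 0 ≤ Y → 0 ≤ P → 0 ≤ L₂ → 0 ≤ E →
      X ≤ A * P + C₁ * (L₁ + 1) → Y ≤ B * Q + C₂ * (L₂ + 1) →
      A * P + θ * (B * Q) ≤ κ * (X + θ * Y) →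
      (∀ δ : ℝ, 0 < δ → L₁ ≤ δ * X + δ ^ (-q) * M) →
      E ≤ B' * Q + C₃ * L₂ → S ≤ S₀ * E ^ (1 + 1 / q) →
      (∀ δ : ℝ, 0 < δ → L₂ ≤ δ * S + δ ^ (1 - q) * N) → X ≤ F ∧ S ≤ F := by
  have hκ1 : 0 < 1 - κ := by linarith
  set δ₁ := (1 - κ) / (2 * (C₁ + 1)) with hδ₁
  have hδ₁0 : 0 < δ₁ := by positivity
  set M₁ := δ₁ ^ (-q) * M with hM₁
  have hM₁0 : 0 ≤ M₁ := by positivity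
  set K₁ := C₁ * M₁ + C₁ + θ * C₂ with hK₁
  have hK₁0 : 0 ≤ K₁ := by positivity
  set K₂ := 2 * K₁ / (1 - κ) with hK₂
  have hK₂0 : 0 ≤ K₂ := by positivity
  set K₃ := B' * (K₂ / (θ * B)) + C₃ with hK₃
  have hK₃0 : 0 ≤ K₃ := by positivity
  set D := S₀ * K₃ ^ (1 + 1 / q) + 1 with hD
  have hD0 : 0 < D := by positivity
  set T₀ := (2 * ((2 * D) ^ (q - 1) * N + 1)) ^ q with hT₀
  refine ⟨max (K₂ * T₀) (D * T₀ ^ (1 + 1 / q)), ?_⟩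
  intro X Y P Q L₁ L₂ E S hX0 hY0 hP0 hL0 hE0 hX hY hc hL₁ hE hS hL₂
  clear_value T₀ D K₃ K₂ K₁ M₁ δ₁
  have hθY : 0 ≤ θ * Y := by positivity
  have h1 : C₁ * L₁ ≤ (1 - κ) / 2 * X + C₁ * M₁ := by
    have h2 := mul_le_mul_of_nonneg_left (hL₁ δ₁ hδ₁0) hC₁
    rw [← hM₁] at h2
    have h3 : C₁ * δ₁ ≤ (1 - κ) / 2 := by
      rw [hδ₁, mul_div_assoc', div_le_div_iff₀ (by positivity) (by norm_num)]
      linarith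
    linarith [mul_le_mul_of_nonneg_right h3 hX0]
  have hθ1 := mul_le_mul_of_nonneg_left hY hθ.le
  have hZ : X + θ * Y ≤ K₂ * (L₂ + 1) := by
    rw [hK₂, div_mul_eq_mul_div, le_div_iff₀ hκ1, hK₁]
    have h2 : 0 ≤ (1 - κ) * (θ * Y) := by positivity
    have h3 : 0 ≤ (C₁ * M₁ + C₁) * L₂ := by positivity
    linarith
  have hQ : Q ≤ K₂ / (θ * B) * (L₂ + 1) := by
    rw [div_mul_eq_mul_div, le_div_iff₀ (by positivity)]
    have : 0 ≤ A * P := by positivity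
    have : κ * (X + θ * Y) ≤ 1 * (X + θ * Y) :=
      mul_le_mul_of_nonneg_right hκ.le (by positivity)
    linarith
  have hE1 : E ≤ K₃ * (L₂ + 1) := by
    have := mul_le_mul_of_nonneg_left hQ hB'
    rw [hK₃]
    linarith
  have hSD : S ≤ D * (L₂ + 1) ^ (1 + 1 / q) := by
    have hq0 : 0 ≤ 1 + 1 / q := by positivity
    calc S ≤ S₀ * (K₃ * (L₂ + 1)) ^ (1 + 1 / q) :=
          hS.trans (mul_le_mul_of_nonneg_left (Real.rpow_le_rpow hE0 hE1 hq0) hS₀)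
      _ = S₀ * K₃ ^ (1 + 1 / q) * (L₂ + 1) ^ (1 + 1 / q) := by
          rw [Real.mul_rpow hK₃0 (by linarith)]; ring
      _ ≤ _ := mul_le_mul_of_nonneg_right (by linarith) (by positivity)
  have hT : L₂ + 1 ≤ T₀ := hT₀ ▸ le_of_forall_young hq hD0 (T := L₂ + 1) (by linarith) fun δ hδ => by
    have := mul_le_mul_of_nonneg_left hSD hδ.le
    linarith [hL₂ δ hδ]
  constructor
  · exact le_max_of_le_left ((by linarith : X ≤ X + θ * Y).trans
      (hZ.trans (mul_le_mul_of_nonneg_left hT hK₂0)))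
  · refine le_max_of_le_right (hSD.trans (mul_le_mul_of_nonneg_left ?_ hD0.le))
    exact Real.rpow_le_rpow (by linarith) hT (by positivity)

end Bootstrap

section MoserBound

variable {n : ℕ}

theorem exists_moser_bound {u v η : En n → ℝ} {q k N R₁ : ℝ} (hq : 1 < q) (hq5 : q ≤ 5)
    (hn : (n : ℝ) = 2 * q + 2) (hk : 0 < k) (hkq : k ^ 2 * q ^ 3 < 32 * (q - 1))
    (hu : ContDiff ℝ 2 u) (hv : ContDiff ℝ 2 v) (hv0 : ∀ x, 0 < v x)
    (hlu : ∀ x, lap u x = -v x) (hlv : ∀ x, lap v x = -Real.exp (u x))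
    (hη : Continuous η) (hη01 : ∀ x, 0 ≤ η x ∧ η x ≤ 1) (hη1 : ∀ x, R₁ ≤ ‖x‖ → η x = 1)
    (hS : ∀ φ : En n → ℝ, ContDiff ℝ 1 φ → HasCompactSupport φ →
        ∫ x, (Real.exp (u x / 2) * η x) * φ x ^ 2 ≤ k * ∫ x, gd φ φ x)
    (hN : ∀ R : ℝ, 1 ≤ R → ∫ x, v x * cut R x ≤ N * R ^ n / R ^ 2) :
    ∃ F : ℝ, ∀ R : ℝ, 1 ≤ R →
      ∫ x, Real.exp (u x / 2) ^ (q + 1) * cut R x ^ ((58 : ℝ) + 2) ≤ F ∧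
      ∫ x, v x ^ (q + 1) * cut R x ^ (58 + (2 + 60 / q)) ≤ F := by
  have hq0 : 0 < q := by linarith
  have hq1 : 0 < q - 1 := by linarith
  have hn2 : 2 < n := by
    have : (2 : ℝ) < n := by linarith
    exact_mod_cast this
  set a : En n → ℝ := fun x => Real.exp (u x / 2) with ha
  have huC := hu.continuous
  have hvC := hv.continuous
  have haC : Continuous a := by fun_prop
  have ha0 : ∀ x, 0 < a x := fun x => Real.exp_pos _
  have haq : Continuous fun x => a x ^ q := haC.rpow_const fun x => Or.inl (ha0 x).ne'
  have hvr : ∀ p : ℝ, Continuous fun x => v x ^ p :=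
    fun p => hvC.rpow_const fun x => Or.inl (hv0 x).ne'
  have hvq := hvr q
  have hvq1 := hvr (q - 1)
  have hg₁ : ContDiff ℝ 2 fun x => Real.exp (q / 4 * u x) := (contDiff_const.mul hu).exp
  have hg₂ : ContDiff ℝ 2 fun x => v x ^ (q / 2) := hv.rpow_const_of_ne fun x => (hv0 x).ne'
  have e₁ : ∀ x, Real.exp (q / 4 * u x) ^ 2 = a x ^ q := fun x => exp_mul_sq_eq q (u x)
  have e₂ : ∀ x, (v x ^ (q / 2)) ^ 2 = v x ^ q := fun x => rpow_half_sq (hv0 x)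
  set B' := q ^ 2 / (4 * (q - 1)) with hB'
  have hB'0 : 0 < B' := by positivity
  obtain ⟨C₁, hC₁, h₁⟩ := exists_stability_bound (g := fun x => Real.exp (q / 4 * u x))
    (r := fun x => q / 8 * (v x * a x ^ q)) haC (fun x => (ha0 x).le) hη hη01 hη1 hk.le hS hg₁
    (by fun_prop) (c := 1 / 4) (fun x => by
      rw [gd_exp_mul hu, hlu, e₁ x]; ring)
  have hr₂ : ∀ x, gd (fun x => v x ^ (q / 2)) (fun x => v x ^ (q / 2)) x
      = q / (4 * (q - 1)) * lap (fun y => (v y ^ (q / 2)) ^ 2) x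
        + B' * (v x ^ (q - 1) * a x ^ 2) := fun x => by
    rw [gd_rpow hv hv0 hq, hlv, ← exp_half_sq]; ring
  obtain ⟨C₂, hC₂, h₂⟩ := exists_stability_bound (g := fun x => v x ^ (q / 2))
    (r := fun x => B' * (v x ^ (q - 1) * a x ^ 2)) haC (fun x => (ha0 x).le) hη hη01 hη1 hk.le hS hg₂
    (by fun_prop) hr₂
  obtain ⟨C₃, hC₃, h₃⟩ := exists_energy_bound hg₂
    (r := fun x => B' * (v x ^ (q - 1) * a x ^ 2)) (by fun_prop) hr₂
  obtain ⟨S₀, hS₀, h₄⟩ := exists_sobolev hn2 (p := 2 * (1 + 1 / q)) (by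
    rw [hn, add_sub_cancel_right]; field_simp)
  have hA0 : 0 < k * (q / 8) := by positivity
  have hB0 : 0 < k * B' := by positivity
  obtain ⟨θ, hθ, h₅⟩ := exists_coupling hA0 hB0 hq.le
  have hκ : √(k * (q / 8) * (k * B')) < 1 := by
    rw [Real.sqrt_lt' one_pos, hB']
    have : k * (q / 8) * (k * (q ^ 2 / (4 * (q - 1)))) = k ^ 2 * q ^ 3 / (32 * (q - 1)) := by
      field_simp; ring
    rw [this, one_pow, div_lt_one (by positivity)]
    exact hkq
  obtain ⟨F, hF⟩ := exists_bound_of_coupled_system (M := ∫ x : En n, unitBump n x) (N := N) hq.le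
    hA0 hB0 hκ hθ hB'0.le hC₁ hC₂ hC₃ (integral_nonneg fun _ => unitBump_nonneg _) hS₀
  refine ⟨F, fun R hR => ?_⟩
  have hR0 : 0 < R := by linarith
  have hcC := continuous_cut (n := n) R
  have hc2 : HasCompactSupport fun x : En n => (cut R x ^ 30) ^ 2 :=
    hasCompactSupport_sq (hasCompactSupport_cut_pow hR0 (by norm_num))
  have eX : ∀ x : En n, a x ^ (q + 1) * cut R x ^ ((58 : ℝ) + 2)
      = a x * a x ^ q * (cut R x ^ 30) ^ 2 := fun x => by
    rw [Real.rpow_add_one (ha0 x).ne', show (58 : ℝ) + 2 = (60 : ℕ) by norm_num,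
      Real.rpow_natCast]
    ring
  have hcR : R ^ n = R ^ (2 * (q + 1)) := by
    rw [← Real.rpow_natCast, hn]; congr 1; ring
  have hcR2 : R ^ n / R ^ 2 = R ^ (2 * (q - 1 + 1)) := by
    rw [hcR, ← Real.rpow_natCast R 2, ← Real.rpow_sub hR0]; congr 1; push_cast; ring
  have cn := cut_nonneg (n := n) R
  have iP : Integrable fun x => v x * a x ^ q * (cut R x ^ 30) ^ 2 :=
    (by fun_prop : Continuous fun x => v x * a x ^ q * (cut R x ^ 30) ^ 2)
      |>.integrable_of_hasCompactSupport hc2.mul_left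
  have iQ : Integrable fun x => v x ^ (q - 1) * a x ^ 2 * (cut R x ^ 30) ^ 2 :=
    (by fun_prop : Continuous fun x => v x ^ (q - 1) * a x ^ 2 * (cut R x ^ 30) ^ 2)
      |>.integrable_of_hasCompactSupport hc2.mul_left
  have iX : Integrable fun x => a x * a x ^ q * (cut R x ^ 30) ^ 2 :=
    (by fun_prop : Continuous fun x => a x * a x ^ q * (cut R x ^ 30) ^ 2)
      |>.integrable_of_hasCompactSupport hc2.mul_left
  have iY : Integrable fun x => a x * v x ^ q * (cut R x ^ 30) ^ 2 :=
    (by fun_prop : Continuous fun x => a x * v x ^ q * (cut R x ^ 30) ^ 2)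
      |>.integrable_of_hasCompactSupport hc2.mul_left
  refine hF (∫ x, a x ^ (q + 1) * cut R x ^ ((58 : ℝ) + 2))
    (∫ x, a x * v x ^ q * (cut R x ^ 30) ^ 2) (∫ x, v x * a x ^ q * (cut R x ^ 30) ^ 2)
    (∫ x, v x ^ (q - 1) * a x ^ 2 * (cut R x ^ 30) ^ 2)
    (∫ x, 1 / R ^ 2 * (a x ^ q * cut R x ^ 58)) (∫ x, 1 / R ^ 2 * (v x ^ q * cut R x ^ 58))
    (∫ x, gd (fun y => v y ^ (q / 2) * cut R y ^ 30) (fun y => v y ^ (q / 2) * cut R y ^ 30) x)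
    (∫ x, v x ^ (q + 1) * cut R x ^ (58 + (2 + 60 / q)))
    (integral_nonneg fun x => ?_) (integral_nonneg fun x => ?_) (integral_nonneg fun x => ?_)
    (integral_nonneg fun x => ?_) (integral_nonneg fun x => gd_self_nonneg _ _) ?_ ?_ ?_ ?_ ?_ ?_ ?_
  · have := ha0 x; have := cn x; positivity
  · have := ha0 x; have := hv0 x; positivity
  · have := ha0 x; have := hv0 x; positivity
  · have := hv0 x; have := cn x; positivity
  · have := h₁ R hR0
    simp only [e₁] at this
    simp only [eX]
    refine this.trans (le_of_eq ?_)
    rw [mul_assoc k, ← integral_const_mul (q / 8)]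
    simp only [mul_assoc]
  · have := h₂ R hR0
    simp only [e₂] at this
    refine this.trans (le_of_eq ?_)
    rw [mul_assoc k, ← integral_const_mul B']
    simp only [mul_assoc]
  · simp only [eX]
    rw [← integral_const_mul, ← integral_const_mul, ← integral_const_mul, ← integral_const_mul,
      ← integral_add (iP.const_mul _) ((iQ.const_mul _).const_mul _),
      ← integral_add iX (iY.const_mul _), ← integral_const_mul]
    refine integral_mono ((iP.const_mul _).add ((iQ.const_mul _).const_mul _))
      ((iX.add (iY.const_mul _)).const_mul _) fun x => ?_
    have h := mul_le_mul_of_nonneg_right (h₅ (a x) (v x) (ha0 x) (hv0 x))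
      (by positivity : 0 ≤ (cut R x ^ 30) ^ 2)
    beta_reduce
    linarith
  · intro δ hδ
    refine (integral_mul_cut_le haC ha0 hq0.le zero_le_two (by linarith) hδ hR0).trans
      (le_of_eq ?_)
    congr 1
    simp only [sub_self, Real.rpow_zero, one_mul]
    rw [integral_cut hR0, ← mul_assoc, hcR, scale_mul_rpow hR0 hδ]
  · have := h₃ R hR0
    simp only [e₂] at this
    refine this.trans (le_of_eq ?_)
    rw [← integral_const_mul B']
    simp only [mul_assoc]
  · have := h₄ (fun y => v y ^ (q / 2) * cut R y ^ 30)
      ((hg₂.of_le (by norm_num)).mul ((contDiff_cut R (k := 1)).pow 30))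
      (hasCompactSupport_cut_pow hR0 (by norm_num)).mul_left
    rw [mul_div_cancel_left₀ _ (two_ne_zero' ℝ)] at this
    refine le_of_eq_of_le (integral_congr_ae (Eventually.of_forall fun x => ?_)) this
    have hx := hv0 x
    beta_reduce
    rw [abs_of_nonneg (mul_nonneg (by positivity) (pow_nonneg (cn x) _)),
      Real.mul_rpow (by positivity) (pow_nonneg (cn x) _), ← Real.rpow_mul hx.le,
      ← Real.rpow_natCast, ← Real.rpow_mul (cn x)]
    congr 2
    · field_simp
    · push_cast; field_simp; ring
  · intro δ hδ
    have ht : 1 ≤ 58 - (2 + 60 / q) * (q - 1) := by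
      have h1 : (2 + 60 / q) * (q - 1) = 58 + 2 * q - 60 / q := by field_simp; ring
      have h2 : 12 ≤ 60 / q := by rw [le_div_iff₀ hq0]; linarith
      linarith
    refine (integral_mul_cut_le hvC hv0 hq1.le (by positivity) ht hδ hR0).trans ?_
    refine add_le_add_right ?_ _
    simp only [sub_sub_cancel, Real.rpow_one]
    calc _ ≤ 1 / R ^ 2 * (1 / R ^ 2 / δ) ^ (q - 1) * (N * R ^ n / R ^ 2) :=
          mul_le_mul_of_nonneg_left (hN R hR) (by positivity)
      _ = 1 / R ^ 2 * (1 / R ^ 2 / δ) ^ (q - 1) * R ^ (2 * (q - 1 + 1)) * N := by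
          rw [← hcR2]; ring
      _ = _ := by rw [scale_mul_rpow hR0 hδ, neg_sub]

end MoserBound

section Averages

variable {n : ℕ}

theorem integrable_of_integral_cut_le {f : En n → ℝ} (hf : Continuous f) (hf0 : ∀ x, 0 ≤ f x)
    {m F : ℝ} (hm : 0 < m) (h : ∀ R : ℝ, 1 ≤ R → ∫ x, f x * cut R x ^ m ≤ F) : Integrable f := by
  refine AECover.integrable_of_integral_bounded_of_nonneg_ae
    (aecover_closedBall (μ := volume) (x := (0 : En n)) (l := atTop) (r := fun R : ℝ => R) tendsto_id)
    F (fun R => hf.continuousOn.integrableOn_compact (isCompact_closedBall _ _))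
    (Eventually.of_forall hf0) ?_
  filter_upwards [eventually_ge_atTop (1 : ℝ)] with R hR
  have hR0 : 0 < R := by linarith
  have hcm : Continuous fun x : En n => cut R x ^ m :=
    (continuous_cut R).rpow_const fun x => Or.inr hm.le
  have hcs : HasCompactSupport fun x : En n => cut R x ^ m :=
    (hasCompactSupport_cut hR0).mono fun x hx => by
      simp only [Function.mem_support, ne_eq] at hx ⊢
      exact fun h => hx (by rw [h, Real.zero_rpow hm.ne'])
  have hi : Integrable fun x => f x * cut R x ^ m :=
    (by fun_prop : Continuous fun x => f x * cut R x ^ m).integrable_of_hasCompactSupport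
      hcs.mul_left
  calc ∫ x in closedBall (0 : En n) R, f x
      = ∫ x in closedBall (0 : En n) R, f x * cut R x ^ m :=
        setIntegral_congr_fun measurableSet_closedBall fun x hx => by
          simp only [cut_eq_one hR0 (by simpa using hx), Real.one_rpow, mul_one]
    _ ≤ ∫ x, f x * cut R x ^ m := setIntegral_le_integral hi
        (Eventually.of_forall fun x => mul_nonneg (hf0 x) (Real.rpow_nonneg (cut_nonneg R x) _))
    _ ≤ F := h R hR

theorem tendsto_integral_mul_one_sub_cut {w : En n → ℝ} (hw : Integrable w) :
    Tendsto (fun R : ℝ => ∫ x, w x * (1 - cut R x)) atTop (nhds 0) := by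
  rw [show (0 : ℝ) = ∫ _ : En n, (0 : ℝ) by simp]
  refine tendsto_integral_filter_of_dominated_convergence (fun x => ‖w x‖)
    (Eventually.of_forall fun R => hw.aestronglyMeasurable.mul
      (continuous_const.sub (continuous_cut R)).aestronglyMeasurable)
    (Eventually.of_forall fun R => Eventually.of_forall fun x => ?_) hw.norm
    (Eventually.of_forall fun x => ?_)
  · rw [norm_mul]
    refine mul_le_of_le_one_right (norm_nonneg _) ?_
    rw [Real.norm_eq_abs, abs_le]
    have h0 := cut_nonneg R x
    have h1 := cut_le_one R x
    constructor <;> linarith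
  · refine tendsto_const_nhds.congr' ?_
    filter_upwards [eventually_ge_atTop (max 1 ‖x‖)] with R hR
    rw [cut_eq_one (by linarith [le_max_left 1 ‖x‖]) ((le_max_right _ _).trans hR), sub_self,
      mul_zero]

theorem le_add_rpow {s δ t : ℝ} (hs : 1 ≤ s) (hδ : 0 < δ) (ht : 0 ≤ t) :
    t ≤ δ + δ ^ (1 - s) * t ^ s := by
  rcases le_or_gt t δ with h | h
  · have : 0 ≤ δ ^ (1 - s) * t ^ s := by positivity
    linarith
  · have ht0 : 0 < t := hδ.trans h
    have h1 : t ^ (1 - s) ≤ δ ^ (1 - s) := Real.rpow_le_rpow_of_nonpos hδ h.le (by linarith)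
    have h2 : t = t ^ (1 - s) * t ^ s := by
      rw [← Real.rpow_add ht0]; simp
    have h3 : t ^ (1 - s) * t ^ s ≤ δ ^ (1 - s) * t ^ s :=
      mul_le_mul_of_nonneg_right h1 (by positivity)
    linarith

theorem sq_mul_le_add_rpow {s δ R z χ h : ℝ} (hs1 : 1 ≤ s) (hs : 2 * s = n) (hδ : 0 < δ)
    (hR : 0 < R) (hz : 0 < z) (hχ0 : 0 ≤ χ) (hχ1 : χ ≤ 1) (h0 : 0 ≤ h) (h1 : h ≤ 1) :
    R ^ 2 * (z * h) ≤ R ^ 2 * (z * χ) + δ * h + δ ^ (1 - s) * R ^ n * (z ^ s * (1 - χ)) := by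
  have h2 : 0 ≤ 1 - χ := by linarith
  have h3 := le_add_rpow hs1 hδ (t := R ^ 2 * (z * (1 - χ))) (by positivity)
  have h4 : (R ^ 2 * (z * (1 - χ))) ^ s ≤ R ^ n * (z ^ s * (1 - χ)) := by
    have h5 : (R ^ 2) ^ s = R ^ n := by
      rw [← Real.rpow_natCast, ← Real.rpow_mul hR.le, ← Real.rpow_natCast R n, ← hs]
      norm_cast
    have h6 : (1 - χ) ^ s ≤ 1 - χ := by
      simpa using Real.rpow_le_rpow_of_exponent_ge_of_imp h2 (by linarith) hs1
        (fun _ h => absurd h (zero_lt_one.trans_le hs1).ne')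
    rw [Real.mul_rpow (by positivity) (by positivity), Real.mul_rpow hz.le h2, h5]
    gcongr
  have hd : 0 ≤ δ ^ (1 - s) := by positivity
  have h5 := mul_le_mul_of_nonneg_left h4 hd
  have h6 : 0 ≤ R ^ 2 * (z * χ) := by positivity
  have h7 : 0 ≤ δ ^ (1 - s) * (R ^ n * (z ^ s * (1 - χ))) := by positivity
  have h8 := mul_le_mul_of_nonneg_right (h3.trans (add_le_add_right h5 δ)) h0
  have h9 := mul_le_mul_of_nonneg_left h1 h6
  have h10 := mul_le_mul_of_nonneg_left h1 h7
  linarith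

theorem exists_sq_mul_average_le (hn : 3 ≤ n) {v : En n → ℝ} (hv : Continuous v)
    (hv0 : ∀ x, 0 < v x) {s : ℝ} (hs : 2 * s = n) (hi : Integrable fun x => v x ^ s) {ε : ℝ}
    (hε : 0 < ε) :
    ∃ R₀ : ℝ, 1 ≤ R₀ ∧ ∀ R : ℝ, R₀ ≤ R → R ^ 2 * ∫ y, v (R • y) * kerH y ≤ ε := by
  have hs1 : 1 ≤ s := by
    have : (3 : ℝ) ≤ n := by exact_mod_cast hn
    linarith
  set m := ∫ y : En n, kerH y with hm
  have hm0 : 0 ≤ m := integral_nonneg kerH_nonneg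
  set δ := ε / (3 * (m + 1)) with hδ
  have hδ0 : 0 < δ := by positivity
  have hδm : δ * m ≤ ε / 3 := by
    rw [hδ, div_mul_eq_mul_div, div_le_div_iff₀ (by positivity) (by norm_num)]
    nlinarith
  obtain ⟨k, hk, hk0⟩ : ∃ k : ℝ, δ ^ (1 - s) * (∫ x, v x ^ s * (1 - cut k x)) ≤ ε / 3 ∧ 0 < k := by
    have h := (tendsto_integral_mul_one_sub_cut hi).const_mul (δ ^ (1 - s))
    rw [mul_zero] at h
    exact ((h.eventually_le_const (show 0 < ε / 3 by positivity)).and (eventually_gt_atTop 0)).exists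
  have hcC := continuous_cut (n := n) k
  have hcc := hasCompactSupport_cut (n := n) hk0
  have hkH : Continuous (kerH (n := n)) := (contDiff_kerH (k := 0)).continuous
  have hvs : Continuous fun x => v x ^ s := hv.rpow_const fun x => Or.inl (hv0 x).ne'
  set I := ∫ x, v x * cut k x with hI
  have hI0 : 0 ≤ I := integral_nonneg fun x => mul_nonneg (hv0 x).le (cut_nonneg k x)
  have i1 : Integrable fun x => v x * cut k x :=
    (by fun_prop : Continuous fun x => v x * cut k x).integrable_of_hasCompactSupport hcc.mul_left
  have i2 : Integrable fun x => v x ^ s * (1 - cut k x) := by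
    refine hi.mono (by fun_prop : Continuous _).aestronglyMeasurable (Eventually.of_forall fun x => ?_)
    have h0 := cut_nonneg k x
    have h1 := cut_le_one k x
    rw [norm_mul]
    refine mul_le_of_le_one_right (norm_nonneg _) ?_
    rw [Real.norm_eq_abs, abs_le]
    constructor <;> linarith
  refine ⟨max 1 (3 * I / ε), le_max_left _ _, fun R hR => ?_⟩
  have hR1 : 1 ≤ R := (le_max_left _ _).trans hR
  have hR0 : 0 < R := by linarith
  have hRI : 3 * I / ε ≤ R := (le_max_right _ _).trans hR
  have j1 : Integrable fun y => R ^ 2 * (v (R • y) * cut k (R • y)) :=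
    (i1.comp_smul hR0.ne').const_mul _
  have j2 : Integrable fun y : En n => δ * kerH y :=
    (hkH.integrable_of_hasCompactSupport hasCompactSupport_kerH).const_mul _
  have j3 : Integrable fun y => δ ^ (1 - s) * R ^ n * (v (R • y) ^ s * (1 - cut k (R • y))) :=
    (i2.comp_smul hR0.ne').const_mul _
  have key : ∀ y, R ^ 2 * (v (R • y) * kerH y) ≤ R ^ 2 * (v (R • y) * cut k (R • y)) + δ * kerH y
      + δ ^ (1 - s) * R ^ n * (v (R • y) ^ s * (1 - cut k (R • y))) := fun y =>
    sq_mul_le_add_rpow hs1 hs hδ0 hR0 (hv0 _) (cut_nonneg k _) (cut_le_one k _) (kerH_nonneg y)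
      (kerH_le_one y)
  have j4 : Integrable fun y => R ^ 2 * (v (R • y) * cut k (R • y)) + δ * kerH y := j1.add j2
  have hJ : Integrable fun y => R ^ 2 * (v (R • y) * kerH y) :=
    (integrable_comp_smul_mul hv hkH hasCompactSupport_kerH R).const_mul _
  have hmono := integral_mono hJ (j4.add j3) key
  have hsum : ∫ y, (R ^ 2 * (v (R • y) * cut k (R • y)) + δ * kerH y
      + δ ^ (1 - s) * R ^ n * (v (R • y) ^ s * (1 - cut k (R • y))))
      = R ^ 2 * ((R ^ n)⁻¹ * I) + δ * m
        + δ ^ (1 - s) * (∫ x, v x ^ s * (1 - cut k x)) := by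
    rw [integral_add j4 j3, integral_add j1 j2, integral_const_mul, integral_const_mul,
      integral_const_mul, integral_comp_smul_En (fun x => v x * cut k x) hR0,
      integral_comp_smul_En (fun x => v x ^ s * (1 - cut k x)) hR0, ← hI, ← hm]
    clear_value I m
    field_simp
  have h10 : R ^ 2 * ((R ^ n)⁻¹ * I) ≤ ε / 3 := by
    have h11 : R ^ 3 ≤ R ^ n := pow_le_pow_right₀ hR1 hn
    have h12 : R ^ 2 * (R ^ n)⁻¹ ≤ R⁻¹ := by
      rw [← div_eq_mul_inv, div_le_iff₀ (by positivity), inv_mul_eq_div, le_div_iff₀ hR0]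
      linarith [pow_succ R 2]
    have h13 : R⁻¹ * I ≤ ε / 3 := by
      rw [div_le_iff₀ hε] at hRI
      rw [inv_mul_eq_div, div_le_iff₀ hR0]
      linarith
    linarith [mul_le_mul_of_nonneg_right h12 hI0]
  rw [← integral_const_mul]
  exact hmono.trans (hsum.trans_le (by linarith))

theorem exists_le_average_add_log {u v : En n → ℝ} (hu : ContDiff ℝ 2 u)
    (hlu : ∀ x, lap u x = -v x) {ε R₀ : ℝ} (hR₀ : 1 ≤ R₀)
    (h : ∀ R : ℝ, R₀ ≤ R → R ^ 2 * ∫ y, v (R • y) * kerH y ≤ ε) :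
    ∃ C : ℝ, ∀ R : ℝ, R₀ ≤ R → C ≤ (∫ y, u (R • y) * kerG y) + ε * Real.log R := by
  set f : ℝ → ℝ := fun R => (∫ y, u (R • y) * kerG y) + ε * Real.log R with hf
  have hd : ∀ R : ℝ, R₀ ≤ R → HasDerivAt f
      (R * (∫ y, lap u (R • y) * kerH y) + ε * R⁻¹) R := fun R hR => by
    have hR0 : 0 < R := by linarith
    exact (hasDerivAt_average hu hR0).add ((Real.hasDerivAt_log hR0.ne').const_mul ε)
  have hmono : MonotoneOn f (Ici R₀) := by
    refine monotoneOn_of_hasDerivWithinAt_nonneg (convex_Ici R₀)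
      (fun R hR => (hd R hR).continuousAt.continuousWithinAt)
      (fun R hR => (hd R (interior_subset hR)).hasDerivWithinAt) fun R hR => ?_
    have hR1 : R₀ ≤ R := interior_subset hR
    have hR0 : 0 < R := by linarith
    have h1 := h R hR1
    simp only [hlu, neg_mul, integral_neg]
    have h2 : R * (∫ y, v (R • y) * kerH y) ≤ ε * R⁻¹ := by
      rw [← div_eq_mul_inv, le_div_iff₀ hR0]
      linarith
    linarith
  exact ⟨f R₀, fun R hR => hmono self_mem_Ici hR hR⟩

theorem exists_average_le_of_integrable_exp {u : En n → ℝ} (hu : Continuous u) {c : ℝ}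
    (hi : Integrable fun x => Real.exp (c * u x)) :
    ∃ K : ℝ, ∀ R : ℝ, 1 ≤ R →
      c * (∫ y, u (R • y) * kerG y) ≤ (∫ y : En n, kerG y) * (K - n * Real.log R) := by
  set m := ∫ y : En n, kerG y with hm
  have hm0 : 0 < m := integral_kerG_pos
  have hG := continuous_kerG (n := n)
  have hGi : Integrable (kerG (n := n)) := hG.integrable_of_hasCompactSupport hasCompactSupport_kerG
  obtain ⟨M, hM⟩ := hG.bounded_above_of_compact_support hasCompactSupport_kerG
  set I := ∫ x, Real.exp (c * u x) with hI
  refine ⟨Real.log (M * I / m), fun R hR => ?_⟩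
  have hR0 : 0 < R := by linarith
  set U := ∫ y, u (R • y) * kerG y with hU
  set s₀ := c * U / m with hs₀
  have i0 := integrable_comp_smul_mul hu hG hasCompactSupport_kerG R
  have i1 : Integrable fun y => M * Real.exp (c * u (R • y)) := (hi.comp_smul hR0.ne').const_mul _
  have i2 : Integrable fun y => Real.exp s₀ * ((1 - s₀) * kerG y + c * (u (R • y) * kerG y)) :=
    ((hGi.const_mul _).add (i0.const_mul _)).const_mul _
  have key : ∀ y, Real.exp s₀ * ((1 - s₀) * kerG y + c * (u (R • y) * kerG y))
      ≤ M * Real.exp (c * u (R • y)) := fun y => by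
    have h1 := Real.add_one_le_exp (c * u (R • y) - s₀)
    have h2 : Real.exp s₀ * (c * u (R • y) - s₀ + 1) ≤ Real.exp (c * u (R • y)) := by
      have := mul_le_mul_of_nonneg_left h1 (Real.exp_pos s₀).le
      rwa [← Real.exp_add, add_sub_cancel] at this
    have h3 : kerG y ≤ M := (le_abs_self _).trans (hM y)
    calc _ = Real.exp s₀ * (c * u (R • y) - s₀ + 1) * kerG y := by ring
      _ ≤ Real.exp (c * u (R • y)) * kerG y := mul_le_mul_of_nonneg_right h2 (kerG_nonneg y)
      _ ≤ Real.exp (c * u (R • y)) * M := mul_le_mul_of_nonneg_left h3 (Real.exp_pos _).le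
      _ = _ := mul_comm _ _
  have hmono := integral_mono i2 i1 key
  rw [integral_const_mul, integral_add (hGi.const_mul _) (i0.const_mul _), integral_const_mul,
    integral_const_mul, integral_const_mul,
    integral_comp_smul_En (fun x => Real.exp (c * u x)) hR0, ← hm, ← hU, ← hI] at hmono
  have h1 : (1 - s₀) * m + c * U = m := by rw [hs₀]; field_simp; ring
  rw [h1] at hmono
  have h2 : Real.exp s₀ ≤ M * I / m / R ^ n := by
    rw [div_div, le_div_iff₀ (by positivity)]
    have := mul_le_mul_of_nonneg_right hmono (by positivity : 0 ≤ R ^ n)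
    have h3 : M * ((R ^ n)⁻¹ * I) * R ^ n = M * I := by field_simp
    linarith
  have h3 : 0 < M * I / m / R ^ n := (Real.exp_pos _).trans_le h2
  have h4 : 0 < M * I / m := by
    have := mul_pos h3 (by positivity : 0 < R ^ n)
    rwa [div_mul_cancel₀ _ (by positivity)] at this
  have h5 := (Real.le_log_iff_exp_le h3).2 h2
  rw [Real.log_div h4.ne' (by positivity), Real.log_pow] at h5
  have h6 : c * U = m * s₀ := by rw [hs₀]; field_simp
  rw [h6]
  exact mul_le_mul_of_nonneg_left h5 hm0.le

theorem false_of_integrable (hn : 3 ≤ n) {u v : En n → ℝ} (hu : ContDiff ℝ 2 u)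
    (hv : Continuous v) (hv0 : ∀ x, 0 < v x) (hlu : ∀ x, lap u x = -v x) {s c : ℝ}
    (hs : 2 * s = n) (hi : Integrable fun x => v x ^ s) (hc : 0 < c)
    (he : Integrable fun x => Real.exp (c * u x)) : False := by
  set m := ∫ y : En n, kerG y with hm
  have hm0 : 0 < m := integral_kerG_pos
  have hn0 : (0 : ℝ) < n := by exact_mod_cast (by omega : 0 < n)
  set ε := m * n / (2 * c) with hε
  have hε0 : 0 < ε := by positivity
  have hcε : c * ε = m * n / 2 := by rw [hε]; field_simp
  obtain ⟨R₀, hR₀, h1⟩ := exists_sq_mul_average_le hn hv hv0 hs hi hε0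
  obtain ⟨C, hC⟩ := exists_le_average_add_log hu hlu hR₀ h1
  obtain ⟨K, hK⟩ := exists_average_le_of_integrable_exp hu.continuous he
  have hlog := (Real.tendsto_log_atTop.const_mul_atTop (show 0 < m * n / 2 by positivity))
  obtain ⟨R, hR, hR1⟩ :=
    ((hlog.eventually_gt_atTop (m * K - c * C)).and (eventually_ge_atTop R₀)).exists
  have h2 := mul_le_mul_of_nonneg_left (hC R hR1) hc.le
  have h3 := hK R (hR₀.trans hR1)
  have h4 : c * (ε * Real.log R) = m * n / 2 * Real.log R := by rw [← mul_assoc, hcε]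
  rw [mul_add, h4] at h2
  rw [← hm] at h3
  linarith

end Averages

/-- (Theorem 5.1 of the paper.) If `5 ≤ n ≤ 12` then there is no
`u ∈ C⁴(ℝ^n)` with `Δ²u = e^u` on `ℝ^n`, stable outside a compact set, and with
`Δu(x) → 0` as `|x| → ∞`. -/
theorem fourth_order_gelfand_liouville_no_stable_outside_compact
    (n : ℕ) (hn5 : 5 ≤ n) (hn12 : n ≤ 12) :
    ¬ ∃ u : En n → ℝ, ContDiff ℝ (4 : ℕ) u ∧
      (∀ x, lap (fun y => lap u y) x = Real.exp (u x)) ∧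
      (∃ R > 0, Stable4OutsideBall n u R) ∧
      Filter.Tendsto (fun x => lap u x) (Filter.cocompact (En n)) (nhds 0) := by

  rintro ⟨u, hu4, heq, ⟨R, -, hst⟩, h0⟩
  have hu : ContDiff ℝ 2 u := hu4.of_le (by norm_num)
  have huC := hu.continuous
  set v : En n → ℝ := fun x => -lap u x with hv
  have hvs : ContDiff ℝ 2 v := (contDiff_lap (k := 2) (hu4.of_le (by norm_num))).neg
  have hlu : ∀ x, lap u x = -v x := fun x => (neg_neg _).symm
  have hlv : ∀ x, lap v x = -Real.exp (u x) := fun x => by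
    rw [← heq x]
    simp [lap, hv]
  have hv0 : Tendsto v (cocompact (En n)) (nhds 0) := by simpa using h0.neg
  have hpos : ∀ x, 0 < v x := pos_of_lap_neg_of_tendsto_zero hvs
    (fun x => by rw [hlv]; exact neg_lt_zero.2 (Real.exp_pos _)) hv0
  obtain ⟨η, hη, hη01, ⟨R₁, hη1⟩, hS, hS'⟩ :=
    exists_cutoff_of_stable_half hn5 huC hst (show (0 : ℝ) < 1 / 50 by norm_num)
  obtain ⟨C, -, hC⟩ :=
    exists_integral_exp_le (by omega) huC hη.continuous hη01 hη1 (by norm_num) hS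
  obtain ⟨N, -, hN⟩ := exists_integral_mul_unitBump_le hvs.continuous (fun x => (hpos x).le)
    fun R hR => exists_average_le (by omega) huC hvs hlv hv0 hC hR
  set q : ℝ := ((n : ℝ) - 2) / 2 with hq
  have hn5' : (5 : ℝ) ≤ n := by exact_mod_cast hn5
  have hn12' : (n : ℝ) ≤ 12 := by exact_mod_cast hn12
  have hq1 : 1 < q := by rw [hq]; linarith
  have hkq : √(1 + 1 / 50) ^ 2 * q ^ 3 < 32 * (q - 1) := by
    rw [Real.sq_sqrt (by norm_num), hq]
    interval_cases n <;> norm_num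
  obtain ⟨F, hF⟩ := exists_moser_bound hq1 (by rw [hq]; linarith) (by rw [hq]; ring)
    (by positivity) hkq hu hvs hpos hlu hlv hη.continuous hη01 hη1 hS' hN
  have hq0 : 0 < q := by linarith
  have ha : Continuous fun x => Real.exp (u x / 2) ^ (q + 1) :=
    (by fun_prop : Continuous fun x => Real.exp (u x / 2)).rpow_const
      fun x => Or.inl (Real.exp_pos _).ne'
  have hi₁ := integrable_of_integral_cut_le ha (fun x => by positivity) (by norm_num)
    fun R hR => (hF R hR).1
  have hi₂ := integrable_of_integral_cut_le
    (hvs.continuous.rpow_const (p := q + 1) fun x => Or.inl (hpos x).ne')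
    (fun x => Real.rpow_nonneg (hpos x).le _) (by positivity) fun R hR => (hF R hR).2
  refine false_of_integrable (by omega) hu hvs.continuous hpos hlu (s := q + 1)
    (c := (q + 1) / 2) (by rw [hq]; ring) hi₂ (by positivity) ?_
  refine hi₁.congr (Eventually.of_forall fun x => ?_)
  beta_reduce
  rw [← Real.exp_mul]
  congr 1
  ring
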